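/- arXiv:1611.01924 — 2 statements merged into one kernel-verified Lean document; each statement's English description precedes it below -/
import Mathlib

section
/- If (V,q) is a regular quadratic O_S-space of rank n ≥ 3 that is isotropic, then the determinant map O_V(O_S) → μ₂(O_S) = {±1} is surjective; that is, there exists an O_S-linear isometry T of (V,q) with det T = −1. -/
/-- The Hasse domain `O_S = {x ∈ K : v_p(x) ≥ 0 for all p ∉ S}`. -/
def hasseDomain {K : Type*} [Field K] {Ω : Type*}
    (v : Ω → AddValuation K (WithTop ℤ)) (S : Finset Ω) : Subring K where
  carrier := {x | ∀ p ∉ S, 0 ≤ v p x}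
  zero_mem' := fun p _ => by simp
  one_mem' := fun p _ => by simp
  add_mem' := fun {x y} hx hy p hp =>
    le_trans (le_min (hx p hp) (hy p hp)) ((v p).map_add x y)
  mul_mem' := fun {x y} hx hy p hp => by
    rw [(v p).map_mul]; exact add_nonneg (hx p hp) (hy p hp)
  neg_mem' := fun {x} hx p hp => by rw [(v p).map_neg]; exact hx p hp

open Polynomial in
/-- Over an algebraic extension of `𝔽_ℓ`, with `ℓ` odd, a nondegenerate diagonal binary form
represents `1`. -/
theorem exists_mul_sq_add_mul_sq_eq_one {k : Type*} [Field k] (ℓ : ℕ) [Fact ℓ.Prime] (hℓ : ℓ ≠ 2)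
    [Algebra (ZMod ℓ) k] [Algebra.IsAlgebraic (ZMod ℓ) k] {α β : k} (hα : α ≠ 0) (hβ : β ≠ 0) :
    ∃ s t : k, α * s ^ 2 + β * t ^ 2 = 1 := by
  let E := IntermediateField.adjoin (ZMod ℓ) ({α, β} : Set k)
  have : FiniteDimensional (ZMod ℓ) E :=
    IntermediateField.finiteDimensional_adjoin fun x _ => Algebra.IsIntegral.isIntegral x
  have : Finite E := Module.finite_of_finite (ZMod ℓ)
  let := Fintype.ofFinite E
  have hchar : CharP E ℓ := charP_of_injective_algebraMap (algebraMap (ZMod ℓ) E).injective ℓ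
  let a : E := ⟨α, IntermediateField.subset_adjoin _ _ (by simp)⟩
  let b : E := ⟨β, IntermediateField.subset_adjoin _ _ (by simp)⟩
  have ha : a ≠ 0 := fun h => hα (congrArg Subtype.val h)
  have hb : b ≠ 0 := fun h => hβ (congrArg Subtype.val h)
  obtain ⟨s, t, h⟩ := FiniteField.exists_root_sum_quadratic
    (f := C a * X ^ 2 + C 0 * X + C (-1)) (g := C b * X ^ 2 + C 0 * X + C 0)
    (degree_quadratic ha) (degree_quadratic hb)
    (FiniteField.odd_card_of_char_ne_two (by rwa [ringChar.eq E ℓ]))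
  simp only [eval_add, eval_mul, eval_C, eval_pow, eval_X] at h
  refine ⟨s, t, ?_⟩
  have h' := congrArg (algebraMap E k) (show a * s ^ 2 + b * t ^ 2 = 1 by linear_combination h)
  simpa using! h'

open Polynomial in
/-- A nonzero element of a prime `p` is transcendental over any subring meeting `p` trivially. -/
theorem transcendental_of_mem_prime {A R : Type*} [CommRing A] [CommRing R] [IsDomain R]
    [Algebra A R] (p : Ideal R) (hp : ∀ a : A, algebraMap A R a ∈ p → a = 0) {π : R}
    (hπ : π ∈ p) (hπ0 : π ≠ 0) : Transcendental A π := by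
  rintro ⟨P, hP, h⟩
  obtain ⟨P', hPP', hX⟩ := exists_eq_pow_rootMultiplicity_mul_and_not_dvd P hP 0
  rw [hPP'] at h
  simp only [map_zero, sub_zero, map_mul, map_pow, aeval_X, mul_eq_zero, pow_eq_zero_iff',
    hπ0, false_and, false_or] at h
  rw [C_0, sub_zero, X_dvd_iff] at hX
  refine hX (hp _ ?_)
  rw [← divX_mul_X_add P'] at h
  simp only [map_add, map_mul, aeval_X, aeval_C] at h
  rw [← neg_mem_iff, ← eq_neg_of_add_eq_zero_left h]
  exact p.mul_mem_left _ hπ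

/-- Quotients of a domain of transcendence degree at most one by nonzero primes are algebraic. -/
theorem isAlgebraic_quotient_of_trdeg_le_one {F R : Type*} [Field F] [CommRing R] [IsDomain R]
    [Algebra F R] (h : Algebra.trdeg F R ≤ 1) (p : Ideal R) (hp : p ≠ ⊥) :
    Algebra.IsAlgebraic F (R ⧸ p) := by
  refine ⟨fun x => ?_⟩
  obtain ⟨a, rfl⟩ := Ideal.Quotient.mk_surjective x
  by_contra hx
  obtain ⟨π, hπ, hπ0⟩ := Submodule.exists_mem_ne_zero_of_ne_bot hp
  have hx' : Transcendental F (algebraMap R (R ⧸ p) a) := hx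
  have ha : Transcendental F a := fun h => hx' (h.algHom (Ideal.Quotient.mkₐ F p))
  have hind : AlgebraicIndependent F (fun _ : Unit => a) :=
    (algebraicIndependent_unique_type_iff (x := fun _ : Unit => a)).2 ha
  have htr : Transcendental (Algebra.adjoin F (Set.range fun _ : Unit => a)) π := by
    refine transcendental_of_mem_prime p ?_ hπ hπ0
    rintro ⟨b, hb⟩ hbp
    rw [Set.range_const, Algebra.adjoin_singleton_eq_range_aeval] at hb
    obtain ⟨P, rfl⟩ := hb
    have hP : Polynomial.aeval (algebraMap R (R ⧸ p) a) P = 0 := by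
      rw [Polynomial.aeval_algebraMap_apply]
      exact Ideal.Quotient.eq_zero_iff_mem.2 hbp
    have : P = 0 := by
      by_contra hne
      exact hx' ⟨P, hne, hP⟩
    subst this
    exact Subtype.ext (map_zero _)
  have := ((hind.option_iff_transcendental π).2 htr).lift_cardinalMk_le_trdeg.trans
    (Cardinal.lift_le.2 h)
  simp at this

theorem Algebra.trdeg_le_one_of_functionField (F K R : Type*) [Field F] [Finite F] [Field K]
    [Algebra (RatFunc F) K] [FunctionField F K] (ℓ : ℕ) [Fact ℓ.Prime] [CharP F ℓ]
    [CommRing R] [Algebra (ZMod ℓ) R] (f : R →+* K) (hf : Function.Injective f) :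
    Algebra.trdeg (ZMod ℓ) R ≤ 1 := by
  let := ZMod.algebra F ℓ
  let : Algebra (Polynomial F) K :=
    ((algebraMap (RatFunc F) K).comp (algebraMap (Polynomial F) (RatFunc F))).toAlgebra
  have : IsScalarTower (Polynomial F) (RatFunc F) K := .of_algebraMap_eq fun _ => rfl
  let : Algebra (Polynomial (ZMod ℓ)) (Polynomial F) := Polynomial.algebra _ _
  let : Algebra (Polynomial (ZMod ℓ)) K :=
    ((algebraMap (Polynomial F) K).comp
      (algebraMap (Polynomial (ZMod ℓ)) (Polynomial F))).toAlgebra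
  have : IsScalarTower (Polynomial (ZMod ℓ)) (Polynomial F) K := .of_algebraMap_eq fun _ => rfl
  have hinj : Function.Injective (algebraMap (Polynomial F) K) :=
    (algebraMap (RatFunc F) K).injective.comp (IsFractionRing.injective _ _)
  have hinj' : Function.Injective (algebraMap (Polynomial (ZMod ℓ)) K) :=
    hinj.comp (Polynomial.map_injective _ (algebraMap (ZMod ℓ) F).injective)
  have : FaithfulSMul (Polynomial (ZMod ℓ)) K := (faithfulSMul_iff_algebraMap_injective _ _).2 hinj'
  let : Algebra (ZMod ℓ) K := ((algebraMap (Polynomial (ZMod ℓ)) K).comp Polynomial.C).toAlgebra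
  have : IsScalarTower (ZMod ℓ) (Polynomial (ZMod ℓ)) K := .of_algebraMap_eq fun _ => rfl
  have : Algebra.IsAlgebraic (Polynomial F) (RatFunc F) :=
    IsLocalization.isAlgebraic _ (nonZeroDivisors (Polynomial F))
  have : Algebra.IsAlgebraic (Polynomial F) K := .trans _ (RatFunc F) _
  have : Algebra.IsAlgebraic (Polynomial (ZMod ℓ)) K := .trans _ (Polynomial F) _
  have hb := (IsTranscendenceBasis.polynomial (R := ZMod ℓ) (ι := Unit)).algebraMap_comp (A := K)
  have h1 : Algebra.trdeg (ZMod ℓ) K = 1 := by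
    have := hb.lift_cardinalMk_eq_trdeg
    simpa using this.symm
  let g : R →ₐ[ZMod ℓ] K := AlgHom.mk f fun r =>
    RingHom.congr_fun (Subsingleton.elim (f.comp (algebraMap (ZMod ℓ) R)) _) r
  have := lift_trdeg_le_of_injective g hf
  rw [h1] at this
  simpa using this

namespace QuadraticMap

section Regular

variable {R V : Type*} [CommRing R] [AddCommGroup V] [Module R V] {Q : QuadraticForm R V}

theorem map_smul_add_smul (a b : R) (u w : V) :
    Q (a • u + b • w) = a ^ 2 * Q u + b ^ 2 * Q w + a * b * Q.polarBilin u w := by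
  have : Q (a • u + b • w) = Q (a • u) + Q (b • w) + polar Q (a • u) (b • w) := by
    simp [polar]
  rw [this, polar_smul_left, polar_smul_right, QuadraticMap.map_smul, QuadraticMap.map_smul,
    polarBilin_apply_apply]
  simp only [smul_eq_mul]
  ring

theorem map_add_eq (u w : V) : Q (u + w) = Q u + Q w + Q.polarBilin u w := by
  simpa using map_smul_add_smul (Q := Q) 1 1 u w

theorem polarBilin_comm (u w : V) : Q.polarBilin u w = Q.polarBilin w u :=
  polar_comm Q u w

theorem polarBilin_self (u : V) : Q.polarBilin u u = 2 * Q u := by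
  simp [polar_self]

theorem polarBilin_mem_of_mem_smul_top (p : Ideal R) {z : V}
    (hz : z ∈ p • (⊤ : Submodule R V)) (w : V) : Q.polarBilin z w ∈ p := by
  have : p • (⊤ : Submodule R V) ≤ Submodule.comap (Q.polarBilin.flip w) p :=
    Submodule.smul_le.2 fun a ha v _ => by simpa using Ideal.mul_mem_right _ p ha
  exact this hz

/-- In a regular quadratic space, vectors pairing into an ideal `p` lie in `pV`. -/
theorem mem_smul_top_of_polarBilin_mem [Module.Projective R V] [Module.Finite R V]
    (hreg : Function.Bijective Q.polarBilin) (p : Ideal R) {z : V}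
    (hz : ∀ w, Q.polarBilin z w ∈ p) : z ∈ p • (⊤ : Submodule R V) := by
  obtain ⟨n, f, g, -, -, hfg⟩ := Module.Finite.exists_comp_eq_id_of_projective R V
  choose y hy using fun i : Fin n => hreg.2 (LinearMap.proj i ∘ₗ g)
  have : z = ∑ i, Q.polarBilin z (f (Pi.single i 1)) • y i := by
    apply hreg.1
    ext w
    have hw : w = ∑ i, g w i • f (Pi.single i 1) := by
      conv_lhs => rw [← LinearMap.id_apply (R := R) w, ← hfg, LinearMap.comp_apply,
        LinearMap.pi_apply_eq_sum_univ f]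
      refine Finset.sum_congr rfl fun i _ => ?_
      congr 2
      ext j
      simp [Pi.single_apply, eq_comm]
    conv_lhs => rw [hw]
    simp only [map_sum, map_smul, LinearMap.sum_apply, LinearMap.smul_apply, hy, smul_eq_mul,
      LinearMap.comp_apply, LinearMap.proj_apply, mul_comm]
  rw [this]
  exact Submodule.sum_mem _ fun i _ => Submodule.smul_mem_smul (hz _) trivial

end Regular

section Domain

variable {R V : Type*} [CommRing R] [IsDomain R] [AddCommGroup V] [Module R V]
  {Q : QuadraticForm R V}

theorem smul_right_injective_of_polarBilin (hreg : Function.Injective Q.polarBilin) {r : R}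
    (hr : r ≠ 0) : Function.Injective fun v : V => r • v := by
  intro u w h
  apply hreg
  ext t
  have := congrArg (fun v => Q.polarBilin v t) h
  simpa [hr] using this

/-- A multiple `(i / b) • x` of an isotropic vector exists whenever it pairs integrally. -/
theorem exists_smul_eq_smul_of_dvd (hreg : Function.Bijective Q.polarBilin) {x : V}
    (hx : Q x = 0) {b i : R} (hb : b ≠ 0) (h : ∀ w, b ∣ i * Q.polarBilin x w) :
    ∃ y, b • y = i • x ∧ Q y = 0 := by
  choose c hc using h
  let ψ : V →ₗ[R] R :=
    { toFun := c
      map_add' := fun u w => mul_left_cancel₀ hb <| by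
        rw [mul_add, ← hc, ← hc, ← hc, map_add, mul_add]
      map_smul' := fun r w => mul_left_cancel₀ hb <| by
        rw [← hc, map_smul, RingHom.id_apply, smul_eq_mul, smul_eq_mul, mul_left_comm b, ← hc]
        ring }
  obtain ⟨y, hy⟩ := hreg.2 ψ
  have hyx : b • y = i • x := by
    apply hreg.1
    ext w
    rw [map_smul, map_smul, hy, LinearMap.smul_apply, LinearMap.smul_apply, smul_eq_mul,
      smul_eq_mul, hc]
    rfl
  refine ⟨y, hyx, ?_⟩
  have := congrArg Q hyx
  rw [QuadraticMap.map_smul, QuadraticMap.map_smul, hx] at this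
  simpa [hb] using this

/-- Modulo a maximal ideal, fewer than `rank V` vectors do not span. -/
theorem exists_smul_notMem_span_sup [Module.Finite R V] (hreg : Function.Injective Q.polarBilin)
    (p : Ideal R) [p.IsMaximal] (s : Finset V) (hs : s.card < Module.finrank R V) {g : R}
    (hg : g ∉ p) : ∃ w : V, g • w ∉ Submodule.span R (s : Set V) ⊔ p • ⊤ := by
  classical
  by_contra! h
  obtain ⟨g', m, hm, hgm⟩ := Ideal.IsMaximal.exists_inv ‹p.IsMaximal› hg
  have hle : (⊤ : Submodule R V) ≤ Submodule.span R (s : Set V) ⊔ p • ⊤ := by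
    intro w _
    have : w = g' • g • w + m • w := by rw [smul_smul, ← add_smul, hgm, one_smul]
    rw [this]
    exact add_mem (Submodule.smul_mem _ _ (h w))
      (Submodule.mem_sup_right (Submodule.smul_mem_smul hm trivial))
  obtain ⟨r, hr, hrle⟩ :=
    Submodule.exists_sub_one_mem_and_smul_le_of_fg_of_le_sup Module.Finite.fg_top le_rfl hle
  have hr0 : r ≠ 0 := by
    rintro rfl
    exact (Ideal.ne_top_iff_one p).1 Ideal.IsPrime.ne_top' (by simpa using neg_mem hr)
  have hmem (w : V) : r • w ∈ Submodule.span R (s : Set V) :=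
    hrle (Submodule.smul_mem_pointwise_smul _ _ _ trivial)
  have hfin := LinearMap.finrank_le_finrank_of_injective
    (f := ((LinearMap.lsmul R V r).codRestrict (Submodule.span R (s : Set V)) hmem))
    (fun u w huw => smul_right_injective_of_polarBilin hreg hr0 (congrArg Subtype.val huw))
  have := finrank_span_finset_le_card (R := R) s
  rw [Set.finrank] at this
  omega

/-- A form regular of rank exceeding `#s` represents a unit modulo `p` on the orthogonal
complement of `s`, the latter being described by a scaled projector `P`. -/
theorem exists_apply_notMem [Module.Projective R V] [Module.Finite R V]
    (hreg : Function.Bijective Q.polarBilin) (p : Ideal R) [hp : p.IsMaximal] (s : Finset V)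
    (hs : s.card < Module.finrank R V) {g : R} (hg : g ∉ p) (P : V →ₗ[R] V)
    (hPg : ∀ w, g • w - P w ∈ Submodule.span R (s : Set V))
    (hPs : ∀ w, ∀ x ∈ s, Q.polarBilin (P w) x = 0) : ∃ w, Q (P w) ∉ p := by
  by_contra! h
  obtain ⟨w, hw⟩ := exists_smul_notMem_span_sup hreg.1 p s hs hg
  refine hw ?_
  rw [← sub_add_cancel (g • w) (P w)]
  refine add_mem (Submodule.mem_sup_left (hPg w)) (Submodule.mem_sup_right ?_)
  refine mem_smul_top_of_polarBilin_mem hreg p fun w' => (hp.isPrime.mem_or_mem ?_).resolve_left hg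
  have h0 : Q.polarBilin (P w) (g • w' - P w') = 0 := by
    have : Submodule.span R (s : Set V) ≤ LinearMap.ker (Q.polarBilin (P w)) :=
      Submodule.span_le.2 fun x hx => hPs w x hx
    exact this (hPg w')
  rw [map_sub, sub_eq_zero, map_smul, smul_eq_mul] at h0
  rw [h0]
  have := h (w + w')
  rw [map_add, map_add_eq] at this
  exact (Submodule.add_mem_iff_right p (add_mem (h w) (h w'))).1 this

/-- If `y`, `f` span a hyperbolic plane modulo `p`, and binary diagonal forms represent `1`
modulo `p`, then the form represents `1` modulo `p` on the complement of the plane. -/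
theorem exists_polarBilin_eq_zero_sub_one_mem_of_hyperbolic [Module.Projective R V]
    [Module.Finite R V] (hreg : Function.Bijective Q.polarBilin) (hn : 4 ≤ Module.finrank R V)
    (h2 : IsUnit (2 : R)) (p : Ideal R) [hp : p.IsMaximal]
    (huniv : ∀ α β : R, α ∉ p → β ∉ p → ∃ s t : R, α * s ^ 2 + β * t ^ 2 - 1 ∈ p)
    {y f : V} (hy : Q y = 0) (hf : Q f = 0) (hyf : Q.polarBilin y f ∉ p) :
    ∃ u, Q.polarBilin y u = 0 ∧ Q u - 1 ∈ p := by
  classical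
  set g := Q.polarBilin y f with hg
  have hfy : Q.polarBilin f y = g := polarBilin_comm f y
  have hyy : Q.polarBilin y y = 0 := by rw [polarBilin_self, hy, mul_zero]
  have hff : Q.polarBilin f f = 0 := by rw [polarBilin_self, hf, mul_zero]
  let P : V →ₗ[R] V :=
    g • LinearMap.id - (Q.polarBilin y).smulRight f - (Q.polarBilin f).smulRight y
  have hP (w : V) : P w = g • w - Q.polarBilin y w • f - Q.polarBilin f w • y := by simp [P]
  have hPy (w : V) : Q.polarBilin y (P w) = 0 := by
    rw [hP, map_sub, map_sub, map_smul, map_smul, map_smul, ← hg, hyy]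
    simp only [smul_eq_mul]
    ring
  have hPf (w : V) : Q.polarBilin f (P w) = 0 := by
    rw [hP, map_sub, map_sub, map_smul, map_smul, map_smul, hff, hfy]
    simp only [smul_eq_mul]
    ring
  obtain ⟨w₁, hw₁⟩ := exists_apply_notMem hreg p {y, f}
    (lt_of_le_of_lt Finset.card_le_two (by omega)) hyf P
    (fun w => by
      have : g • w - P w = Q.polarBilin y w • f + Q.polarBilin f w • y := by
        rw [hP]
        abel
      rw [this]
      exact add_mem (Submodule.smul_mem _ _ (Submodule.subset_span (by simp)))
        (Submodule.smul_mem _ _ (Submodule.subset_span (by simp))))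
    (fun w x hx => by
      rw [polarBilin_comm]
      rcases Finset.mem_insert.1 hx with rfl | hx
      · exact hPy w
      · rw [Finset.mem_singleton.1 hx]
        exact hPf w)
  set u₁ := P w₁ with hu₁
  have h2p : (2 : R) ∉ p := fun h => hp.ne_top (Ideal.eq_top_of_isUnit_mem _ h h2)
  let P₂ : V →ₗ[R] V := (2 * Q u₁) • P - ((Q.polarBilin u₁).comp P).smulRight u₁
  have hP₂ (w : V) : P₂ w = (2 * Q u₁) • P w - Q.polarBilin u₁ (P w) • u₁ := by simp [P₂]
  have hP₂y (w : V) : Q.polarBilin y (P₂ w) = 0 := by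
    rw [hP₂, map_sub, map_smul, map_smul, hPy, hPy]
    simp
  have hP₂f (w : V) : Q.polarBilin f (P₂ w) = 0 := by
    rw [hP₂, map_sub, map_smul, map_smul, hPf, hPf]
    simp
  have hP₂u (w : V) : Q.polarBilin u₁ (P₂ w) = 0 := by
    rw [hP₂, map_sub, map_smul, map_smul, polarBilin_self]
    simp only [smul_eq_mul]
    ring
  obtain ⟨w₂, hw₂⟩ := exists_apply_notMem hreg p {y, f, u₁}
    (lt_of_le_of_lt Finset.card_le_three (by omega)) (g := 2 * Q u₁ * g)
    (fun h => (hp.isPrime.mem_or_mem h).elim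
      (fun h => (hp.isPrime.mem_or_mem h).elim h2p hw₁) hyf) P₂
    (fun w => by
      have : (2 * Q u₁ * g) • w - P₂ w = (2 * Q u₁) • Q.polarBilin y w • f +
          (2 * Q u₁) • Q.polarBilin f w • y + Q.polarBilin u₁ (P w) • u₁ := by
        rw [hP₂, hP]
        module
      rw [this]
      refine add_mem (add_mem ?_ ?_) ?_
      all_goals
        repeat apply Submodule.smul_mem
        exact Submodule.subset_span (by simp))
    (fun w x hx => by
      rw [polarBilin_comm]
      rcases Finset.mem_insert.1 hx with rfl | hx
      · exact hP₂y w
      rcases Finset.mem_insert.1 hx with rfl | hx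
      · exact hP₂f w
      · rw [Finset.mem_singleton.1 hx]
        exact hP₂u w)
  obtain ⟨s, t, hst⟩ := huniv _ _ hw₁ hw₂
  refine ⟨s • u₁ + t • P₂ w₂, ?_, ?_⟩
  · rw [map_add, map_smul, map_smul, hPy, hP₂y]
    simp
  · rw [map_smul_add_smul, hP₂u]
    convert hst using 1
    ring

end Domain

section DedekindDomain

variable {R V : Type*} [CommRing R] [IsDedekindDomain R] [AddCommGroup V] [Module R V]
  {Q : QuadraticForm R V}

/-- Given a maximal ideal `p`, a nonzero isotropic vector can be rescaled, and completed by a second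
isotropic vector, so that the two span a hyperbolic plane modulo `p`. -/
theorem exists_isotropic_polarBilin_notMem (hreg : Function.Bijective Q.polarBilin) {x : V}
    (hx0 : x ≠ 0) (hx : Q x = 0) (p : Ideal R) [hp : p.IsMaximal] :
    ∃ y f, Q y = 0 ∧ Q f = 0 ∧ Q.polarBilin y f ∉ p ∧
      ∀ u, Q.polarBilin y u = 0 → Q.polarBilin x u = 0 := by
  let A : Ideal R := LinearMap.range (Q.polarBilin x)
  have hA : A ≠ 0 := by
    intro h
    apply hx0
    apply hreg.1
    rw [map_zero]
    exact LinearMap.range_eq_bot.1 h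
  obtain ⟨b, hbA, hb⟩ : ∃ b ∈ A, b ∉ A * p := by
    by_contra! h
    have : A * p = A * (1 : Ideal R) := by
      rw [mul_one]
      exact le_antisymm Ideal.mul_le_left h
    exact hp.ne_top ((mul_left_cancel₀ hA this).trans Ideal.one_eq_top)
  have hb0 : b ≠ 0 := by
    rintro rfl
    exact hb (zero_mem _)
  obtain ⟨I, hI⟩ := Ideal.dvd_iff_le.2 ((Ideal.span_singleton_le_iff_mem A).2 hbA)
  obtain ⟨i, hiI, hip⟩ : ∃ i ∈ I, i ∉ p := by
    by_contra! h
    exact hb (Ideal.mul_mono_right h (hI ▸ Ideal.mem_span_singleton_self b))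
  have hi0 : i ≠ 0 := by
    rintro rfl
    exact hip (zero_mem _)
  have hdvd (w : V) : b ∣ i * Q.polarBilin x w := by
    rw [← Ideal.mem_span_singleton, hI, mul_comm]
    exact Ideal.mul_mem_mul hiI (LinearMap.mem_range_self _ w)
  obtain ⟨y, hyx, hy⟩ := exists_smul_eq_smul_of_dvd hreg hx hb0 hdvd
  have hBy (w : V) : b * Q.polarBilin y w = i * Q.polarBilin x w := by
    simpa using congrArg (fun v => Q.polarBilin v w) hyx
  obtain ⟨f, hf⟩ : ∃ f, Q.polarBilin y f ∉ p := by
    by_contra! h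
    have hle : A * Ideal.span {i} ≤ A * (I * p) := by
      rw [← mul_assoc, ← hI, mul_comm]
      refine Ideal.span_singleton_mul_le_iff.2 ?_
      rintro _ ⟨w, rfl⟩
      rw [← hBy]
      exact Ideal.mul_mem_mul (Ideal.mem_span_singleton_self b) (h w)
    rw [← Ideal.dvd_iff_le, mul_dvd_mul_iff_left hA, Ideal.dvd_iff_le,
      Ideal.span_singleton_le_iff_mem] at hle
    exact hip (Ideal.mul_le_right (I := I) hle)
  refine ⟨y, Q.polarBilin y f • f + (-Q f) • y, hy, ?_, ?_, fun u hu => ?_⟩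
  · rw [map_smul_add_smul, hy, polarBilin_comm f y]
    ring
  · rw [map_add, map_smul, map_smul, polarBilin_self, hy, smul_eq_mul]
    simpa using fun h => hf (hp.isPrime.mem_of_pow_mem 2 (by rwa [pow_two]))
  · have := hBy u
    rw [hu, mul_zero] at this
    exact (mul_eq_zero.1 this.symm).resolve_left hi0

/-- Newton iteration by rescaling: a value congruent to `1` modulo an element with a power in `I`
can be improved to a value congruent to `1` modulo `I`. -/
theorem exists_smul_sub_one_mem {R V : Type*} [CommRing R] [AddCommGroup V] [Module R V]
    {Q : QuadraticForm R V} (h2 : IsUnit (2 : R)) (I : Ideal R) {u : V}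
    (h : Q u - 1 ∈ I.radical) : ∃ s : R, Q (s • u) - 1 ∈ I := by
  obtain ⟨d, hd⟩ := h2.exists_right_inv
  have key (n : ℕ) : ∃ s : R, (Q u - 1) ^ 2 ^ n ∣ Q (s • u) - 1 := by
    induction n with
    | zero => exact ⟨1, by simp⟩
    | succ n ih =>
      obtain ⟨s, hs⟩ := ih
      refine ⟨(1 - d * (Q (s • u) - 1)) * s, ?_⟩
      rw [pow_succ, pow_mul]
      refine (pow_dvd_pow_of_dvd hs 2).trans ?_
      refine ⟨d ^ 2 * (Q (s • u) - 1) - 1 + (d ^ 2 - (2 * d - 1)), ?_⟩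
      rw [mul_smul, QuadraticMap.map_smul Q _ (s • u), smul_eq_mul]
      linear_combination (-(Q (s • u)) * (Q (s • u) - 1) + (Q (s • u) - 1) ^ 2) * hd
  obtain ⟨m, hm⟩ := h
  obtain ⟨s, hs⟩ := key m
  exact ⟨s, Ideal.mem_of_dvd I hs (Ideal.pow_mem_of_pow_mem I hm Nat.lt_two_pow_self.le)⟩

/-- If binary diagonal forms with unit coefficients represent `1` modulo each nonzero prime, then
a regular isotropic form of rank at least four represents `1`. -/
theorem exists_apply_eq_one_of_isotropic [Module.Projective R V] [Module.Finite R V]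
    (hreg : Function.Bijective Q.polarBilin) (hn : 4 ≤ Module.finrank R V)
    (h2 : IsUnit (2 : R))
    (huniv : ∀ p : Ideal R, p.IsMaximal → p ≠ ⊥ → ∀ α β : R, α ∉ p → β ∉ p →
      ∃ s t : R, α * s ^ 2 + β * t ^ 2 - 1 ∈ p)
    {x : V} (hx0 : x ≠ 0) (hx : Q x = 0) : ∃ v, Q v = 1 := by
  classical
  have hloc (p : Ideal R) (hp : p.IsMaximal) (hp0 : p ≠ ⊥) :
      ∃ u, Q.polarBilin x u = 0 ∧ Q u - 1 ∈ p := by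
    obtain ⟨y, f, hy, hf, hyf, hyx⟩ := exists_isotropic_polarBilin_notMem hreg hx0 hx p
    obtain ⟨u, hu, hu1⟩ := exists_polarBilin_eq_zero_sub_one_mem_of_hyperbolic hreg hn h2 p
      (huniv p hp hp0) hy hf hyf
    exact ⟨u, hyx u hu, hu1⟩
  have hglob (I : Ideal R) (hI : I ≠ ⊥) : ∃ u, Q.polarBilin x u = 0 ∧ Q u - 1 ∈ I := by
    let s := (UniqueFactorizationMonoid.normalizedFactors I).toFinset
    have hs (p : Ideal R) (hp : p ∈ s) : Prime p :=
      UniqueFactorizationMonoid.prime_of_normalized_factor p (Multiset.mem_toFinset.1 hp)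
    choose! u hu hu1 using hloc
    choose c hc using fun p : Ideal R => IsDedekindDomain.exists_forall_sub_mem_ideal (s := s)
      (fun q => q) (fun _ => 1) hs (fun _ _ _ _ h => h) (fun q => if q = p then 1 else 0)
    let z := ∑ p ∈ s, c p • u p
    have hz : Q.polarBilin x z = 0 := by
      simp only [z, map_sum, map_smul]
      refine Finset.sum_eq_zero fun p hp => ?_
      have := hs p hp
      rw [hu p (Ideal.IsPrime.isMaximal (Ideal.isPrime_of_prime this) this.ne_zero) this.ne_zero,
        smul_zero]
    obtain ⟨r, hr⟩ := exists_smul_sub_one_mem h2 I (u := z) (by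
      rw [Ideal.radical_eq_sInf, Submodule.mem_sInf]
      rintro p ⟨hIp, hp⟩
      have hp0 : p ≠ ⊥ := fun h => hI (le_bot_iff.1 (h ▸ hIp))
      have hpm := hp.isMaximal hp0
      have hps : p ∈ s := Multiset.mem_toFinset.2
        ((Ideal.mem_normalizedFactors_iff hI).2 ⟨hp, hIp⟩)
      have hzp : z - u p ∈ p • (⊤ : Submodule R V) := by
        have : z - u p = ∑ q ∈ s, (c q - if p = q then 1 else 0) • u q := by
          simp [z, sub_smul, Finset.sum_sub_distrib, hps]
        rw [this]
        refine Submodule.sum_mem _ fun q _ => Submodule.smul_mem_smul ?_ trivial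
        simpa using hc q p hps
      have hB (w : V) : Q.polarBilin (z - u p) w ∈ p := polarBilin_mem_of_mem_smul_top p hzp w
      have hQ : Q (z - u p) ∈ p :=
        ((Ideal.unit_mul_mem_iff_mem p h2).1 (polarBilin_self (Q := Q) (z - u p) ▸ hB _))
      have : Q z - 1 = Q (z - u p) + (Q (u p) - 1) + Q.polarBilin (z - u p) (u p) := by
        conv_lhs => rw [← sub_add_cancel z (u p), map_add_eq]
        ring
      rw [this]
      exact add_mem (add_mem hQ (hu1 p hpm hp0)) (hB _))
    exact ⟨r • z, by rw [map_smul, hz, smul_zero], hr⟩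
  let A : Ideal R := LinearMap.range (Q.polarBilin x)
  obtain ⟨b, hbA, hb0⟩ : ∃ b ∈ A, b ≠ 0 := by
    by_contra! h
    apply hx0
    apply hreg.1
    rw [map_zero]
    ext w
    exact h _ (LinearMap.mem_range_self _ w)
  obtain ⟨I, hI⟩ := Ideal.dvd_iff_le.2 ((Ideal.span_singleton_le_iff_mem A).2 hbA)
  have hI0 : I ≠ ⊥ := by
    rintro rfl
    rw [Ideal.mul_bot, Ideal.span_singleton_eq_bot] at hI
    exact hb0 hI
  obtain ⟨u, hu, hu1⟩ := hglob I hI0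
  have hbI : b ∈ Submodule.map (Q.polarBilin x) (I • (⊤ : Submodule R V)) := by
    rw [Submodule.map_smul'', Submodule.map_top]
    change b ∈ I * A
    rw [mul_comm, ← hI]
    exact Ideal.mem_span_singleton_self b
  obtain ⟨w, hw, hwb⟩ := hbI
  have hBw (t : V) : Q.polarBilin w t ∈ I := polarBilin_mem_of_mem_smul_top I hw t
  have hQw : Q w ∈ I := (Ideal.unit_mul_mem_iff_mem I h2).1 (polarBilin_self (Q := Q) w ▸ hBw w)
  set i := 1 - Q (w + u) with hi
  have hiI : i ∈ I := by
    have : i = -(Q w + (Q u - 1) + Q.polarBilin w u) := by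
      rw [hi, map_add_eq]
      ring
    rw [this]
    exact neg_mem (add_mem (add_mem hQw hu1) (hBw u))
  obtain ⟨y, hyx, hy⟩ := exists_smul_eq_smul_of_dvd (i := i) hreg hx hb0 fun t => by
    rw [← Ideal.mem_span_singleton, hI, mul_comm]
    exact Ideal.mul_mem_mul hiI (LinearMap.mem_range_self _ t)
  have hBy (t : V) : b * Q.polarBilin y t = i * Q.polarBilin x t := by
    simpa using congrArg (fun v => Q.polarBilin v t) hyx
  have hyu : Q.polarBilin y u = 0 := mul_left_cancel₀ hb0 (by rw [hBy, hu, mul_zero, mul_zero])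
  have hyw : Q.polarBilin y w = i := mul_left_cancel₀ hb0 (by rw [hBy, hwb, mul_comm])
  refine ⟨y + (w + u), ?_⟩
  rw [map_add_eq y, (Q.polarBilin y).map_add, hyu, hyw, hy, hi]
  ring

end DedekindDomain

end QuadraticMap

/-- The reflection in a vector of norm `1` is an isometry of determinant `-1`. -/
theorem QuadraticMap.exists_isometry_det_eq_neg_one {R V : Type*} (K : Type*) [CommRing R]
    [AddCommGroup V] [Module R V] [Module.Finite R V] [Field K] [Algebra R K]
    {Q : QuadraticForm R V} {v : V} (hv : Q v = 1) :
    ∃ T : V ≃ₗ[R] V, (∀ x, Q (T x) = Q x) ∧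
      LinearMap.det (LinearMap.baseChange K (T : V →ₗ[R] V)) = -1 := by
  have hvv : (-Q.polarBilin v) v = -2 := by
    rw [LinearMap.neg_apply, polarBilin_self, hv, mul_one]
  have h : IsUnit (1 + (-Q.polarBilin v) v) := by
    rw [hvv]
    norm_num
  refine ⟨LinearEquiv.dilatransvection h, fun x => ?_, ?_⟩
  · have hx : LinearEquiv.dilatransvection h x = (1 : R) • x + (-Q.polarBilin v x) • v := by
      rw [LinearEquiv.dilatransvection.apply, one_smul, LinearMap.neg_apply]
    rw [hx, map_smul_add_smul, hv, polarBilin_comm x v]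
    ring
  · rw [LinearEquiv.dilatransvection.coe_toLinearMap, LinearMap.transvection.baseChange,
      LinearMap.transvection.det, Module.Dual.baseChange_apply_tmul, hvv, neg_smul, two_smul]
    norm_num

theorem QuadraticMap.exists_isometry_det_eq_neg_one_of_odd_finrank {R V : Type*} (K : Type*)
    [CommRing R] [IsDomain R] [AddCommGroup V] [Module R V] [Field K] [Algebra R K]
    [IsFractionRing R K] (Q : QuadraticForm R V) (hn : Odd (Module.finrank R V)) :
    ∃ T : V ≃ₗ[R] V, (∀ x, Q (T x) = Q x) ∧
      LinearMap.det (LinearMap.baseChange K (T : V →ₗ[R] V)) = -1 := by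
  refine ⟨LinearEquiv.neg R, fun x => by simp, ?_⟩
  have hneg : LinearMap.baseChange K ((LinearEquiv.neg R : V ≃ₗ[R] V) : V →ₗ[R] V) =
      (-1 : K) • LinearMap.id := by
    ext x
    simp [TensorProduct.tmul_neg]
  have hrank : Module.finrank K (TensorProduct R K V) = Module.finrank R V := by
    rw [IsLocalization.finrank_eq K (nonZeroDivisors R) le_rfl,
      IsLocalizedModule.finrank_eq (nonZeroDivisors R) (TensorProduct.mk R K V 1) le_rfl]
  rw [hneg, LinearMap.det_smul, hrank, hn.neg_one_pow, LinearMap.det_id, mul_one]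

/-- If `(V, q)` is a regular quadratic `O_S`-space of rank `n ≥ 3` which
is isotropic, then the determinant map `O_V(O_S) → μ₂(O_S) = {±1}` is surjective; that is,
there exists an `O_S`-linear self-isometry `T` of `(V, q)` with `det T = −1` (the
determinant being computed after extending scalars to the fraction field `K`). -/
theorem det_surjective_of_isotropic
    (Fq : Type*) [Field Fq] [Fintype Fq] (hq : Odd (Fintype.card Fq))
    (K : Type*) [Field K] [Algebra Fq K] [Algebra (RatFunc Fq) K] (hK : FunctionField Fq K)
    (Ω : Type*) (v : Ω → AddValuation K (WithTop ℤ))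
    (S : Finset Ω) (hS : S.Nonempty)
    [IsDedekindDomain (hasseDomain v S)] [IsFractionRing (hasseDomain v S) K]
    -- (V, q): a finitely generated projective O_S-module with a quadratic form
    (V : Type*) [AddCommGroup V] [Module (hasseDomain v S) V]
    [Module.Projective (hasseDomain v S) V] [Module.Finite (hasseDomain v S) V]
    (Q : QuadraticForm (hasseDomain v S) V)
    -- of rank n ≥ 3
    (n : ℕ) (hn : 3 ≤ n) (hrank : Module.finrank (hasseDomain v S) V = n)
    -- O_S-regular: the symmetric bilinear form B_q(u,w) = q(u+w) − q(u) − q(w) induces an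
    -- isomorphism V ≅ Hom(V, O_S)
    (hreg : Function.Bijective (QuadraticMap.polarBilin Q))
    -- isotropic
    (hiso : ∃ x : V, x ≠ 0 ∧ Q x = 0) :
    -- Conclusion: there is a self-isometry of determinant −1
    ∃ T : V ≃ₗ[hasseDomain v S] V, (∀ x : V, Q (T x) = Q x) ∧
      LinearMap.det (LinearMap.baseChange K (T : V →ₗ[hasseDomain v S] V)) = -1 := by
  rcases Nat.even_or_odd n with heven | hodd
  swap
  · exact QuadraticMap.exists_isometry_det_eq_neg_one_of_odd_finrank K Q (hrank ▸ hodd)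
  obtain ⟨ℓ, hchar⟩ := CharP.exists Fq
  have : Fact ℓ.Prime := ⟨CharP.char_is_prime Fq ℓ⟩
  have hℓ : ℓ ≠ 2 := by
    rintro rfl
    have h := FiniteField.even_card_of_char_two (ringChar.eq Fq 2)
    rw [Nat.odd_iff] at hq
    omega
  have hRat : CharP (RatFunc Fq) ℓ :=
    charP_of_injective_algebraMap (algebraMap Fq (RatFunc Fq)).injective ℓ
  have hK' : CharP K ℓ := charP_of_injective_algebraMap (algebraMap (RatFunc Fq) K).injective ℓ
  have hO : CharP (hasseDomain v S) ℓ :=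
    (algebraMap (hasseDomain v S) K).charP (IsFractionRing.injective _ _) ℓ
  let : Algebra (ZMod ℓ) (hasseDomain v S) := ZMod.algebra _ ℓ
  have h2 : IsUnit (2 : hasseDomain v S) := by
    have h : IsUnit (2 : ZMod ℓ) := by
      refine IsUnit.mk0 _ fun h => hℓ ?_
      rw [← Nat.cast_ofNat, ZMod.natCast_eq_zero_iff] at h
      exact (Nat.prime_dvd_prime_iff_eq Fact.out Nat.prime_two).1 h
    exact map_ofNat (algebraMap (ZMod ℓ) (hasseDomain v S)) 2 ▸ h.map (algebraMap _ _)
  have htr : Algebra.trdeg (ZMod ℓ) (hasseDomain v S) ≤ 1 :=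
    Algebra.trdeg_le_one_of_functionField Fq K _ ℓ (algebraMap (hasseDomain v S) K)
      (IsFractionRing.injective _ _)
  obtain ⟨x, hx0, hx⟩ := hiso
  have h4 : 4 ≤ Module.finrank (hasseDomain v S) V := by
    rw [hrank]
    obtain ⟨m, rfl⟩ := heven
    omega
  obtain ⟨w, hw⟩ := QuadraticMap.exists_apply_eq_one_of_isotropic hreg h4 h2
    (fun p hp hp0 α β hα hβ => by
      have := isAlgebraic_quotient_of_trdeg_le_one htr p hp0
      let := Ideal.Quotient.field p
      obtain ⟨s, t, hst⟩ := exists_mul_sq_add_mul_sq_eq_one (k := hasseDomain v S ⧸ p) ℓ hℓ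
        (α := Ideal.Quotient.mk p α) (β := Ideal.Quotient.mk p β)
        (mt Ideal.Quotient.eq_zero_iff_mem.1 hα) (mt Ideal.Quotient.eq_zero_iff_mem.1 hβ)
      obtain ⟨s, rfl⟩ := Ideal.Quotient.mk_surjective s
      obtain ⟨t, rfl⟩ := Ideal.Quotient.mk_surjective t
      refine ⟨s, t, Ideal.Quotient.eq_zero_iff_mem.1 ?_⟩
      rw [map_sub, map_add, map_mul, map_mul, map_pow, map_pow, map_one, hst, sub_self])
    hx0 hx
  exact QuadraticMap.exists_isometry_det_eq_neg_one K hw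
end

section
/- The local-global Hasse principle holds for a regular isotropic quadratic O_S-space (V,q) of rank ≥ 3 (i.e. |Cl_S(O_V)| = 1, meaning any quadratic O_S-space isomorphic to (V,q) over K and over Ô_p for all p ∉ S is O_S-isomorphic to it) if and only if the order of Pic(O_S) is odd. -/
open IsDedekindDomain

universe u

set_option linter.unusedSectionVars false

section

open QuadraticMap

section Reflection
variable {K E : Type*} [Field K] [AddCommGroup E] [Module K E]

/-- The orthogonal reflection along `x` (the identity if `q x = 0`). -/
def orthReflection (q : QuadraticForm K E) (x : E) : Module.End K E :=
  LinearMap.id - (q.polarBilin x).smulRight ((q x)⁻¹ • x)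

theorem orthReflection_apply (q : QuadraticForm K E) (x y : E) :
    orthReflection q x y = y - (polar q x y * (q x)⁻¹) • x := by
  simp [orthReflection, smul_smul]

theorem quadForm_sub_smul (q : QuadraticForm K E) (x y : E) (c : K) :
    q (y - c • x) = q y - c * polar q x y + c * c * q x := by
  have h := QuadraticMap.map_add q y (-(c • x))
  rw [← sub_eq_add_neg] at h
  rw [h, QuadraticMap.map_neg, QuadraticMap.map_smul, QuadraticMap.polar_neg_right,
    QuadraticMap.polar_smul_right, polar_comm]
  simp only [smul_eq_mul]
  ring

theorem quadForm_orthReflection (q : QuadraticForm K E) (x y : E) :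
    q (orthReflection q x y) = q y := by
  rw [orthReflection_apply, quadForm_sub_smul]
  by_cases h : q x = 0
  · simp [h]
  · field_simp
    ring

theorem orthReflection_mul_self (q : QuadraticForm K E) (x : E) :
    orthReflection q x * orthReflection q x = 1 := by
  ext y
  simp only [Module.End.mul_apply, orthReflection_apply, Module.End.one_apply,
    QuadraticMap.polar_sub_right, QuadraticMap.polar_smul_right, QuadraticMap.polar_self,
    smul_eq_mul]
  by_cases h : q x = 0
  · simp [h]
  · have : polar q x y * (q x)⁻¹ +
      (polar q x y - polar q x y * (q x)⁻¹ * (2 * q x)) * (q x)⁻¹ = 0 := by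
      field_simp; ring
    simp only [nsmul_eq_mul, Nat.cast_ofNat]
    rw [sub_sub, ← add_smul, this, zero_smul, sub_zero]

theorem quadForm_prod_orthReflection (q : QuadraticForm K E) (l : List E) (y : E) :
    q ((l.map (orthReflection q)).prod y) = q y := by
  induction l with
  | nil => simp
  | cons a l ih => simp [quadForm_orthReflection, ih]

theorem prod_reverse_mul_prod_orthReflection (q : QuadraticForm K E) (l : List E) :
    (l.reverse.map (orthReflection q)).prod * (l.map (orthReflection q)).prod = 1 := by
  induction l with
  | nil => simp
  | cons a l ih =>
    simp only [List.reverse_cons, List.map_append, List.prod_append, List.map_cons, List.map_nil,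
      List.prod_cons, List.prod_nil, mul_one]
    rw [mul_assoc, ← mul_assoc (orthReflection q a), orthReflection_mul_self, one_mul, ih]

theorem polar_of_quadForm_comp {q : QuadraticForm K E} {g : Module.End K E}
    (hg : ∀ x, q (g x) = q x) (x y : E) : polar q (g x) (g y) = polar q x y := by
  simp only [polar, ← map_add, hg]

/-- Two vectors with the same norm are exchanged by the reflection along their difference. -/
theorem orthReflection_sub_apply {q : QuadraticForm K E} {x y : E} (h : q x = q y)
    (hxy : q (x - y) ≠ 0) : orthReflection q (x - y) y = x := by
  have h1 : polar q (x - y) y = - q (x - y) := by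
    rw [polar, sub_add_cancel, h]; ring
  rw [orthReflection_apply, h1, neg_mul, mul_inv_cancel₀ hxy, neg_smul, one_smul]
  abel

theorem orthReflection_apply_of_polar_eq_zero {q : QuadraticForm K E} {x y : E}
    (h : polar q x y = 0) : orthReflection q x y = y := by
  simp [orthReflection_apply, h]

/-- Generation of the orthogonal group of a unimodular lattice over a valuation ring in which `2`
is invertible by reflections along vectors of unit norm. -/
theorem exists_list_prod_orthReflection_eq {Γ : Type*} [LinearOrderedCommGroupWithZero Γ]
    (w : Valuation K Γ) (hw2 : w 2 = 1) (q : QuadraticForm K E) (M : AddSubgroup E)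
    (hsmul : ∀ (c : K), w c ≤ 1 → ∀ y ∈ M, c • y ∈ M) (hintegral : ∀ x ∈ M, w (q x) ≤ 1)
    {n : ℕ} (b : Module.Basis (Fin n) K E) (hbM : ∀ i, b i ∈ M) (hb : ∀ i, w (q (b i)) = 1)
    (horth : ∀ i j, i ≠ j → polar q (b i) (b j) = 0)
    (g : Module.End K E) (hg : ∀ x, q (g x) = q x) (hgM : ∀ x ∈ M, g x ∈ M) :
    ∃ l : List E, (∀ x ∈ l, w (q x) = 1) ∧ g = (l.map (orthReflection q)).prod := by
  have hpol : ∀ x ∈ M, ∀ y ∈ M, w (polar q x y) ≤ 1 := fun x hx y hy =>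
    (w.map_sub_le (w.map_sub_le (hintegral _ (M.add_mem hx hy)) (hintegral x hx)) (hintegral y hy))
  have hrefl : ∀ x ∈ M, w (q x) = 1 → ∀ y ∈ M, orthReflection q x y ∈ M := by
    intro x hx h1 y hy
    rw [orthReflection_apply]
    refine M.sub_mem hy (hsmul _ ?_ _ hx)
    rw [map_mul, map_inv₀, h1, inv_one, mul_one]
    exact hpol x hx y hy
  have key : ∀ k ≤ n, ∃ l : List E, (∀ x ∈ l, x ∈ M ∧ w (q x) = 1) ∧
      ∀ i : Fin n, (i : ℕ) < k → (l.map (orthReflection q)).prod (g (b i)) = b i := by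
    intro k
    induction k with
    | zero => exact fun _ => ⟨[], by simp, by simp⟩
    | succ k ih =>
      intro hk
      obtain ⟨l, hl, hfix⟩ := ih (by omega)
      set x := b ⟨k, hk⟩ with hx
      have hgy : ∀ l : List E, (∀ x ∈ l, x ∈ M ∧ w (q x) = 1) → ∀ y ∈ M,
          (l.map (orthReflection q)).prod y ∈ M := by
        intro l
        induction l with
        | nil => intro _ y hy; simpa using hy
        | cons a l ih =>
          intro h y hy
          simp only [List.map_cons, List.prod_cons, Module.End.mul_apply]
          exact hrefl a (h a (by simp)).1 (h a (by simp)).2 _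
            (ih (fun x hx => h x (by simp [hx])) y hy)
      set y := (l.map (orthReflection q)).prod (g x) with hy
      have hxM : x ∈ M := hbM _
      have hyM : y ∈ M := hgy l hl _ (hgM _ hxM)
      have hqy : q y = q x := by rw [hy, quadForm_prod_orthReflection, hg]
      have hperp : ∀ i : Fin n, (i : ℕ) < k → polar q y (b i) = 0 := by
        intro i hi
        rw [← hfix i hi, hy, polar_of_quadForm_comp (quadForm_prod_orthReflection q l),
          polar_of_quadForm_comp hg]
        exact horth _ _ (fun h => by rw [← h] at hi; simp at hi)
      have hperpx : ∀ i : Fin n, (i : ℕ) < k → polar q x (b i) = 0 := fun i hi =>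
        horth _ _ (fun h => by rw [← h] at hi; simp at hi)
      have hpar : q (x - y) + q (x + y) = 2 * 2 * q x := by
        have h1 := quadForm_sub_smul q y x 1
        have h2 := quadForm_sub_smul q y x (-1)
        simp only [one_smul, neg_smul, sub_neg_eq_add] at h1 h2
        rw [h1, h2, hqy]; ring
      have hne : ∀ {a : K}, w a = 1 → a ≠ 0 := fun h h0 => by simp [h0] at h
      have hcase : w (q (x - y)) = 1 ∨ w (q (x + y)) = 1 := by
        by_contra! hc
        have h1 := lt_of_le_of_ne (hintegral _ (M.sub_mem hxM hyM)) hc.1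
        have h2 := lt_of_le_of_ne (hintegral _ (M.add_mem hxM hyM)) hc.2
        have h3 := w.map_add_lt h1 h2
        rw [hpar, map_mul, map_mul, hw2, hb] at h3
        simp at h3
      rcases hcase with hc | hc
      · refine ⟨(x - y) :: l, ?_, ?_⟩
        · simp only [List.mem_cons, forall_eq_or_imp]
          exact ⟨⟨M.sub_mem hxM hyM, hc⟩, hl⟩
        · intro i hi
          simp only [List.map_cons, List.prod_cons, Module.End.mul_apply]
          rcases Nat.lt_succ_iff_lt_or_eq.mp hi with hi | hi
          · rw [hfix i hi]
            apply orthReflection_apply_of_polar_eq_zero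
            rw [QuadraticMap.polar_sub_left, hperp i hi, hperpx i hi, sub_zero]
          · have : i = ⟨k, hk⟩ := Fin.ext hi
            subst this
            exact orthReflection_sub_apply hqy.symm (hne hc)
      · refine ⟨x :: (x + y) :: l, ?_, ?_⟩
        · simp only [List.mem_cons, forall_eq_or_imp]
          exact ⟨⟨hxM, hb _⟩, ⟨M.add_mem hxM hyM, hc⟩, hl⟩
        · intro i hi
          simp only [List.map_cons, List.prod_cons, Module.End.mul_apply]
          rcases Nat.lt_succ_iff_lt_or_eq.mp hi with hi | hi
          · rw [hfix i hi, orthReflection_apply_of_polar_eq_zero (x := x + y)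
              (by rw [QuadraticMap.polar_add_left, hperp i hi, hperpx i hi, add_zero]),
              orthReflection_apply_of_polar_eq_zero (hperpx i hi)]
          · have : i = ⟨k, hk⟩ := Fin.ext hi
            subst this
            have h1 : orthReflection q (x + y) y = -x := by
              have h2 : x + y = y - (-x) := by abel
              have h3 := orthReflection_sub_apply (q := q) (x := y) (y := -x)
                (by rw [QuadraticMap.map_neg, hqy]) (by rw [← h2]; exact hne hc)
              rw [h2]
              nth_rewrite 2 [← h3]
              rw [← Module.End.mul_apply, orthReflection_mul_self, Module.End.one_apply]
            rw [h1, orthReflection_apply, QuadraticMap.polar_neg_right, QuadraticMap.polar_self]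
            have : q x ≠ 0 := hne (hb _)
            simp only [nsmul_eq_mul, Nat.cast_ofNat]
            rw [show -(2 * q x) * (q x)⁻¹ = -2 by field_simp, neg_smul, two_smul]
            abel
  obtain ⟨l, hl, hfix⟩ := key n le_rfl
  refine ⟨l.reverse, fun x hx => (hl x (by simpa using hx)).2, ?_⟩
  have h1 : (l.map (orthReflection q)).prod * g = 1 :=
    b.ext fun i => by simpa using hfix i i.2
  rw [← one_mul g, ← prod_reverse_mul_prod_orthReflection q l, mul_assoc, h1, mul_one]

open CliffordAlgebra

theorem contractLeft_eq_zero_of_mem_adjoin (q : QuadraticForm K E) (d : Module.Dual K E)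
    (s : Set E) (hd : ∀ x ∈ s, d x = 0) {x : CliffordAlgebra q}
    (hx : x ∈ Algebra.adjoin K (ι q '' s)) : contractLeft d x = 0 := by
  suffices h : ∀ y, contractLeft d y = 0 → contractLeft d (x * y) = 0 by
    simpa using h 1 (contractLeft_one ..)
  induction hx using Algebra.adjoin_induction with
  | mem x hx =>
    obtain ⟨v, hv, rfl⟩ := hx
    intro y hy
    rw [contractLeft_ι_mul, hd v hv, hy, zero_smul, mul_zero, sub_zero]
  | algebraMap r => intro y hy; rw [contractLeft_algebraMap_mul, hy, mul_zero]
  | add x y _ _ hx hy => intro z hz; rw [add_mul, map_add, hx z hz, hy z hz, add_zero]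
  | mul x y _ _ hx hy => intro z hz; rw [mul_assoc]; exact hx _ (hy z hz)

theorem exists_eq_add_ι_mul_of_mem_adjoin_insert (q : QuadraticForm K E) (s : Set E) (v : E)
    {x : CliffordAlgebra q} (hx : x ∈ Algebra.adjoin K (ι q '' insert v s)) :
    ∃ a ∈ Algebra.adjoin K (ι q '' s), ∃ c ∈ Algebra.adjoin K (ι q '' s), x = a + ι q v * c := by
  set A := Algebra.adjoin K (ι q '' s)
  suffices h : ∀ y, (∃ a ∈ A, ∃ c ∈ A, y = a + ι q v * c) →
      ∃ a ∈ A, ∃ c ∈ A, x * y = a + ι q v * c by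
    simpa using h 1 ⟨1, A.one_mem, 0, A.zero_mem, by simp⟩
  induction hx using Algebra.adjoin_induction with
  | mem x hx =>
    obtain ⟨u, hu, rfl⟩ := hx
    rintro _ ⟨a, ha, c, hc, rfl⟩
    rcases hu with rfl | hu
    · refine ⟨algebraMap K _ (q u) * c, A.mul_mem (A.algebraMap_mem _) hc, a, ha, ?_⟩
      rw [mul_add, ← mul_assoc, ι_sq_scalar, add_comm]
    · have huA : ι q u ∈ A := Algebra.subset_adjoin ⟨u, hu, rfl⟩
      refine ⟨ι q u * a + algebraMap K _ (polar q u v) * c,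
        A.add_mem (A.mul_mem huA ha) (A.mul_mem (A.algebraMap_mem _) hc),
        - (ι q u * c), A.neg_mem (A.mul_mem huA hc), ?_⟩
      rw [← ι_mul_ι_add_swap]
      noncomm_ring
  | algebraMap r =>
    rintro _ ⟨a, ha, c, hc, rfl⟩
    refine ⟨algebraMap K _ r * a, A.mul_mem (A.algebraMap_mem _) ha,
      algebraMap K _ r * c, A.mul_mem (A.algebraMap_mem _) hc, ?_⟩
    rw [mul_add, ← mul_assoc, Algebra.commutes, mul_assoc]
    congr 1
    rw [← mul_assoc, ← mul_assoc, Algebra.commutes]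
  | add x y _ _ hx hy =>
    intro z hz
    obtain ⟨a, ha, c, hc, h⟩ := hx z hz
    obtain ⟨a', ha', c', hc', h'⟩ := hy z hz
    exact ⟨a + a', A.add_mem ha ha', c + c', A.add_mem hc hc', by
      rw [add_mul, h, h']; noncomm_ring⟩
  | mul x y _ _ hx hy => intro z hz; rw [mul_assoc]; exact hx _ (hy z hz)

/-- An element of a Clifford algebra killed by all contractions is a scalar. -/
theorem mem_bot_of_contractLeft_eq_zero [FiniteDimensional K E] (q : QuadraticForm K E)
    (x : CliffordAlgebra q) (hx : ∀ d : Module.Dual K E, contractLeft d x = 0) :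
    x ∈ (⊥ : Subalgebra K (CliffordAlgebra q)) := by
  classical
  let b := Module.finBasis K E
  have key : ∀ s : Finset (Fin (Module.finrank K E)),
      x ∈ Algebra.adjoin K (ι q '' (b '' s)) → x ∈ (⊥ : Subalgebra K (CliffordAlgebra q)) := by
    intro s
    induction s using Finset.induction_on with
    | empty => simp
    | insert i s hi ih =>
      intro h
      rw [Finset.coe_insert, Set.image_insert_eq] at h
      obtain ⟨a, ha, c, hc, rfl⟩ := exists_eq_add_ι_mul_of_mem_adjoin_insert q _ _ h
      have hd : ∀ v ∈ b '' s, b.coord i v = 0 := by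
        rintro _ ⟨j, hj, rfl⟩
        have : j ≠ i := fun h => hi (h ▸ hj)
        simp [this]
      have h1 := hx (b.coord i)
      rw [map_add, contractLeft_ι_mul, contractLeft_eq_zero_of_mem_adjoin q _ _ hd ha,
        contractLeft_eq_zero_of_mem_adjoin q _ _ hd hc] at h1
      have hc0 : c = 0 := by simpa using h1
      subst hc0
      exact ih (by simpa using ha)
  refine key Finset.univ ?_
  have : Algebra.adjoin K (ι q '' (b '' ((Finset.univ : Finset (Fin (Module.finrank K E))) :
      Set (Fin (Module.finrank K E))))) = ⊤ := by
    rw [eq_top_iff, ← adjoin_range_ι, Algebra.adjoin_le_iff]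
    rintro _ ⟨v, rfl⟩
    rw [SetLike.mem_coe, ← b.sum_repr v, map_sum]
    refine Subalgebra.sum_mem _ fun i _ => ?_
    rw [map_smul]
    refine Subalgebra.smul_mem _ (Algebra.subset_adjoin ?_) _
    exact ⟨_, ⟨i, by simp, rfl⟩, rfl⟩
  rw [this]
  exact Algebra.mem_top

theorem contractLeft_polarBilin (q : QuadraticForm K E) (v : E) (x : CliffordAlgebra q) :
    contractLeft (q.polarBilin v) x = ι q v * x - involute x * ι q v := by
  induction x using CliffordAlgebra.left_induction with
  | algebraMap r => rw [contractLeft_algebraMap, AlgHom.commutes, Algebra.commutes, sub_self]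
  | add x y hx hy => rw [map_add, hx, hy, map_add]; noncomm_ring
  | ι_mul x u hx =>
    rw [contractLeft_ι_mul, hx, map_mul, involute_ι, polarBilin_apply_apply, Algebra.smul_def,
      ← ι_mul_ι_add_swap]
    noncomm_ring

theorem ι_mul_ι_orthReflection {q : QuadraticForm K E} {x : E} (hx : q x ≠ 0) (v : E) :
    ι q x * ι q v = - (ι q (orthReflection q x v) * ι q x) := by
  have h : ι q x * ι q v + ι q v * ι q x = algebraMap K _ (polar q x v) :=
    ι_mul_ι_add_swap x v
  rw [orthReflection_apply, map_sub, map_smul, sub_mul, smul_mul_assoc, ι_sq_scalar,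
    Algebra.smul_def,
    ← map_mul (algebraMap K (CliffordAlgebra q)), inv_mul_cancel_right₀ hx, ← h]
  noncomm_ring

theorem prod_ι_mul_ι {q : QuadraticForm K E} (l : List E) (hl : ∀ x ∈ l, q x ≠ 0) (v : E) :
    (l.map (ι q)).prod * ι q v =
      ι q ((l.map (orthReflection q)).prod v) * involute (l.map (ι q)).prod := by
  induction l with
  | nil => simp
  | cons a l ih =>
    simp only [List.map_cons, List.prod_cons, Module.End.mul_apply, map_mul, involute_ι]
    rw [mul_assoc, ih (fun x hx => hl x (by simp [hx])), ← mul_assoc,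
      ι_mul_ι_orthReflection (hl a (by simp))]
    noncomm_ring

/-- The spinor norm is well defined: if a product of reflections is trivial, then the product of
the norms of the corresponding vectors is a square. -/
theorem isSquare_prod_of_prod_orthReflection_eq_one [FiniteDimensional K E] (h2 : (2 : K) ≠ 0)
    {q : QuadraticForm K E} (hq : ∀ x, (∀ y, polar q x y = 0) → x = 0)
    (l : List E) (hl : ∀ x ∈ l, q x ≠ 0) (h : (l.map (orthReflection q)).prod = 1) :
    IsSquare (l.map q).prod := by
  have : Invertible (2 : K) := invertibleOfNonzero h2
  set s := (l.map (ι q)).prod with hs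
  have hsurj : Function.Surjective q.polarBilin := by
    rw [← LinearMap.injective_iff_surjective_of_finrank_eq_finrank
      (Subspace.dual_finrank_eq).symm, injective_iff_map_eq_zero]
    exact fun x hx => hq x fun y => by rw [← polarBilin_apply_apply, hx]; rfl
  have hbot : involute s ∈ (⊥ : Subalgebra K (CliffordAlgebra q)) := by
    refine mem_bot_of_contractLeft_eq_zero q _ fun d => ?_
    obtain ⟨v, rfl⟩ := hsurj d
    have h1 := prod_ι_mul_ι l hl v
    rw [h, Module.End.one_apply] at h1
    rw [contractLeft_polarBilin, involute_involute, ← h1, sub_self]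
  obtain ⟨c, hc⟩ := Algebra.mem_bot.mp hbot
  have hsc : s = algebraMap K _ c := by
    rw [← involute_involute s, ← hc, AlgHom.commutes]
  have hrev : reverse s * s = algebraMap K _ (l.map q).prod := by
    rw [hs]
    clear_value s
    clear hs h hbot hc hsc
    induction l with
    | nil => simp
    | cons a l ih =>
      simp only [List.map_cons, List.prod_cons, reverse.map_mul, reverse_ι, map_mul]
      rw [mul_assoc, ← mul_assoc (ι q a), ι_sq_scalar, Algebra.left_comm,
        ih (fun x hx => hl x (by simp [hx]))]
  rw [hsc, reverse.commutes, ← map_mul] at hrev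
  exact ⟨c, ((algebraMap K (CliffordAlgebra q)).injective hrev).symm⟩

end Reflection

end

section

open Polynomial

theorem Ideal.map_comap_of_isFractionRing {A R K : Type*} [CommRing A] [IsDedekindDomain A]
    [CommRing R] [IsDomain R] [Field K] [Algebra A R] [Algebra A K]
    [Algebra R K] [IsScalarTower A R K] [IsFractionRing A K] [IsFractionRing R K] (J : Ideal R) :
    (J.comap (algebraMap A R)).map (algebraMap A R) = J := by
  refine le_antisymm Ideal.map_comap_le fun x hx ↦ ?_
  obtain ⟨u, v, hv, huv⟩ := IsFractionRing.div_surjective A (algebraMap R K x)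
  have hv0 : algebraMap A K v ≠ 0 :=
    IsFractionRing.to_map_ne_zero_of_mem_nonZeroDivisors hv
  have huv' : algebraMap A R u = algebraMap A R v * x := by
    apply IsFractionRing.injective R K
    rw [map_mul, ← IsScalarTower.algebraMap_apply, ← IsScalarTower.algebraMap_apply, ← huv]
    field_simp
  have hvR : algebraMap A R v ≠ 0 := fun h ↦ hv0 (by
    rw [IsScalarTower.algebraMap_apply A R K, h, map_zero])
  have hle : Ideal.span {v} ≤ Ideal.span {u, v} := Ideal.span_mono (by simp)
  obtain ⟨D, hD⟩ := Ideal.dvd_iff_le.mpr hle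
  have hmem : ∀ d ∈ D, ∃ w, d * u = v * w := fun d hd ↦ by
    have : u * d ∈ Ideal.span {v} :=
      hD ▸ Ideal.mul_mem_mul (Ideal.subset_span (by simp)) hd
    obtain ⟨w, hw⟩ := Ideal.mem_span_singleton'.mp this
    exact ⟨w, by rw [mul_comm d, ← hw, mul_comm]⟩
  have htop : D.map (algebraMap A R) = ⊤ := by
    have h := congrArg (Ideal.map (algebraMap A R)) hD
    rw [Ideal.map_mul, Ideal.map_span, Ideal.map_span, Set.image_singleton, Set.image_pair,
      huv'] at h
    have h2 : Ideal.span {algebraMap A R v * x, algebraMap A R v} =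
        Ideal.span {algebraMap A R v} := by
      refine le_antisymm (Ideal.span_le.mpr ?_) (Ideal.span_mono (by simp))
      rintro y (rfl | rfl)
      · exact Ideal.mul_mem_right _ _ (Ideal.subset_span rfl)
      · exact Ideal.subset_span rfl
    rw [h2] at h
    rw [Ideal.eq_top_iff_one]
    have h3 : algebraMap A R v ∈ Ideal.span {algebraMap A R v} * D.map (algebraMap A R) :=
      h ▸ Ideal.subset_span rfl
    obtain ⟨z, hz, hz'⟩ := Ideal.mem_span_singleton_mul.mp h3
    rwa [mul_left_cancel₀ hvR (hz'.trans (mul_one _).symm)] at hz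
  have hsub : D.map (algebraMap A R) ≤ Submodule.comap (LinearMap.toSpanSingleton R R x)
      ((J.comap (algebraMap A R)).map (algebraMap A R)) := by
    rw [Ideal.map_le_iff_le_comap]
    intro d hd
    obtain ⟨w, hw⟩ := hmem d hd
    have hw' : algebraMap A R d * x = algebraMap A R w := by
      apply mul_left_cancel₀ hvR
      rw [← map_mul, ← hw, map_mul, huv']
      ring
    simp only [Ideal.mem_comap, Submodule.mem_comap, LinearMap.toSpanSingleton_apply, smul_eq_mul]
    rw [hw']
    refine Ideal.mem_map_of_mem _ ?_
    rw [Ideal.mem_comap, ← hw']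
    exact J.mul_mem_left _ hx
  have := hsub (htop ▸ Submodule.mem_top : (1 : R) ∈ _)
  simpa using this

theorem ClassGroup.extendedHom_surjective_of_isFractionRing {A R : Type*} (K : Type*) [CommRing A]
    [IsDedekindDomain A] [CommRing R] [IsDedekindDomain R] [Field K]
    [Algebra A R] [Algebra A K] [Algebra R K] [IsScalarTower A R K] [IsFractionRing A K]
    [IsFractionRing R K] [Module.IsTorsionFree A R] :
    Function.Surjective (ClassGroup.extendedHom A R) := by
  intro c
  obtain ⟨J, rfl⟩ := ClassGroup.mk0_surjective c
  have hJ := Ideal.map_comap_of_isFractionRing (A := A) (K := K) J.1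
  have hne : J.1.comap (algebraMap A R) ≠ ⊥ := fun h ↦
    mem_nonZeroDivisors_iff_ne_zero.mp J.2 (by rw [← hJ, h, Ideal.map_bot]; rfl)
  refine ⟨ClassGroup.mk0 ⟨_, mem_nonZeroDivisors_iff_ne_zero.mpr hne⟩, ?_⟩
  rw [ClassGroup.extendedHom_mk0]
  congr 1
  exact Subtype.ext hJ

theorem ClassGroup.finite_of_isSeparable {k F K R : Type*} [Field k] [Fintype k] [Field F]
    [Algebra k[X] F] [IsFractionRing k[X] F] [Field K] [Algebra F K] [FiniteDimensional F K]
    [Algebra.IsSeparable F K] [CommRing R] [IsDedekindDomain R] [Algebra R K]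
    [IsFractionRing R K] [Algebra k[X] K] [IsScalarTower k[X] F K]
    (h : ∀ f : k[X], algebraMap k[X] K f ∈ (algebraMap R K).range) : Finite (ClassGroup R) := by
  classical
  let e := RingEquiv.ofBijective (algebraMap R K).rangeRestrict
    ⟨fun x y h ↦ IsFractionRing.injective R K (congrArg Subtype.val h),
      (algebraMap R K).rangeRestrict_surjective⟩
  have he : ∀ x, algebraMap R K (e.symm x) = x := fun x ↦
    congrArg Subtype.val (e.apply_symm_apply x)
  let g : k[X] →+* R := e.symm.toRingHom.comp ((algebraMap k[X] K).codRestrict _ h)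
  let _ : Algebra k[X] R := g.toAlgebra
  have : IsScalarTower k[X] R K := .of_algebraMap_eq fun a ↦ (he ⟨_, h a⟩).symm
  let A := integralClosure k[X] K
  have : IsFractionRing A K := IsIntegralClosure.isFractionRing_of_finite_extension k[X] F K A
  have : IsDedekindDomain A := IsIntegralClosure.isDedekindDomain k[X] F K A
  have : Fintype (ClassGroup A) := ClassGroup.fintypeOfAdmissibleOfFinite F K
    (Polynomial.cardPowDegreeIsAdmissible :
      AbsoluteValue.IsAdmissible (Polynomial.cardPowDegree : AbsoluteValue k[X] ℤ))
  have hmem : ∀ a : A, (a : K) ∈ (algebraMap R K).range := fun a ↦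
    IsIntegrallyClosed.isIntegral_iff.mp (a.2.tower_top (A := R))
  let f : A →+* R := e.symm.toRingHom.comp (A.val.toRingHom.codRestrict _ hmem)
  have hf : ∀ a, algebraMap R K (f a) = a := fun a ↦ he ⟨a, hmem a⟩
  algebraize [f]
  have : IsScalarTower A R K := .of_algebraMap_eq fun a ↦ (hf a).symm
  have : Module.IsTorsionFree A R := Module.isTorsionFree_iff_algebraMap_injective.mpr
    fun x y h ↦ Subtype.ext (by rw [← hf x, ← hf y]; exact congrArg _ h)
  exact Finite.of_surjective _ (ClassGroup.extendedHom_surjective_of_isFractionRing (A := A) K)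

open IntermediateField in
theorem exists_transcendental_isSeparable {k K R : Type*} [Field k] [PerfectField k] (p : ℕ)
    [Fact p.Prime] [CharP k p] [Field K] [Algebra k K] [Algebra.EssFiniteType k K]
    (htr : Algebra.trdeg k K = 1) [CommRing R] [IsDomain R] [Algebra R K] [IsFractionRing R K] :
    ∃ t : R, Transcendental k (algebraMap R K t) ∧
      Algebra.IsSeparable (adjoin k {algebraMap R K t}) K := by
  have : ExpChar k p := .prime Fact.out
  have : CharP K p := .of_ringHom_of_ne_zero (algebraMap k K) p (Fact.out : p.Prime).ne_zero
  obtain ⟨s, hs, hsep⟩ := exists_isTranscendenceBasis_and_isSeparable_of_perfectField k K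
  have hcard : s.card = 1 := by
    have := hs.cardinalMk_eq_trdeg
    rw [htr] at this
    simpa using this
  obtain ⟨s0, rfl⟩ := Finset.card_eq_one.mp hcard
  have hs0 : Transcendental k s0 := by
    have := hs.1.transcendental ⟨s0, by simp⟩
    exact this
  obtain ⟨u, v, hv, huv⟩ := IsFractionRing.div_surjective R s0
  let a : Fin 2 → K := ![algebraMap R K u, algebraMap R K v]
  have ha : ∀ i, ∃ r : R, a i = algebraMap R K r := by
    intro i; fin_cases i
    exacts [⟨u, rfl⟩, ⟨v, rfl⟩]
  have hn : ∃ n : Fin 2, Transcendental k (a n) := by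
    by_contra! h
    have h0 : IsAlgebraic k (algebraMap R K u) := by simpa [Transcendental, a] using h 0
    have h1 : IsAlgebraic k (algebraMap R K v) := by simpa [Transcendental, a] using h 1
    exact hs0 (huv ▸ div_eq_mul_inv (algebraMap R K u) _ ▸ h0.mul h1.inv)
  have hrev : ∀ i j : Fin 2, j ≠ i.rev ↔ j = i := by decide
  obtain ⟨n, hn⟩ := hn
  have hb : IsTranscendenceBasis k fun i : {i // i ≠ n.rev} ↦ a i := by
    let _ : Unique {i // i ≠ n.rev} := ⟨⟨⟨n, (hrev n n).mpr rfl⟩⟩,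
      fun x ↦ Subtype.ext ((hrev n x).mp x.2)⟩
    refine AlgebraicIndependent.isTranscendenceBasis_of_lift_trdeg_le_of_finite
      (algebraicIndependent_unique_type_iff.mpr hn) (by simp [htr])
  obtain ⟨i, hi, hi'⟩ := exists_isTranscendenceBasis_and_isSeparable_of_linearIndepOn_pow p Fact.out
    (fun s hs ↦ by
      apply hs.map_of_injective_injective (frobeniusEquiv k p).symm
        (frobenius K p).toAddMonoidHom <;>
      simp only [Algebra.smul_def, RingHom.toAddMonoidHom_eq_coe, AddMonoidHom.coe_coe,
        frobenius_def, mul_pow, ← map_pow, frobeniusEquiv_symm_pow, implies_true, map_eq_zero,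
        pow_eq_zero_iff (Fact.out : p.Prime).ne_zero, imp_self]) n.rev hb
  have hne : i.rev ≠ i := (by decide : ∀ j : Fin 2, j.rev ≠ j) i
  have himg : a '' {i}ᶜ = {a i.rev} := by
    have : ({i}ᶜ : Set (Fin 2)) = {i.rev} := by
      ext j; have := hrev i.rev j; rw [Fin.rev_rev] at this; simpa using this
    rw [this, Set.image_singleton]
  rw [himg] at hi'
  obtain ⟨t, ht⟩ := ha i.rev
  refine ⟨t, ht ▸ hi.1.transcendental ⟨i.rev, hne⟩, ?_⟩
  rw [← ht]
  set F := adjoin k {a i.rev} with hF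
  let M : IntermediateField F K := separableClosure F K
  have hM : ∀ j, a j ∈ M := by
    intro j
    by_cases hj : j = i
    · exact hj ▸ hi'
    · have : j = i.rev := by
        have := hrev i.rev j; rw [Fin.rev_rev] at this; exact this.mp hj
      rw [this]
      exact M.algebraMap_mem ⟨_, subset_adjoin k _ rfl⟩
  have hs0M : s0 ∈ M := huv ▸ M.div_mem (hM 0) (hM 1)
  have hle : adjoin k ((({s0} : Finset K)) : Set K) ≤ M.restrictScalars k := by
    rw [adjoin_le_iff]
    simpa using hs0M
  have hsep2 : Algebra.IsSeparable M K := by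
    let _ : Algebra (adjoin k ((({s0} : Finset K)) : Set K)) M := (inclusion hle).toAlgebra
    have : IsScalarTower (adjoin k ((({s0} : Finset K)) : Set K)) M K :=
      .of_algebraMap_eq fun _ ↦ rfl
    exact Algebra.isSeparable_tower_top_of_isSeparable
      (adjoin k ((({s0} : Finset K)) : Set K)) M K
  exact Algebra.IsSeparable.trans F M K

theorem ClassGroup.finite_of_trdeg_eq_one {k K R : Type*} [Field k] [Fintype k] [Field K]
    [Algebra k K] [Algebra.EssFiniteType k K] (htr : Algebra.trdeg k K = 1) [CommRing R]
    [IsDedekindDomain R] [Algebra R K] [IsFractionRing R K] : Finite (ClassGroup R) := by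
  classical
  obtain ⟨p, hp⟩ := CharP.exists k
  have : Fact p.Prime := ⟨CharP.char_is_prime k p⟩
  obtain ⟨t, ht, hsep⟩ := exists_transcendental_isSeparable (k := k) (K := K) (R := R) p htr
  set x := algebraMap R K t with hx
  let F := IntermediateField.adjoin k {x}
  let g : k[X] →+* F :=
    (aeval (R := k) (⟨x, IntermediateField.subset_adjoin k _ rfl⟩ : F)).toRingHom
  have hg : ∀ f, (g f : K) = aeval x f := fun f ↦
    (aeval_algHom_apply F.val _ f).symm
  let _ : Algebra k[X] F := g.toAlgebra
  let _ : Algebra k[X] K := (aeval (R := k) x).toRingHom.toAlgebra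
  have : IsScalarTower k[X] F K := .of_algebraMap_eq fun f ↦ (hg f).symm
  have : IsFractionRing k[X] F := by
    have : FaithfulSMul k[X] F := (faithfulSMul_iff_algebraMap_injective _ _).mpr <|
      (injective_iff_map_eq_zero g).mpr fun f hf ↦ by
        by_contra h0
        exact ht ⟨f, h0, by rw [← hg, hf]; rfl⟩
    refine .of_field _ _ fun z ↦ ?_
    obtain ⟨r, s, hrs⟩ := (IntermediateField.mem_adjoin_simple_iff k z.1).mp z.2
    exact ⟨r, s, Subtype.ext (by simpa [hg, RingHom.algebraMap_toAlgebra] using hrs)⟩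
  have : FiniteDimensional F K := by
    have : Algebra.EssFiniteType F K := .of_comp k F K
    exact Algebra.finite_of_essFiniteType_of_isAlgebraic
  refine ClassGroup.finite_of_isSeparable (k := k) (F := F) (K := K) (R := R) fun f ↦ ?_
  change aeval x f ∈ _
  rw [aeval_def, eval₂_eq_sum, Polynomial.sum]
  refine Subring.sum_mem _ fun n _ ↦ Subring.mul_mem _ ?_
    (Subring.pow_mem _ (RingHom.mem_range.mpr ⟨t, rfl⟩) n)
  refine RingHom.mem_range.mpr (IsIntegrallyClosed.isIntegral_iff.mp ?_)
  refine ⟨X ^ Fintype.card k - X, ?_, ?_⟩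
  · exact monic_X_pow_sub (by simpa using Fintype.one_lt_card)
  · simp [← map_pow, FiniteField.pow_card]

theorem ClassGroup.finite_of_functionField {k K R : Type*} [Field k] [Fintype k] [Field K]
    [Algebra (RatFunc k) K] [FunctionField k K] [CommRing R]
    [IsDedekindDomain R] [Algebra R K] [IsFractionRing R K] : Finite (ClassGroup R) := by
  let _ : Algebra k K := ((algebraMap (RatFunc k) K).comp (algebraMap k (RatFunc k))).toAlgebra
  have : IsScalarTower k (RatFunc k) K := .of_algebraMap_eq fun _ ↦ rfl
  have : Algebra.EssFiniteType k[X] (RatFunc k) := .of_isLocalization _ (nonZeroDivisors k[X])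
  have : Algebra.EssFiniteType k (RatFunc k) := .comp k k[X] _
  have : Algebra.EssFiniteType k K := .comp k (RatFunc k) _
  refine ClassGroup.finite_of_trdeg_eq_one (k := k) (K := K) ?_
  have h1 := lift_trdeg_add_eq k (RatFunc k) K
  have h2 := lift_trdeg_add_eq k k[X] (RatFunc k)
  have : Algebra.IsAlgebraic k[X] (RatFunc k) :=
    IsLocalization.isAlgebraic (RatFunc k) (nonZeroDivisors k[X])
  have h3 : Algebra.trdeg k[X] (RatFunc k) = 0 := trdeg_eq_zero
  have h4 : Algebra.trdeg (RatFunc k) K = 0 := trdeg_eq_zero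
  rw [h3, Polynomial.trdeg_of_isDomain] at h2
  rw [h4] at h1
  simp only [Cardinal.lift_zero, add_zero, Cardinal.lift_id] at h1 h2
  rw [← h2] at h1
  simpa using h1.symm

end

section

open QuadraticMap nonZeroDivisors

section Eichler

variable {K E : Type*} [Field K] [AddCommGroup E] [Module K E]

/-- The Eichler transformation attached to an isotropic vector `u` and a vector `w ⊥ u`, where
`c = q w`. -/
def eichlerMap (q : QuadraticForm K E) (u w : E) : Module.End K E :=
  LinearMap.id + (q.polarBilin u).smulRight w - (q.polarBilin w).smulRight u
    - (q w) • (q.polarBilin u).smulRight u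

theorem eichlerMap_apply (q : QuadraticForm K E) (u w y : E) :
    eichlerMap q u w y = y + polar q y u • w - polar q y w • u - (q w * polar q y u) • u := by
  simp [eichlerMap, polar_comm q y, smul_smul]

theorem quadForm_add_smul (q : QuadraticForm K E) (x y : E) (c : K) :
    q (y + c • x) = q y + c * polar q x y + c * c * q x := by
  have := quadForm_sub_smul q x y (-c)
  simp only [neg_smul, sub_neg_eq_add] at this
  rw [this]; ring

theorem quadForm_eichlerMap {q : QuadraticForm K E} {u w : E} (hu : q u = 0)
    (huw : polar q u w = 0) (y : E) : q (eichlerMap q u w y) = q y := by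
  rw [eichlerMap_apply]
  simp only [quadForm_sub_smul, quadForm_add_smul, polar_sub_right, polar_add_right,
    polar_smul_right, polar_self, smul_eq_mul, hu, huw, polar_comm q u y, polar_comm q w y]
  simp
  ring

theorem eichlerMap_neg_eichlerMap {q : QuadraticForm K E} {u w : E} (hu : q u = 0)
    (huw : polar q u w = 0) (y : E) : eichlerMap q u (-w) (eichlerMap q u w y) = y := by
  have huu : polar q u u = 0 := by simp [polar_self, hu]
  have hwu : polar q w u = 0 := by rw [polar_comm, huw]
  have hww : polar q w w = 2 * q w := by simp [polar_self]
  simp only [eichlerMap_apply, polar_sub_left, polar_add_left, polar_smul_left, polar_neg_right,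
    smul_eq_mul, huw, huu, hwu, hww, QuadraticMap.map_neg]
  module

/-- Eichler transformations as isometries. -/
def eichlerIsometry (q : QuadraticForm K E) (u w : E) (hu : q u = 0) (huw : polar q u w = 0) :
    q.IsometryEquiv q where
  toLinearEquiv := LinearEquiv.ofLinearMap (eichlerMap q u w) (eichlerMap q u (-w))
    (LinearMap.ext fun y ↦ by
      simpa using eichlerMap_neg_eichlerMap (w := -w) hu (by simp [polar_neg_right, huw]) y)
    (LinearMap.ext fun y ↦ eichlerMap_neg_eichlerMap hu huw y)
  map_app' y := quadForm_eichlerMap hu huw y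

theorem eichlerIsometry_apply (q : QuadraticForm K E) (u w : E) (hu : q u = 0)
    (huw : polar q u w = 0) (y : E) : eichlerIsometry q u w hu huw y =
      y + polar q y u • w - polar q y w • u - (q w * polar q y u) • u :=
  eichlerMap_apply q u w y

theorem QuadraticMap.IsometryEquiv.polar_apply {q : QuadraticForm K E} (g : q.IsometryEquiv q)
    (x y : E) : polar q (g x) (g y) = polar q x y := by
  simp only [polar, ← map_add, QuadraticMap.IsometryEquiv.map_app]

end Eichler

section Lattice

variable (R : Type*) {K E : Type*} [CommRing R] [IsDedekindDomain R] [Field K] [Algebra R K]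
  [IsFractionRing R K] [AddCommGroup E] [Module K E] [Module R E] [IsScalarTower R K E]

/-- A decomposition of a quadratic space into a hyperbolic plane, with hyperbolic pair `e, f`,
and its orthogonal complement, the latter equipped with a unimodular lattice. -/
structure HyperbolicSplitting (q : QuadraticForm K E) where
  e : E
  f : E
  core : Submodule R E
  map_e : q e = 0
  map_f : q f = 0
  polar_e_f : polar q e f = 1
  polar_core_e : ∀ z ∈ core, polar q z e = 0
  polar_core_f : ∀ z ∈ core, polar q z f = 0
  fg : core.FG
  ne_bot : core ≠ ⊥
  map_core : ∀ z ∈ core, q z ∈ (1 : FractionalIdeal R⁰ K)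
  mem_core : ∀ z, polar q z e = 0 → polar q z f = 0 →
    (∀ w ∈ core, polar q z w ∈ (1 : FractionalIdeal R⁰ K)) → z ∈ core

/-- A submodule of a quadratic space which is its own dual. -/
def IsUnimodular (q : QuadraticForm K E) (N : Submodule R E) : Prop :=
  ∀ x, x ∈ N ↔ ∀ y ∈ N, polar q x y ∈ (1 : FractionalIdeal R⁰ K)

variable {R}

theorem FractionalIdeal.algebraMap_mem_one (r : R) :
    algebraMap R K r ∈ (1 : FractionalIdeal R⁰ K) :=
  (FractionalIdeal.mem_one_iff _).mpr ⟨r, rfl⟩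

theorem FractionalIdeal.mul_mem_one {I : FractionalIdeal R⁰ K} (hI : I ≠ 0) {a b : K} (ha : a ∈ I)
    (hb : b ∈ I⁻¹) : a * b ∈ (1 : FractionalIdeal R⁰ K) :=
  mul_inv_cancel₀ hI ▸ FractionalIdeal.mul_mem_mul ha hb

theorem FractionalIdeal.one_mul_mem {I : FractionalIdeal R⁰ K} {a b : K}
    (ha : a ∈ (1 : FractionalIdeal R⁰ K)) (hb : b ∈ I) : a * b ∈ I := by
  simpa using FractionalIdeal.mul_mem_mul ha hb

theorem FractionalIdeal.add_mem {I : FractionalIdeal R⁰ K} {a b : K} (ha : a ∈ I) (hb : b ∈ I) :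
    a + b ∈ I :=
  Submodule.add_mem (I : Submodule R K) ha hb

theorem FractionalIdeal.sub_mem {I : FractionalIdeal R⁰ K} {a b : K} (ha : a ∈ I) (hb : b ∈ I) :
    a - b ∈ I :=
  Submodule.sub_mem (I : Submodule R K) ha hb

theorem FractionalIdeal.neg_mem {I : FractionalIdeal R⁰ K} {a : K} (ha : a ∈ I) : -a ∈ I :=
  Submodule.neg_mem (I : Submodule R K) ha

theorem FractionalIdeal.zero_mem' {I : FractionalIdeal R⁰ K} : (0 : K) ∈ I :=
  Submodule.zero_mem (I : Submodule R K)

theorem Submodule.smul_mem_of_mem_one (N : Submodule R E) {a : K} {z : E}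
    (ha : a ∈ (1 : FractionalIdeal R⁰ K)) (hz : z ∈ N) : a • z ∈ N := by
  obtain ⟨r, rfl⟩ := (FractionalIdeal.mem_one_iff _).mp ha
  rw [algebraMap_smul]
  exact N.smul_mem r hz

/-- If `a ∈ p⁻¹I` is not in `I` then `aI⁻¹ + R = p⁻¹`. -/
theorem FractionalIdeal.exists_mul_add_eq_one {I : FractionalIdeal R⁰ K} (hI : I ≠ 0)
    {p : Ideal R} (hp : p.IsMaximal) (hp0 : p ≠ ⊥) {a : K} (ha : a ∉ I)
    (hpa : ∀ r ∈ p, algebraMap R K r * a ∈ I) :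
    ∃ c ∈ I⁻¹ * (p : FractionalIdeal R⁰ K), ∃ r ∈ p, c * a + algebraMap R K r = 1 := by
  have hpne : (p : FractionalIdeal R⁰ K) ≠ 0 := FractionalIdeal.coeIdeal_ne_zero.mpr hp0
  have h1 : FractionalIdeal.spanSingleton R⁰ a * p ≤ I := by
    rw [FractionalIdeal.spanSingleton_mul_le_iff]
    intro z hz
    obtain ⟨r, hr, rfl⟩ := (FractionalIdeal.mem_coeIdeal _).mp hz
    rw [mul_comm]
    exact hpa r hr
  have h2 : FractionalIdeal.spanSingleton R⁰ a * (I⁻¹ * p) ≤ 1 := by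
    calc _ = (FractionalIdeal.spanSingleton R⁰ a * p) * I⁻¹ := by ring
      _ ≤ I * I⁻¹ := by gcongr
      _ = 1 := mul_inv_cancel₀ hI
  obtain ⟨D, hD⟩ := FractionalIdeal.le_one_iff_exists_coeIdeal.mp h2
  have hDp : ¬ D ≤ p := fun h ↦ by
    have h3 : FractionalIdeal.spanSingleton R⁰ a * (I⁻¹ * p) ≤ (p : FractionalIdeal R⁰ K) :=
      hD ▸ (FractionalIdeal.coeIdeal_le_coeIdeal K).mpr h
    have h4 : FractionalIdeal.spanSingleton R⁰ a ≤ I := by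
      calc FractionalIdeal.spanSingleton R⁰ a
          = (FractionalIdeal.spanSingleton R⁰ a * (I⁻¹ * p)) *
              (p : FractionalIdeal R⁰ K)⁻¹ * I := by
            field_simp
        _ ≤ p * (p : FractionalIdeal R⁰ K)⁻¹ * I := by gcongr
        _ = I := by field_simp
    exact ha (h4 (FractionalIdeal.mem_spanSingleton_self _ _))
  have htop : D ⊔ p = ⊤ := by
    exact hp.1.2 _ (right_lt_sup.mpr hDp)
  obtain ⟨d, hd, r, hr, hdr⟩ := Submodule.mem_sup.mp ((Ideal.eq_top_iff_one _).mp htop)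
  have hd' : algebraMap R K d ∈ FractionalIdeal.spanSingleton R⁰ a * (I⁻¹ * p) :=
    hD ▸ FractionalIdeal.mem_coeIdeal_of_mem _ hd
  obtain ⟨c, hc, hdc⟩ := FractionalIdeal.mem_singleton_mul.mp hd'
  exact ⟨c, hc, r, hr, by rw [mul_comm c, ← hdc, ← map_add, hdr, map_one]⟩

end Lattice

end

section

open QuadraticMap nonZeroDivisors

theorem two_ne_zero_of_invertible {R K : Type*} [CommRing R] [Field K] [Algebra R K]
    [Invertible (2 : R)] : (2 : K) ≠ 0 := by
  have : IsUnit (algebraMap R K 2) := (isUnit_of_invertible (2 : R)).map _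
  rw [← map_ofNat (algebraMap R K) 2]
  exact this.ne_zero

section Lattice

variable {R K E : Type*} [CommRing R] [IsDedekindDomain R] [Field K] [Algebra R K]
  [IsFractionRing R K] [AddCommGroup E] [Module K E] [Module R E] [IsScalarTower R K E]

theorem FractionalIdeal.mem_of_forall_mul_mem_one {I : FractionalIdeal R⁰ K} (hI : I ≠ 0) {a : K}
    (h : ∀ b ∈ I⁻¹, a * b ∈ (1 : FractionalIdeal R⁰ K)) : a ∈ I := by
  rw [← inv_inv I, FractionalIdeal.mem_inv_iff (inv_ne_zero hI)]
  exact h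

theorem FractionalIdeal.mem_one_of_forall_mul_mem {I : FractionalIdeal R⁰ K} (hI : I ≠ 0) {a : K}
    (h : ∀ b ∈ I, a * b ∈ I) : a ∈ (1 : FractionalIdeal R⁰ K) := by
  have h1 : FractionalIdeal.spanSingleton R⁰ a * I ≤ I :=
    FractionalIdeal.spanSingleton_mul_le_iff.mpr h
  have h2 : FractionalIdeal.spanSingleton R⁰ a ≤ 1 := by
    calc FractionalIdeal.spanSingleton R⁰ a = FractionalIdeal.spanSingleton R⁰ a * I * I⁻¹ := by
          field_simp
      _ ≤ I * I⁻¹ := by gcongr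
      _ = 1 := mul_inv_cancel₀ hI
  exact h2 (FractionalIdeal.mem_spanSingleton_self _ _)

theorem FractionalIdeal.mem_mul_inv_of_forall {I : FractionalIdeal R⁰ K} {p : Ideal R}
    (hp0 : p ≠ ⊥) {a : K} (h : ∀ r ∈ p, algebraMap R K r * a ∈ I) :
    a ∈ I * (p : FractionalIdeal R⁰ K)⁻¹ := by
  have hpne : (p : FractionalIdeal R⁰ K) ≠ 0 := FractionalIdeal.coeIdeal_ne_zero.mpr hp0
  have h1 : FractionalIdeal.spanSingleton R⁰ a * p ≤ I := by
    rw [FractionalIdeal.spanSingleton_mul_le_iff]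
    intro z hz
    obtain ⟨r, hr, rfl⟩ := (FractionalIdeal.mem_coeIdeal _).mp hz
    rw [mul_comm]
    exact h r hr
  have h2 : FractionalIdeal.spanSingleton R⁰ a ≤ I * (p : FractionalIdeal R⁰ K)⁻¹ := by
    calc FractionalIdeal.spanSingleton R⁰ a
        = FractionalIdeal.spanSingleton R⁰ a * p * (p : FractionalIdeal R⁰ K)⁻¹ := by
          field_simp
      _ ≤ I * (p : FractionalIdeal R⁰ K)⁻¹ := by gcongr
  exact h2 (FractionalIdeal.mem_spanSingleton_self _ _)

theorem FractionalIdeal.inv_two_mem_one [Invertible (2 : R)] :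
    (2⁻¹ : K) ∈ (1 : FractionalIdeal R⁰ K) := by
  refine (FractionalIdeal.mem_one_iff _).mpr ⟨⅟2, ?_⟩
  refine eq_inv_of_mul_eq_one_left ?_
  rw [← map_ofNat (algebraMap R K) 2, ← map_mul, invOf_mul_self, map_one]

theorem FractionalIdeal.mem_of_two_mul_mem [Invertible (2 : R)] {I : FractionalIdeal R⁰ K} {a : K}
    (h : 2 * a ∈ I) : a ∈ I := by
  have h2 : (2 : K) ≠ 0 := two_ne_zero_of_invertible (R := R)
  simpa [h2] using FractionalIdeal.one_mul_mem FractionalIdeal.inv_two_mem_one h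

theorem IsUnimodular.polar_mem {q : QuadraticForm K E} {N : Submodule R E}
    (hN : IsUnimodular R q N) {x y : E} (hx : x ∈ N) (hy : y ∈ N) :
    polar q x y ∈ (1 : FractionalIdeal R⁰ K) :=
  (hN x).mp hx y hy

theorem IsUnimodular.map_mem [Invertible (2 : R)] {q : QuadraticForm K E} {N : Submodule R E}
    (hN : IsUnimodular R q N) {x : E} (hx : x ∈ N) : q x ∈ (1 : FractionalIdeal R⁰ K) := by
  refine FractionalIdeal.mem_of_two_mul_mem ?_
  simpa [polar_self] using hN.polar_mem hx hx

/-- The relation of being mapped to one another by an isometry of the ambient space. -/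
def LatticeIsometric (q : QuadraticForm K E) (N N' : Submodule R E) : Prop :=
  ∃ g : q.IsometryEquiv q, ∀ y, y ∈ N ↔ g y ∈ N'

theorem LatticeIsometric.refl (q : QuadraticForm K E) (N : Submodule R E) :
    LatticeIsometric q N N :=
  ⟨QuadraticMap.IsometryEquiv.refl q, fun _ ↦ Iff.rfl⟩

theorem LatticeIsometric.symm {q : QuadraticForm K E} {N N' : Submodule R E}
    (h : LatticeIsometric q N N') : LatticeIsometric q N' N := by
  obtain ⟨g, hg⟩ := h
  refine ⟨g.symm, fun y ↦ ?_⟩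
  rw [hg, QuadraticMap.IsometryEquiv.apply_symm_apply]

theorem LatticeIsometric.trans {q : QuadraticForm K E} {N N' N'' : Submodule R E}
    (h : LatticeIsometric q N N') (h' : LatticeIsometric q N' N'') : LatticeIsometric q N N'' := by
  obtain ⟨g, hg⟩ := h
  obtain ⟨g', hg'⟩ := h'
  exact ⟨g.trans g', fun y ↦ (hg y).trans (hg' _)⟩

theorem IsUnimodular.latticeIsometric {q : QuadraticForm K E} {N N' : Submodule R E}
    (hN : IsUnimodular R q N) (hN' : IsUnimodular R q N') (g : q.IsometryEquiv q)
    (hg : ∀ y ∈ N, g y ∈ N') : LatticeIsometric q N N' := by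
  refine ⟨g, fun y ↦ ⟨hg y, fun h ↦ (hN y).mpr fun z hz ↦ ?_⟩⟩
  rw [← g.polar_apply]
  exact hN'.polar_mem h (hg z hz)

namespace HyperbolicSplitting

variable {q : QuadraticForm K E} (S : HyperbolicSplitting R q)

/-- The coefficient of `e`. -/
def coordE : E →ₗ[K] K := q.polarBilin.flip S.f

/-- The coefficient of `f`. -/
def coordF : E →ₗ[K] K := q.polarBilin.flip S.e

/-- The component orthogonal to `e` and `f`. -/
def proj : E →ₗ[K] E := LinearMap.id - S.coordE.smulRight S.e - S.coordF.smulRight S.f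

theorem coordE_apply (y : E) : S.coordE y = polar q y S.f := rfl

theorem coordF_apply (y : E) : S.coordF y = polar q y S.e := rfl

theorem proj_apply (y : E) : S.proj y = y - S.coordE y • S.e - S.coordF y • S.f := rfl

theorem eq_add (y : E) : y = S.coordE y • S.e + S.coordF y • S.f + S.proj y := by
  rw [proj_apply]; abel

theorem polar_f_e : polar q S.f S.e = 1 := by rw [polar_comm, S.polar_e_f]

theorem polar_e_e : polar q S.e S.e = 0 := by simp [polar_self, S.map_e]

theorem polar_f_f : polar q S.f S.f = 0 := by simp [polar_self, S.map_f]

@[simp] theorem polar_proj_e (y : E) : polar q (S.proj y) S.e = 0 := by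
  simp [proj_apply, polar_sub_left, polar_smul_left, coordF_apply, S.polar_e_e, S.polar_f_e]

@[simp] theorem polar_proj_f (y : E) : polar q (S.proj y) S.f = 0 := by
  simp [proj_apply, polar_sub_left, polar_smul_left, coordE_apply, S.polar_f_f, S.polar_e_f]

theorem polar_eq (x y : E) : polar q x y = S.coordE x * S.coordF y + S.coordF x * S.coordE y +
    polar q (S.proj x) (S.proj y) := by
  have h1 (z) : polar q S.e (S.proj z) = 0 := by rw [polar_comm, polar_proj_e]
  have h2 (z) : polar q S.f (S.proj z) = 0 := by rw [polar_comm, polar_proj_f]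
  conv_lhs => rw [S.eq_add x, S.eq_add y]
  simp only [polar_add_left, polar_add_right, polar_smul_left, polar_smul_right, smul_eq_mul,
    S.polar_e_e, S.polar_e_f, S.polar_f_e, S.polar_f_f, h1, h2, polar_proj_e, polar_proj_f]
  ring

theorem polar_proj_of_orthogonal (x : E) {w : E} (he : polar q w S.e = 0) (hf : polar q w S.f = 0) :
    polar q (S.proj x) w = polar q x w := by
  simp [proj_apply, polar_comm q _ w, he, hf]

theorem map_eq (x : E) : q x = S.coordE x * S.coordF x + q (S.proj x) := by
  conv_lhs => rw [S.eq_add x, add_comm, ← add_assoc, quadForm_add_smul, quadForm_add_smul]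
  simp [polar_add_right, polar_smul_right, S.map_e, S.map_f, S.polar_f_e, polar_comm q _ (S.proj x)]
  ring

/-- The lattice `Je ⊕ J⁻¹f ⊕ core`. -/
def lattice (J : FractionalIdeal R⁰ K) : Submodule R E where
  carrier := {y | S.coordE y ∈ J ∧ S.coordF y ∈ J⁻¹ ∧ S.proj y ∈ S.core}
  add_mem' hx hy := by
    simp only [Set.mem_ofPred_eq, map_add] at *
    exact ⟨FractionalIdeal.add_mem hx.1 hy.1, FractionalIdeal.add_mem hx.2.1 hy.2.1,
      S.core.add_mem hx.2.2 hy.2.2⟩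
  zero_mem' := by simp [FractionalIdeal.zero_mem']
  smul_mem' r x hx := by
    simp only [Set.mem_ofPred_eq, ← algebraMap_smul K r, map_smul, smul_eq_mul] at *
    exact ⟨FractionalIdeal.one_mul_mem (FractionalIdeal.algebraMap_mem_one r) hx.1,
      FractionalIdeal.one_mul_mem (FractionalIdeal.algebraMap_mem_one r) hx.2.1,
      Submodule.smul_mem_of_mem_one _ (FractionalIdeal.algebraMap_mem_one r) hx.2.2⟩

theorem mem_lattice {J : FractionalIdeal R⁰ K} {y : E} :
    y ∈ S.lattice J ↔ S.coordE y ∈ J ∧ S.coordF y ∈ J⁻¹ ∧ S.proj y ∈ S.core := Iff.rfl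

theorem polar_core_mem {z w : E} (hz : z ∈ S.core) (hw : w ∈ S.core) :
    polar q z w ∈ (1 : FractionalIdeal R⁰ K) :=
  FractionalIdeal.sub_mem (FractionalIdeal.sub_mem (S.map_core _ (S.core.add_mem hz hw))
    (S.map_core _ hz)) (S.map_core _ hw)

theorem coordE_smul_f (b : K) : S.coordE (b • S.f) = 0 := by simp [coordE_apply, S.polar_f_f]

theorem coordF_smul_f (b : K) : S.coordF (b • S.f) = b := by simp [coordF_apply, S.polar_f_e]

theorem proj_smul_f (b : K) : S.proj (b • S.f) = 0 := by
  rw [proj_apply, coordE_smul_f, coordF_smul_f]; simp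

theorem smul_f_mem {J : FractionalIdeal R⁰ K} {b : K} (hb : b ∈ J⁻¹) : b • S.f ∈ S.lattice J := by
  rw [mem_lattice, coordE_smul_f, coordF_smul_f, proj_smul_f]
  exact ⟨FractionalIdeal.zero_mem', hb, S.core.zero_mem⟩

theorem core_le_lattice (J : FractionalIdeal R⁰ K) : S.core ≤ S.lattice J := fun z hz ↦ by
  have he : S.coordE z = 0 := S.polar_core_f z hz
  have hf : S.coordF z = 0 := S.polar_core_e z hz
  rw [mem_lattice, proj_apply, he, hf]
  simpa [FractionalIdeal.zero_mem'] using hz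

/-- The splitting with `e` and `f` exchanged. -/
def swap : HyperbolicSplitting R q where
  e := S.f
  f := S.e
  core := S.core
  map_e := S.map_f
  map_f := S.map_e
  polar_e_f := S.polar_f_e
  polar_core_e := S.polar_core_f
  polar_core_f := S.polar_core_e
  fg := S.fg
  ne_bot := S.ne_bot
  map_core := S.map_core
  mem_core z he hf := S.mem_core z hf he

theorem swap_proj (y : E) : S.swap.proj y = S.proj y := by
  rw [proj_apply, proj_apply, sub_right_comm]; rfl

theorem swap_lattice (J : FractionalIdeal R⁰ K) : S.swap.lattice J⁻¹ = S.lattice J := by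
  ext y
  rw [mem_lattice, mem_lattice, inv_inv, swap_proj]
  exact and_left_comm

theorem smul_e_mem {J : FractionalIdeal R⁰ K} {a : K} (ha : a ∈ J) : a • S.e ∈ S.lattice J := by
  rw [← swap_lattice]
  exact S.swap.smul_f_mem (by rwa [inv_inv])

theorem isUnimodular_lattice {J : FractionalIdeal R⁰ K} (hJ : J ≠ 0) :
    IsUnimodular R q (S.lattice J) := by
  refine fun x ↦ ⟨fun hx y hy ↦ ?_, fun h ↦ ?_⟩
  · rw [S.polar_eq]
    refine FractionalIdeal.add_mem (FractionalIdeal.add_mem ?_ ?_) (S.polar_core_mem hx.2.2 hy.2.2)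
    · exact FractionalIdeal.mul_mem_one hJ hx.1 hy.2.1
    · rw [mul_comm]
      exact FractionalIdeal.mul_mem_one hJ hy.1 hx.2.1
  · refine ⟨FractionalIdeal.mem_of_forall_mul_mem_one hJ fun b hb ↦ ?_,
      FractionalIdeal.mem_of_forall_mul_mem_one (inv_ne_zero hJ) fun a ha ↦ ?_,
      S.mem_core _ (S.polar_proj_e x) (S.polar_proj_f x) fun w hw ↦ ?_⟩
    · simpa [polar_smul_right, mul_comm, coordE_apply] using h _ (S.smul_f_mem hb)
    · rw [inv_inv] at ha
      simpa [polar_smul_right, mul_comm, coordF_apply] using h _ (S.smul_e_mem ha)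
    · rw [S.polar_proj_of_orthogonal x (S.polar_core_e w hw) (S.polar_core_f w hw)]
      exact h w (S.core_le_lattice J hw)

section EichlerF

variable {w : E} (he : polar q w S.e = 0) (hf : polar q w S.f = 0)

/-- The Eichler isometry attached to `f`. -/
def eichlerF : q.IsometryEquiv q := eichlerIsometry q S.f w S.map_f (by rw [polar_comm, hf])

include he in
theorem coordE_eichlerF (y : E) : S.coordE (S.eichlerF hf y) = S.coordE y := by
  simp [eichlerF, eichlerIsometry_apply, coordE_apply, polar_sub_left, polar_add_left,
    polar_smul_left, hf, S.polar_f_f]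

include he in
theorem coordF_eichlerF (y : E) : S.coordF (S.eichlerF hf y) =
    S.coordF y - polar q (S.proj y) w - q w * S.coordE y := by
  rw [S.polar_proj_of_orthogonal y he hf]
  simp [eichlerF, eichlerIsometry_apply, coordF_apply, coordE_apply, polar_sub_left, polar_add_left,
    polar_smul_left, he, S.polar_f_e]

include he in
theorem proj_eichlerF (y : E) : S.proj (S.eichlerF hf y) = S.proj y + S.coordE y • w := by
  rw [proj_apply, coordE_eichlerF S he, coordF_eichlerF S he, S.polar_proj_of_orthogonal y he hf,
    proj_apply]
  simp only [eichlerF, eichlerIsometry_apply, coordE_apply, coordF_apply]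
  module

include he in
theorem eichlerF_mem [Invertible (2 : R)] {J : FractionalIdeal R⁰ K} (hJ : J ≠ 0)
    (hw : ∀ i ∈ J, i • w ∈ S.core) {y : E} (hy : y ∈ S.lattice J) :
    S.eichlerF hf y ∈ S.lattice J := by
  rw [mem_lattice, coordE_eichlerF S he, coordF_eichlerF S he, proj_eichlerF S he]
  refine ⟨hy.1, FractionalIdeal.sub_mem (FractionalIdeal.sub_mem hy.2.1 ?_) ?_,
    S.core.add_mem hy.2.2 (hw _ hy.1)⟩
  · rw [FractionalIdeal.mem_inv_iff hJ]
    intro i hi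
    simpa [polar_smul_right, mul_comm] using S.polar_core_mem hy.2.2 (hw i hi)
  · rw [FractionalIdeal.mem_inv_iff hJ]
    intro i hi
    refine FractionalIdeal.mem_of_two_mul_mem ?_
    convert S.polar_core_mem (hw _ hy.1) (hw i hi) using 1
    simp [polar_smul_left, polar_smul_right, polar_self]
    ring

end EichlerF

end HyperbolicSplitting

end Lattice

end

section

open QuadraticMap nonZeroDivisors

section Lattice

variable {R K E : Type*} [CommRing R] [IsDedekindDomain R] [Field K] [Algebra R K]
  [IsFractionRing R K] [AddCommGroup E] [Module K E] [Module R E] [IsScalarTower R K E]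

theorem FractionalIdeal.mem_coeIdeal_inv_mul {I : FractionalIdeal R⁰ K} (hI : I ≠ 0) {p : Ideal R}
    {a c : K} (ha : a ∈ I) (hc : c ∈ I⁻¹ * (p : FractionalIdeal R⁰ K)) :
    ∃ r ∈ p, algebraMap R K r = a * c := by
  rw [← FractionalIdeal.mem_coeIdeal R⁰]
  simpa [← mul_assoc, mul_inv_cancel₀ hI] using FractionalIdeal.mul_mem_mul ha hc

theorem FractionalIdeal.coeIdeal_mul_le (I : FractionalIdeal R⁰ K) (p : Ideal R) :
    I * (p : FractionalIdeal R⁰ K) ≤ I := by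
  calc I * (p : FractionalIdeal R⁰ K) ≤ I * 1 := by
        gcongr; exact FractionalIdeal.coeIdeal_le_one
    _ = I := mul_one I

theorem FractionalIdeal.inv_mul_inv_coeIdeal (I : FractionalIdeal R⁰ K) (p : Ideal R) :
    (I * (p : FractionalIdeal R⁰ K)⁻¹)⁻¹ = I⁻¹ * p := by
  rw [mul_inv, inv_inv]

namespace HyperbolicSplitting

variable {q : QuadraticForm K E} (S : HyperbolicSplitting R q)

/-- The form on the core does not take values in a proper ideal. -/
theorem exists_polar_core_notMem {p : Ideal R} (hp : p.IsMaximal) (hp0 : p ≠ ⊥) :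
    ∃ z ∈ S.core, ∃ w ∈ S.core, polar q z w ∉ (p : FractionalIdeal R⁰ K) := by
  by_contra! hcon
  have hpne : (p : FractionalIdeal R⁰ K) ≠ 0 := FractionalIdeal.coeIdeal_ne_zero.mpr hp0
  obtain ⟨t, ht, ht1⟩ := FractionalIdeal.exists_notMem_one_of_ne_bot (K := K) hp0 hp.ne_top
  refine ht1 ?_
  have hintegral : IsIntegral R t := isIntegral_of_smul_mem_submodule S.core S.ne_bot S.fg t
    fun z hz ↦ S.mem_core _ (by simp [polar_smul_left, S.polar_core_e z hz])
      (by simp [polar_smul_left, S.polar_core_f z hz]) fun w hw ↦ by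
      rw [polar_smul_left, smul_eq_mul, mul_comm]
      exact FractionalIdeal.mul_mem_one hpne (hcon z hz w hw) ht
  exact (FractionalIdeal.mem_one_iff _).mpr (IsIntegrallyClosed.isIntegral_iff.mp hintegral)

variable [Invertible (2 : R)]

theorem exists_isometryEquiv_neighbor_of_notMem {I : FractionalIdeal R⁰ K} (hI : I ≠ 0)
    {p : Ideal R} (hp : p.IsMaximal) (hp0 : p ≠ ⊥) {x : E}
    (hpx : ∀ r ∈ p, algebraMap R K r • x ∈ S.lattice I)
    (hqx : q x ∈ (1 : FractionalIdeal R⁰ K)) (hx : S.coordE x ∉ I) :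
    ∃ g : q.IsometryEquiv q, g x ∈ S.lattice (I * (p : FractionalIdeal R⁰ K)⁻¹) ∧
      ∀ y ∈ S.lattice I, polar q x y ∈ (1 : FractionalIdeal R⁰ K) →
        g y ∈ S.lattice (I * (p : FractionalIdeal R⁰ K)⁻¹) := by
  have hpne : (p : FractionalIdeal R⁰ K) ≠ 0 := FractionalIdeal.coeIdeal_ne_zero.mpr hp0
  have hE : ∀ r ∈ p, algebraMap R K r * S.coordE x ∈ I := fun r hr ↦ by
    simpa only [map_smul, smul_eq_mul] using (hpx r hr).1
  have hz : ∀ r ∈ p, algebraMap R K r • S.proj x ∈ S.core := fun r hr ↦ by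
    simpa using (hpx r hr).2.2
  obtain ⟨c, hc, r, hr, hcr⟩ := FractionalIdeal.exists_mul_add_eq_one hI hp hp0 hx hE
  have hwe : polar q (-c • S.proj x) S.e = 0 := by rw [polar_smul_left]; simp
  have hwf : polar q (-c • S.proj x) S.f = 0 := by rw [polar_smul_left]; simp
  have hwJ : ∀ i ∈ I, i • -c • S.proj x ∈ S.core := fun i hi ↦ by
    obtain ⟨s, hs, hsi⟩ := FractionalIdeal.mem_coeIdeal_inv_mul hI hi hc
    rw [smul_smul, mul_neg, ← hsi, neg_smul]
    exact S.core.neg_mem (hz s hs)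
  have hmem : ∀ y ∈ S.lattice I, S.eichlerF hwf y ∈ S.lattice I := fun y hy ↦
    S.eichlerF_mem hwe hwf hI hwJ hy
  have hIle : I ≤ I * (p : FractionalIdeal R⁰ K)⁻¹ := fun a ha ↦
    FractionalIdeal.mem_mul_inv_of_forall hp0 fun s _ ↦
      FractionalIdeal.one_mul_mem (FractionalIdeal.algebraMap_mem_one s) ha
  have hcI : c ∈ I⁻¹ := FractionalIdeal.coeIdeal_mul_le _ _ hc
  have key : ∀ b, S.coordE x * b ∈ (1 : FractionalIdeal R⁰ K) → b ∈ I⁻¹ →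
      b ∈ (I * (p : FractionalIdeal R⁰ K)⁻¹)⁻¹ := fun b hab hb ↦ by
    rw [FractionalIdeal.inv_mul_inv_coeIdeal]
    have h1 : b = (S.coordE x * b) * c + b * algebraMap R K r := by
      linear_combination -b * hcr
    rw [h1]
    exact FractionalIdeal.add_mem (FractionalIdeal.one_mul_mem hab hc)
      (FractionalIdeal.mul_mem_mul hb (FractionalIdeal.mem_coeIdeal_of_mem _ hr))
  have hm1 : S.proj (S.eichlerF hwf x) ∈ S.core := by
    rw [S.proj_eichlerF hwe]
    convert hz r hr using 1
    rw [← eq_sub_iff_add_eq'] at hcr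
    rw [hcr]; module
  have hab : S.coordE x * S.coordF (S.eichlerF hwf x) ∈ (1 : FractionalIdeal R⁰ K) := by
    have h := S.map_eq (S.eichlerF hwf x)
    rw [QuadraticMap.IsometryEquiv.map_app, S.coordE_eichlerF hwe] at h
    rw [← sub_eq_iff_eq_add] at h
    rw [← h]
    exact FractionalIdeal.sub_mem hqx (S.map_core _ hm1)
  have hb : S.coordF (S.eichlerF hwf x) ∈ I⁻¹ := by
    have h1 : S.coordF (S.eichlerF hwf x) = (S.coordE x * S.coordF (S.eichlerF hwf x)) * c +
        S.coordF (S.eichlerF hwf (algebraMap R K r • x)) := by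
      rw [map_smul, map_smul, smul_eq_mul]
      linear_combination -(S.coordF (S.eichlerF hwf x)) * hcr
    rw [h1]
    exact FractionalIdeal.add_mem (FractionalIdeal.one_mul_mem hab hcI) (hmem _ (hpx r hr)).2.1
  refine ⟨S.eichlerF hwf, ⟨?_, key _ hab hb, hm1⟩, fun y hy hxy ↦ ⟨?_, ?_, (hmem y hy).2.2⟩⟩
  · rw [S.coordE_eichlerF hwe]
    exact FractionalIdeal.mem_mul_inv_of_forall hp0 hE
  · exact hIle (hmem y hy).1
  · refine key _ ?_ (hmem y hy).2.1
    rw [← (S.eichlerF hwf).polar_apply, S.polar_eq, S.coordE_eichlerF hwe] at hxy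
    convert FractionalIdeal.sub_mem hxy (FractionalIdeal.add_mem
      (FractionalIdeal.mul_mem_one hI (hmem y hy).1 hb) (S.polar_core_mem hm1 (hmem y hy).2.2))
      using 1
    ring

theorem exists_orthogonal_notMem {I : FractionalIdeal R⁰ K} (hI : I ≠ 0)
    {p : Ideal R} (hp : p.IsMaximal) (hp0 : p ≠ ⊥) {x : E} (hxI : x ∉ S.lattice I)
    (hpx : ∀ r ∈ p, algebraMap R K r • x ∈ S.lattice I) (hx : S.coordE x ∈ I) :
    ∃ w, polar q w S.e = 0 ∧ polar q w S.f = 0 ∧ (∀ j ∈ I⁻¹, j • w ∈ S.core) ∧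
      S.coordE x - polar q (S.proj x) w - q w * S.coordF x ∉ I := by
  by_contra! hcon
  have hF : ∀ r ∈ p, algebraMap R K r * S.coordF x ∈ I⁻¹ := fun r hr ↦ by
    simpa only [map_smul, smul_eq_mul] using (hpx r hr).2.1
  have h1 : ∀ i ∈ I, ∀ z ∈ S.core,
      polar q (S.proj x) (i • z) ∈ I ∧ q (i • z) * S.coordF x ∈ I := fun i hi z hz ↦ by
    have hI' : ∀ j ∈ I⁻¹, j • i • z ∈ S.core := fun j hj ↦ by
      rw [smul_smul]
      exact Submodule.smul_mem_of_mem_one _ (mul_comm i j ▸ FractionalIdeal.mul_mem_one hI hi hj) hz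
    have he : polar q (i • z) S.e = 0 := by simp [polar_smul_left, S.polar_core_e z hz]
    have hf : polar q (i • z) S.f = 0 := by simp [polar_smul_left, S.polar_core_f z hz]
    have ha := FractionalIdeal.sub_mem hx (hcon (i • z) he hf hI')
    have hb := FractionalIdeal.sub_mem hx (hcon (-(i • z)) (by simp [polar_neg_left, he])
      (by simp [polar_neg_left, hf]) fun j hj ↦ by rw [smul_neg]; exact S.core.neg_mem (hI' j hj))
    rw [polar_neg_right, QuadraticMap.map_neg] at hb
    constructor
    · apply FractionalIdeal.mem_of_two_mul_mem
      convert FractionalIdeal.sub_mem ha hb using 1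
      ring
    · apply FractionalIdeal.mem_of_two_mul_mem
      convert FractionalIdeal.add_mem ha hb using 1
      ring
  have hz : S.proj x ∈ S.core := S.mem_core _ (S.polar_proj_e x) (S.polar_proj_f x) fun w hw ↦
    FractionalIdeal.mem_one_of_forall_mul_mem hI fun i hi ↦ by
      simpa [polar_smul_right, mul_comm] using (h1 i hi w hw).1
  refine hxI ⟨hx, ?_, hz⟩
  by_contra hF'
  obtain ⟨c, hc, r, hr, hcr⟩ := FractionalIdeal.exists_mul_add_eq_one (inv_ne_zero hI) hp hp0 hF' hF
  obtain ⟨z, hz, w, hw, hzw⟩ := S.exists_polar_core_notMem hp hp0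
  have hq : ∀ z ∈ S.core, ∀ i ∈ I, ∀ j ∈ I, q z * S.coordF x * i * j ∈ I := by
    intro z hz i hi j hj
    apply FractionalIdeal.mem_of_two_mul_mem
    convert FractionalIdeal.sub_mem (FractionalIdeal.sub_mem
      (h1 (i + j) (FractionalIdeal.add_mem hi hj) z hz).2 (h1 i hi z hz).2) (h1 j hj z hz).2 using 1
    simp only [QuadraticMap.map_smul, smul_eq_mul]
    ring
  refine hzw ?_
  have hB : polar q z w * S.coordF x ∈ I⁻¹ := by
    rw [FractionalIdeal.mem_inv_iff hI]
    intro i hi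
    refine FractionalIdeal.mem_one_of_forall_mul_mem hI fun j hj ↦ ?_
    convert FractionalIdeal.sub_mem (FractionalIdeal.sub_mem (hq _ (S.core.add_mem hz hw) i hi j hj)
      (hq z hz i hi j hj)) (hq w hw i hi j hj) using 1
    rw [polar]; ring
  have h2 : polar q z w = polar q z w * S.coordF x * c + polar q z w * algebraMap R K r := by
    linear_combination -polar q z w * hcr
  rw [h2]
  refine FractionalIdeal.add_mem ?_ (FractionalIdeal.one_mul_mem (S.polar_core_mem hz hw)
    (FractionalIdeal.mem_coeIdeal_of_mem _ hr))
  have h3 := FractionalIdeal.mul_mem_mul hB hc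
  rwa [inv_inv, ← mul_assoc, inv_mul_cancel₀ hI, one_mul] at h3

theorem exists_isometryEquiv_neighbor {I : FractionalIdeal R⁰ K} (hI : I ≠ 0)
    {p : Ideal R} (hp : p.IsMaximal) (hp0 : p ≠ ⊥) {x : E} (hxI : x ∉ S.lattice I)
    (hpx : ∀ r ∈ p, algebraMap R K r • x ∈ S.lattice I)
    (hqx : q x ∈ (1 : FractionalIdeal R⁰ K)) :
    ∃ g : q.IsometryEquiv q, g x ∈ S.lattice (I * (p : FractionalIdeal R⁰ K)⁻¹) ∧
      ∀ y ∈ S.lattice I, polar q x y ∈ (1 : FractionalIdeal R⁰ K) →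
        g y ∈ S.lattice (I * (p : FractionalIdeal R⁰ K)⁻¹) := by
  by_cases hx : S.coordE x ∈ I
  · obtain ⟨w, he, hf, hw, hxw⟩ := S.exists_orthogonal_notMem hI hp hp0 hxI hpx hx
    have hmem : ∀ y ∈ S.lattice I, S.swap.eichlerF he y ∈ S.lattice I := fun y hy ↦ by
      rw [← swap_lattice] at hy ⊢
      exact S.swap.eichlerF_mem hf he (inv_ne_zero hI) hw hy
    obtain ⟨g, hg, hg'⟩ := S.exists_isometryEquiv_neighbor_of_notMem hI hp hp0
      (x := S.swap.eichlerF he x) (fun r hr ↦ by rw [← map_smul]; exact hmem _ (hpx r hr))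
      (by rwa [QuadraticMap.IsometryEquiv.map_app]) (by
        have := S.swap.coordF_eichlerF hf he x
        rw [swap_proj] at this
        change S.coordE _ = S.coordE _ - _ - _ * S.coordF x at this
        rwa [this])
    refine ⟨(S.swap.eichlerF he).trans g, hg, fun y hy hxy ↦ hg' _ (hmem y hy) ?_⟩
    exact (S.swap.eichlerF he).polar_apply x y ▸ hxy
  · exact S.exists_isometryEquiv_neighbor_of_notMem hI hp hp0 hpx hqx hx

end HyperbolicSplitting

end Lattice

end

section

open QuadraticMap nonZeroDivisors

section Lattice

variable {R K E : Type*} [CommRing R] [IsDedekindDomain R] [Field K] [Algebra R K]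
  [IsFractionRing R K] [AddCommGroup E] [Module K E] [Module R E] [IsScalarTower R K E]

theorem FractionalIdeal.exists_algebraMap_mul_mem {J : FractionalIdeal R⁰ K} (hJ : J ≠ 0) (a : K) :
    ∃ r ≠ (0 : R), algebraMap R K r * a ∈ J := by
  obtain ⟨j, hj, hj0⟩ := FractionalIdeal.exists_ne_zero_mem_isInteger hJ
  obtain ⟨⟨b, s⟩, hb⟩ := IsLocalization.surj R⁰ a
  refine ⟨j * s, mul_ne_zero hj (nonZeroDivisors.coe_ne_zero s), ?_⟩
  rw [map_mul, mul_assoc, mul_comm (algebraMap R K s), hb, mul_comm]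
  exact FractionalIdeal.one_mul_mem (FractionalIdeal.algebraMap_mem_one b) hj0

namespace HyperbolicSplitting

variable {q : QuadraticForm K E} (S : HyperbolicSplitting R q)

theorem exists_smul_mem_lattice {J : FractionalIdeal R⁰ K} (hJ : J ≠ 0) (z : E) :
    ∃ r ≠ (0 : R), r • z ∈ S.lattice J := by
  obtain ⟨r₁, hr₁, h₁⟩ := FractionalIdeal.exists_algebraMap_mul_mem hJ (S.coordE z)
  obtain ⟨r₂, hr₂, h₂⟩ := FractionalIdeal.exists_algebraMap_mul_mem (inv_ne_zero hJ) (S.coordF z)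
  obtain ⟨s, hs⟩ := S.fg
  classical
  obtain ⟨r₃, h₃⟩ := IsLocalization.exist_integer_multiples_of_finset R⁰
    (s.image fun w ↦ polar q (S.proj z) w)
  have h₄ : (r₃ : R) • S.proj z ∈ S.core := by
    rw [← algebraMap_smul K]
    refine S.mem_core _ (by simp) (by simp) fun w hw ↦ ?_
    rw [← hs] at hw
    induction hw using Submodule.span_induction with
    | mem x hx =>
      obtain ⟨r, hr⟩ := h₃ _ (Finset.mem_image_of_mem _ hx)
      rw [polar_smul_left, smul_eq_mul, ← Algebra.smul_def, ← hr]
      exact FractionalIdeal.algebraMap_mem_one r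
    | zero => simp
    | add x y _ _ hx hy => rw [polar_add_right]; exact FractionalIdeal.add_mem hx hy
    | smul r x _ hx =>
      rw [← algebraMap_smul K r x, polar_smul_right, smul_eq_mul]
      exact FractionalIdeal.one_mul_mem (FractionalIdeal.algebraMap_mem_one r) hx
  refine ⟨r₁ * r₂ * r₃, mul_ne_zero (mul_ne_zero hr₁ hr₂) (nonZeroDivisors.coe_ne_zero r₃), ?_⟩
  rw [mem_lattice, ← algebraMap_smul K]
  simp only [LinearMap.map_smul, smul_eq_mul, map_mul]
  refine ⟨?_, ?_, ?_⟩
  · convert FractionalIdeal.one_mul_mem (FractionalIdeal.algebraMap_mem_one (r₂ * r₃)) h₁ using 1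
    rw [map_mul]; ring
  · convert FractionalIdeal.one_mul_mem (FractionalIdeal.algebraMap_mem_one (r₁ * r₃)) h₂ using 1
    rw [map_mul]; ring
  · rw [← map_mul, ← map_mul, algebraMap_smul, mul_smul]
    exact S.core.smul_mem _ h₄

theorem coordE_smul_e (a : K) : S.coordE (a • S.e) = a := by simp [coordE_apply, S.polar_e_f]

theorem coordF_smul_e (a : K) : S.coordF (a • S.e) = 0 := by simp [coordF_apply, S.polar_e_e]

theorem proj_smul_e (a : K) : S.proj (a • S.e) = 0 := by
  rw [proj_apply, coordE_smul_e, coordF_smul_e]; simp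

theorem coordE_proj (y : E) : S.coordE (S.proj y) = 0 := S.polar_proj_f y

theorem coordF_proj (y : E) : S.coordF (S.proj y) = 0 := S.polar_proj_e y

theorem proj_proj (y : E) : S.proj (S.proj y) = S.proj y := by
  rw [proj_apply S (S.proj y), coordE_proj, coordF_proj]; simp

theorem coordE_add (a b : K) (y : E) : S.coordE (a • S.e + b • S.f + S.proj y) = a := by
  rw [map_add, map_add, coordE_smul_e, coordE_smul_f, coordE_proj, add_zero, add_zero]

theorem coordF_add (a b : K) (y : E) : S.coordF (a • S.e + b • S.f + S.proj y) = b := by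
  rw [map_add, map_add, coordF_smul_e, coordF_smul_f, coordF_proj, zero_add, add_zero]

theorem proj_add (a b : K) (y : E) : S.proj (a • S.e + b • S.f + S.proj y) = S.proj y := by
  rw [map_add, map_add, proj_smul_e, proj_smul_f, proj_proj, zero_add, zero_add]

/-- The isometry multiplying `e` by `c` and `f` by `c⁻¹`. -/
def scale {c : K} (hc : c ≠ 0) : q.IsometryEquiv q where
  toFun y := (c * S.coordE y) • S.e + (c⁻¹ * S.coordF y) • S.f + S.proj y
  invFun y := (c⁻¹ * S.coordE y) • S.e + (c * S.coordF y) • S.f + S.proj y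
  map_add' x y := by simp only [map_add]; module
  map_smul' r x := by simp only [map_smul, smul_eq_mul, RingHom.id_apply]; module
  left_inv y := by
    simp only [coordE_add, coordF_add, proj_add]
    rw [inv_mul_cancel_left₀ hc, mul_inv_cancel_left₀ hc, ← S.eq_add]
  right_inv y := by
    simp only [coordE_add, coordF_add, proj_add]
    rw [inv_mul_cancel_left₀ hc, mul_inv_cancel_left₀ hc, ← S.eq_add]
  map_app' y := by
    change q (_ + _) = _
    rw [S.map_eq, coordE_add, coordF_add, proj_add, S.map_eq y]
    field_simp

theorem scale_apply {c : K} (hc : c ≠ 0) (y : E) :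
    S.scale hc y = (c * S.coordE y) • S.e + (c⁻¹ * S.coordF y) • S.f + S.proj y := rfl

theorem scale_mem_lattice {c : K} (hc : c ≠ 0) (J : FractionalIdeal R⁰ K) (y : E) :
    y ∈ S.lattice J ↔ S.scale hc y ∈ S.lattice (FractionalIdeal.spanSingleton R⁰ c * J) := by
  have key (I : FractionalIdeal R⁰ K) {d : K} (hd : d ≠ 0) (z : K) :
      d * z ∈ FractionalIdeal.spanSingleton R⁰ d * I ↔ z ∈ I := by
    rw [FractionalIdeal.mem_singleton_mul]
    exact ⟨fun ⟨w, hw, h⟩ ↦ mul_left_cancel₀ hd h ▸ hw, fun h ↦ ⟨z, h, rfl⟩⟩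
  rw [scale_apply, mem_lattice, mem_lattice, coordE_add, coordF_add, proj_add, key J hc, mul_inv,
    FractionalIdeal.spanSingleton_inv, key J⁻¹ (inv_ne_zero hc)]

theorem latticeIsometric_spanSingleton_mul {c : K} (hc : c ≠ 0) (J : FractionalIdeal R⁰ K) :
    LatticeIsometric q (S.lattice J) (S.lattice (FractionalIdeal.spanSingleton R⁰ c * J)) :=
  ⟨S.scale hc, S.scale_mem_lattice hc J⟩

variable [Invertible (2 : R)]

theorem latticeIsometric_mul_sq_of_isMaximal {J : FractionalIdeal R⁰ K} (hJ : J ≠ 0)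
    {p : Ideal R} (hp : p.IsMaximal) (hp0 : p ≠ ⊥) :
    LatticeIsometric q (S.lattice (J * (p : FractionalIdeal R⁰ K) ^ 2)) (S.lattice J) := by
  have hpne : (p : FractionalIdeal R⁰ K) ≠ 0 := FractionalIdeal.coeIdeal_ne_zero.mpr hp0
  obtain ⟨I, rfl⟩ : ∃ I : FractionalIdeal R⁰ K, J = I * (p : FractionalIdeal R⁰ K)⁻¹ :=
    ⟨J * p, by field_simp⟩
  have hI : I ≠ 0 := left_ne_zero_of_mul hJ
  have h1 : I * (p : FractionalIdeal R⁰ K)⁻¹ * (p : FractionalIdeal R⁰ K) ^ 2 = I * p := by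
    field_simp
  rw [h1]
  obtain ⟨b, hb, hbI⟩ : ∃ b ∈ (I * (p : FractionalIdeal R⁰ K))⁻¹, b ∉ I⁻¹ := by
    by_contra! hcon
    obtain ⟨t, ht, ht1⟩ := FractionalIdeal.exists_notMem_one_of_ne_bot (K := K) hp0 hp.ne_top
    refine ht1 (FractionalIdeal.mem_one_of_forall_mul_mem (inv_ne_zero hI) fun i hi ↦ hcon _ ?_)
    rw [mul_inv, mul_comm]
    exact FractionalIdeal.mul_mem_mul ht hi
  have hpb : ∀ r ∈ p, algebraMap R K r * b ∈ I⁻¹ := fun r hr ↦ by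
    have := FractionalIdeal.mul_mem_mul (FractionalIdeal.mem_coeIdeal_of_mem R⁰ hr) hb
    rwa [mul_inv, mul_comm I⁻¹, mul_inv_cancel_left₀ hpne] at this
  obtain ⟨c, hc, r, hr, hcr⟩ :=
    FractionalIdeal.exists_mul_add_eq_one (inv_ne_zero hI) hp hp0 hbI hpb
  rw [inv_inv] at hc
  obtain ⟨g, hg, hg'⟩ := S.exists_isometryEquiv_neighbor hI hp hp0 (x := b • S.f)
    (fun h ↦ hbI (S.coordF_smul_f b ▸ h.2.1))
    (fun r hr ↦ by rw [smul_smul]; exact S.smul_f_mem (hpb r hr))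
    (by rw [QuadraticMap.map_smul, S.map_f, smul_zero]; exact FractionalIdeal.zero_mem')
  refine (S.isUnimodular_lattice (mul_ne_zero hI hpne)).latticeIsometric
    (S.isUnimodular_lattice hJ) g fun y hy ↦ ?_
  have hE : S.coordE y ∈ I := FractionalIdeal.coeIdeal_mul_le _ _ hy.1
  have hy' : y - (S.coordF y * c) • b • S.f ∈ S.lattice I := by
    rw [mem_lattice, map_sub, map_sub, map_sub, smul_smul, coordE_smul_f, coordF_smul_f,
      proj_smul_f, sub_zero, sub_zero]
    refine ⟨hE, ?_, hy.2.2⟩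
    have h2 : S.coordF y - S.coordF y * c * b = algebraMap R K r * S.coordF y := by
      linear_combination -S.coordF y * hcr
    rw [h2]
    have := FractionalIdeal.mul_mem_mul (FractionalIdeal.mem_coeIdeal_of_mem R⁰ hr) hy.2.1
    rwa [mul_inv, mul_comm I⁻¹, mul_inv_cancel_left₀ hpne] at this
  have h3 : g y = (S.coordF y * c) • g (b • S.f) + g (y - (S.coordF y * c) • b • S.f) := by
    rw [map_sub, map_smul _ (S.coordF y * c)]; abel
  rw [h3]
  refine Submodule.add_mem _ (Submodule.smul_mem_of_mem_one _ ?_ hg) (hg' _ hy' ?_)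
  · rw [mul_comm]
    exact FractionalIdeal.mul_mem_one (mul_ne_zero hI hpne) hc hy.2.1
  · rw [smul_smul, polar_sub_right, polar_smul_left, polar_smul_left, polar_smul_right,
      S.polar_f_f, smul_zero, smul_zero, sub_zero, smul_eq_mul, mul_comm, polar_comm]
    exact FractionalIdeal.mul_mem_one (mul_ne_zero hI hpne) hy.1 hb

theorem latticeIsometric_mul_sq {J : FractionalIdeal R⁰ K} (hJ : J ≠ 0) {A : Ideal R}
    (hA : A ≠ 0) :
    LatticeIsometric q (S.lattice (J * (A : FractionalIdeal R⁰ K) ^ 2)) (S.lattice J) := by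
  induction A using UniqueFactorizationMonoid.induction_on_prime with
  | h₁ => exact absurd rfl hA
  | h₂ A hu =>
    rw [Ideal.isUnit_iff] at hu
    rw [hu, FractionalIdeal.coeIdeal_top, one_pow, mul_one]
    exact LatticeIsometric.refl _ _
  | h₃ A p hA0 hp ih =>
    rw [FractionalIdeal.coeIdeal_mul, mul_pow, mul_comm ((p : FractionalIdeal R⁰ K) ^ 2),
      ← mul_assoc]
    have hp' := Ideal.isPrime_of_prime hp
    exact (S.latticeIsometric_mul_sq_of_isMaximal (mul_ne_zero hJ (pow_ne_zero _
      (FractionalIdeal.coeIdeal_ne_zero.mpr hA0))) (hp'.isMaximal hp.ne_zero) hp.ne_zero).trans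
      (ih hA0)

/-- Every unimodular lattice is isometric to one of the form `Je ⊕ J⁻¹f ⊕ core`. -/
theorem exists_latticeIsometric {N : Submodule R E} (hfg : N.FG) (hN : IsUnimodular R q N) :
    ∃ J : FractionalIdeal R⁰ K, J ≠ 0 ∧ LatticeIsometric q N (S.lattice J) := by
  have : IsNoetherian R N := isNoetherian_of_fg_of_noetherian N hfg
  let L (g : q.IsometryEquiv q) (J : FractionalIdeal R⁰ K) : Submodule R N :=
    (S.lattice J).comap ((g.toLinearEquiv.toLinearMap.restrictScalars R) ∘ₗ N.subtype)
  have memL (g J) (y : N) : y ∈ L g J ↔ g (y : E) ∈ S.lattice J := Iff.rfl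
  obtain ⟨_, ⟨g, J, hJ, rfl⟩, hmax⟩ := set_has_maximal_iff_noetherian.mpr this
    {A | ∃ g J, J ≠ 0 ∧ A = L g J} ⟨_, QuadraticMap.IsometryEquiv.refl q, 1, one_ne_zero, rfl⟩
  refine ⟨J, hJ, hN.latticeIsometric (S.isUnimodular_lattice hJ) g ?_⟩
  by_contra! hcon
  obtain ⟨y, hy, hgy⟩ := hcon
  have hne : Submodule.Quotient.mk (p := L g J) ⟨y, hy⟩ ≠ 0 := by
    rwa [Ne, Submodule.Quotient.mk_eq_zero]
  obtain ⟨p, hp, -⟩ := exists_le_isAssociatedPrime_of_isNoetherianRing R _ hne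
  rw [isAssociatedPrime_iff] at hp
  obtain ⟨hp, x, hx⟩ := hp
  obtain ⟨x, rfl⟩ := Submodule.Quotient.mk_surjective _ x
  have hmem (r : R) : r ∈ p ↔ r • g (x : E) ∈ S.lattice J := by
    rw [hx, Submodule.mem_colon_singleton, Submodule.mem_bot, ← Submodule.Quotient.mk_smul,
      Submodule.Quotient.mk_eq_zero, memL]
    rw [Submodule.coe_smul, ← algebraMap_smul K r (x : E), map_smul, algebraMap_smul]
  have hp0 : p ≠ ⊥ := by
    obtain ⟨r, hr, hr'⟩ := S.exists_smul_mem_lattice hJ (g (x : E))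
    exact fun h ↦ hr (by simpa [h] using (hmem r).mpr hr')
  have hxJ : g (x : E) ∉ S.lattice J := fun h ↦
    hp.ne_top ((Ideal.eq_top_iff_one _).mpr ((hmem 1).mpr (by rwa [one_smul])))
  obtain ⟨g', hg', hg''⟩ := S.exists_isometryEquiv_neighbor hJ (hp.isMaximal hp0) hp0 hxJ
    (fun r hr ↦ by rw [algebraMap_smul]; exact (hmem r).mp hr)
    (by rw [QuadraticMap.IsometryEquiv.map_app]; exact hN.map_mem x.2)
  refine hmax _ ⟨g.trans g', _, mul_ne_zero hJ (inv_ne_zero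
    (FractionalIdeal.coeIdeal_ne_zero.mpr hp0)), rfl⟩ (lt_of_le_of_ne (fun y hy ↦ ?_) ?_)
  · exact hg'' _ hy (g.polar_apply x y ▸ hN.polar_mem x.2 y.2)
  · intro h
    have : x ∈ L g J := h ▸ hg'
    exact hxJ this

/-- If all ideal classes are squares there is only one isometry class of unimodular lattices. -/
theorem latticeIsometric_of_forall_isSquare (hsq : ∀ a : ClassGroup R, IsSquare a)
    {J J' : FractionalIdeal R⁰ K} (hJ : J ≠ 0) (hJ' : J' ≠ 0) :
    LatticeIsometric q (S.lattice J) (S.lattice J') := by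
  obtain ⟨a, ha⟩ := hsq (ClassGroup.mk (K := K) (Units.mk0 J hJ / Units.mk0 J' hJ'))
  obtain ⟨A, rfl⟩ := ClassGroup.mk0_surjective a
  rw [← ClassGroup.mk_mk0 K A, ← map_mul, ← div_eq_one, ← map_div, ClassGroup.mk_eq_one_iff,
    FractionalIdeal.isPrincipal_iff] at ha
  obtain ⟨c, hc⟩ := ha
  have hA : (A : Ideal R) ≠ 0 := nonZeroDivisors.coe_ne_zero A
  have hA' := FractionalIdeal.coeIdeal_ne_zero (K := K).mpr hA
  simp only [Units.val_div_eq_div_val, Units.val_mk0, Units.val_mul, FractionalIdeal.coe_mk0] at hc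
  have hJc : J = FractionalIdeal.spanSingleton R⁰ c *
      (J' * ((A : Ideal R) : FractionalIdeal R⁰ K) ^ 2) := by
    rw [← hc]; field_simp
  have hc0 : c ≠ 0 := by
    rintro rfl
    simp [hJ] at hJc
  rw [hJc]
  exact (S.latticeIsometric_spanSingleton_mul hc0 _).symm.trans (S.latticeIsometric_mul_sq hJ' hA)

end HyperbolicSplitting

end Lattice

end

section

open QuadraticMap nonZeroDivisors

section Lattice

variable {R K E : Type*} [CommRing R] [IsDedekindDomain R] [Field K] [Algebra R K]
  [IsFractionRing R K] [AddCommGroup E] [Module K E] [Module R E] [IsScalarTower R K E]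

theorem exists_hyperbolicSplitting [Invertible (2 : R)] [FiniteDimensional K E]
    (hrank : 3 ≤ Module.finrank K E) {q : QuadraticForm K E}
    (hq : ∀ x, (∀ y, polar q x y = 0) → x = 0) {M : Submodule R E} (hfg : M.FG)
    (hM : IsUnimodular R q M) (hspan : ∀ z, ∃ r ≠ (0 : R), r • z ∈ M) {e : E} (he0 : e ≠ 0)
    (he : q e = 0) :
    ∃ (S : HyperbolicSplitting R q) (J : FractionalIdeal R⁰ K), J ≠ 0 ∧ M = S.lattice J := by
  have : IsNoetherian R M := isNoetherian_of_fg_of_noetherian M hfg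
  have hee : polar q e e = 0 := by simp [polar_self, he]
  let D : FractionalIdeal R⁰ K := ⟨M.map ((q.polarBilin e).restrictScalars R),
    FractionalIdeal.isFractional_of_fg (hfg.map _)⟩
  have memD (d : K) : d ∈ D ↔ ∃ y ∈ M, polar q e y = d := Iff.rfl
  have hD : D ≠ 0 := by
    intro h
    refine he0 (hq e fun y ↦ ?_)
    obtain ⟨r, hr, hry⟩ := hspan y
    have h1 : polar q e (r • y) ∈ D := (memD _).mpr ⟨_, hry, rfl⟩
    rw [h, FractionalIdeal.mem_zero_iff, ← algebraMap_smul K, polar_smul_right, smul_eq_mul,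
      mul_eq_zero] at h1
    exact h1.resolve_left (by simpa using hr)
  have hsmulM {a : K} {z : E} (ha : a ∈ (1 : FractionalIdeal R⁰ K)) (hz : z ∈ M) : a • z ∈ M :=
    M.smul_mem_of_mem_one ha hz
  have smul_e_mem (t : K) : t • e ∈ M ↔ t ∈ D⁻¹ := by
    rw [hM, FractionalIdeal.mem_inv_iff hD]
    refine ⟨fun h d hd ↦ ?_, fun h y hy ↦ ?_⟩
    · obtain ⟨y, hy, rfl⟩ := (memD d).mp hd
      simpa only [polar_smul_left, smul_eq_mul] using h y hy
    · rw [polar_smul_left, smul_eq_mul]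
      exact h _ ((memD _).mpr ⟨y, hy, rfl⟩)
  obtain ⟨f', hf'e, hf'M⟩ : ∃ f', polar q e f' = 1 ∧ ∀ d ∈ D, d • f' ∈ M := by
    have key : ∀ x ∈ D⁻¹ * D, ∃ f', polar q e f' = x ∧ ∀ d ∈ D, d • f' ∈ M := by
      intro x hx
      refine FractionalIdeal.mul_induction_on hx (fun t ht d hd ↦ ?_) fun x y hx hy ↦ ?_
      · obtain ⟨y, hy, rfl⟩ := (memD d).mp hd
        refine ⟨t • y, polar_smul_right _ _ _ _, fun d hd ↦ ?_⟩
        rw [smul_smul]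
        exact hsmulM (FractionalIdeal.mul_mem_one hD hd ht) hy
      · obtain ⟨f₁, h₁, h₁'⟩ := hx
        obtain ⟨f₂, h₂, h₂'⟩ := hy
        refine ⟨f₁ + f₂, by rw [polar_add_right, h₁, h₂], fun d hd ↦ ?_⟩
        rw [smul_add]
        exact M.add_mem (h₁' d hd) (h₂' d hd)
    exact key 1 (by rw [inv_mul_cancel₀ hD]; exact FractionalIdeal.one_mem_one R⁰)
  obtain ⟨f, hqf, hfe, hfM⟩ : ∃ f, q f = 0 ∧ polar q e f = 1 ∧ ∀ d ∈ D, d • f ∈ M := by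
    refine ⟨f' - q f' • e, ?_, ?_, fun d hd ↦ ?_⟩
    · rw [quadForm_sub_smul, hf'e, he]; ring
    · rw [polar_sub_right, polar_smul_right, hee, hf'e]; simp
    · rw [smul_sub, smul_smul]
      refine M.sub_mem (hf'M d hd) ((smul_e_mem _).mpr ?_)
      rw [FractionalIdeal.mem_inv_iff hD]
      intro d' hd'
      refine FractionalIdeal.mem_of_two_mul_mem ?_
      convert hM.polar_mem (hf'M d hd) (hf'M d' hd') using 1
      simp [polar_smul_left, polar_smul_right, polar_self]
      ring
  have hff : polar q f f = 0 := by simp [polar_self, hqf]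
  have memJ (y : E) (hy : y ∈ M) : polar q y f ∈ D⁻¹ := by
    rw [FractionalIdeal.mem_inv_iff hD]
    intro d hd
    simpa only [polar_smul_right, smul_eq_mul, mul_comm] using hM.polar_mem hy (hfM d hd)
  have mem_D (y : E) (hy : y ∈ M) : polar q y e ∈ D := (memD _).mpr ⟨y, hy, polar_comm _ _ _⟩
  let core : Submodule R E := M ⊓ (LinearMap.ker ((q.polarBilin e).restrictScalars R) ⊓
    LinearMap.ker ((q.polarBilin f).restrictScalars R))
  have mem_core (z : E) : z ∈ core ↔ z ∈ M ∧ polar q z e = 0 ∧ polar q z f = 0 := by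
    rw [polar_comm q z, polar_comm q z]; exact Iff.rfl
  have proj_mem (y : E) (hy : y ∈ M) : y - polar q y f • e - polar q y e • f ∈ core := by
    rw [mem_core]
    refine ⟨M.sub_mem (M.sub_mem hy ((smul_e_mem _).mpr (memJ y hy))) (hfM _ (mem_D y hy)), ?_, ?_⟩
    · simp [polar_sub_left, polar_smul_left, hee, polar_comm q f e, hfe]
    · simp [polar_sub_left, polar_smul_left, hff, hfe]
  let S : HyperbolicSplitting R q :=
    { e := e
      f := f
      core := core
      map_e := he
      map_f := hqf
      polar_e_f := hfe
      polar_core_e := fun z hz ↦ ((mem_core z).mp hz).2.1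
      polar_core_f := fun z hz ↦ ((mem_core z).mp hz).2.2
      fg := Submodule.FG.of_le hfg inf_le_left
      ne_bot := by
        obtain ⟨z, hz, hz0⟩ := Submodule.exists_mem_ne_zero_of_ne_bot
          (LinearMap.ker_ne_bot_of_finrank_lt (f := (q.polarBilin e).prod (q.polarBilin f))
            (by rw [Module.finrank_prod, Module.finrank_self]; omega))
        obtain ⟨r, hr, hrz⟩ := hspan z
        rw [LinearMap.ker_prod] at hz
        refine (Submodule.ne_bot_iff _).mpr ⟨r • z, ⟨hrz, ?_, ?_⟩, ?_⟩
        · exact Submodule.smul_mem _ r (show z ∈ LinearMap.ker _ from hz.1)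
        · exact Submodule.smul_mem _ r (show z ∈ LinearMap.ker _ from hz.2)
        · rw [← algebraMap_smul K]
          exact smul_ne_zero (by simpa using hr) hz0
      map_core := fun z hz ↦ hM.map_mem hz.1
      mem_core := fun z hze hzf hz ↦ (mem_core z).mpr ⟨(hM z).mpr fun y hy ↦ by
        have := hz _ (proj_mem y hy)
        simpa only [polar_sub_right, polar_smul_right, hze, hzf, smul_zero, sub_zero] using this,
        hze, hzf⟩ }
  refine ⟨S, D⁻¹, inv_ne_zero hD, ?_⟩
  ext y
  rw [S.mem_lattice, inv_inv]
  refine ⟨fun hy ↦ ⟨memJ y hy, mem_D y hy, proj_mem y hy⟩, fun ⟨h₁, h₂, h₃⟩ ↦ ?_⟩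
  rw [S.eq_add y]
  exact M.add_mem (M.add_mem ((smul_e_mem _).mpr h₁) (hfM _ h₂)) h₃.1

end Lattice

end

section

open QuadraticMap nonZeroDivisors TensorProduct

section BaseChange

variable {R A V W : Type*} [CommRing R] [CommRing A] [Algebra R A] [Invertible (2 : R)]
  [AddCommGroup V] [Module R V] [AddCommGroup W] [Module R W]

theorem QuadraticForm.polar_baseChange_tmul (Q : QuadraticForm R V) (a b : A) (v w : V) :
    polar (Q.baseChange A) (a ⊗ₜ v) (b ⊗ₜ w) = a * b * algebraMap R A (polar Q v w) := by
  have h (c : A) (z : V) : c ⊗ₜ[R] z = c • (1 : A) ⊗ₜ z := by rw [smul_tmul', smul_eq_mul, mul_one]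
  rw [h a, h b, polar_smul_left, polar_smul_right, polar, ← tmul_add]
  simp only [QuadraticForm.baseChange_tmul, mul_one, smul_eq_mul, polar, map_sub,
    Algebra.algebraMap_eq_smul_one]
  ring

theorem Module.exists_dual_basis (R V : Type*) [CommRing R] [AddCommGroup V] [Module R V]
    [Module.Projective R V] [Module.Finite R V] :
    ∃ (n : ℕ) (v : Fin n → V) (φ : Fin n → Module.Dual R V), ∀ x, x = ∑ i, φ i x • v i := by
  obtain ⟨n, f, g, -, -, hfg⟩ := Module.Finite.exists_comp_eq_id_of_projective R V
  refine ⟨n, fun i ↦ f (Pi.single i 1), fun i ↦ LinearMap.proj i ∘ₗ g, fun x ↦ ?_⟩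
  conv_lhs => rw [← LinearMap.id_apply (R := R) x, ← hfg, LinearMap.comp_apply,
    pi_eq_sum_univ' (g x)]
  simp

/-- Functionals on the base change of a regular quadratic module are represented by vectors. -/
theorem QuadraticForm.exists_polar_baseChange_eq [Module.Projective R V] [Module.Finite R V]
    {Q : QuadraticForm R V} (hQ : Function.Surjective (polarBilin Q))
    (F : A ⊗[R] V →ₗ[A] A) : ∃ ν, ∀ x, F x = polar (Q.baseChange A) ν x := by
  obtain ⟨n, v, φ, h⟩ := Module.exists_dual_basis R V
  choose u hu using fun i ↦ hQ (φ i)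
  refine ⟨∑ i, F (1 ⊗ₜ v i) ⊗ₜ u i, fun x ↦ ?_⟩
  suffices F = (Q.baseChange A).polarBilin (∑ i, F (1 ⊗ₜ v i) ⊗ₜ u i) from
    DFunLike.congr_fun this x
  ext x
  have h1 : (1 : A) ⊗ₜ[R] x = ∑ i, algebraMap R A (polar Q (u i) x) • (1 : A) ⊗ₜ[R] v i := by
    conv_lhs => rw [h x, tmul_sum]
    refine Finset.sum_congr rfl fun i _ ↦ ?_
    rw [algebraMap_smul, tmul_smul, ← hu]; rfl
  simp only [AlgebraTensorModule.curry_apply, curry_apply, LinearMap.coe_restrictScalars,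
    map_sum, LinearMap.sum_apply, polarBilin_apply_apply, QuadraticForm.polar_baseChange_tmul,
    mul_one]
  conv_lhs => rw [h1]
  rw [map_sum]
  refine Finset.sum_congr rfl fun i _ ↦ ?_
  rw [map_smul, smul_eq_mul, mul_comm]

theorem QuadraticForm.exists_forall_sub_polar_mem [Module.Projective R V] [Module.Finite R V]
    {Q : QuadraticForm R V} (hQ : Function.Surjective (polarBilin Q)) {qW : QuadraticForm R W}
    (ψ : (qW.baseChange A).IsometryEquiv (Q.baseChange A)) {m : Ideal R} (hm : m.IsMaximal)
    (hmA : m.map (algebraMap R A) ≠ ⊤) (f : Module.Dual R W) :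
    ∃ w₀, ∀ w, f w - polar qW w₀ w ∈ m := by
  let := Ideal.Quotient.field m
  obtain ⟨ν, hν⟩ := QuadraticForm.exists_polar_baseChange_eq (A := A) hQ
    ((AlgebraTensorModule.rid R A A).toLinearMap ∘ₗ LinearMap.baseChange A f ∘ₗ
      ψ.symm.toLinearEquiv.toLinearMap)
  have hf (w : W) : algebraMap R A (f w) = polar (qW.baseChange A) (ψ.symm ν) (1 ⊗ₜ w) := by
    have h := hν (ψ (1 ⊗ₜ w))
    have h' : ψ.symm.toLinearEquiv (ψ (1 ⊗ₜ w)) = 1 ⊗ₜ w := ψ.symm_apply_apply _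
    simp only [LinearMap.comp_apply, LinearEquiv.coe_coe, h', LinearMap.baseChange_tmul,
      AlgebraTensorModule.rid_tmul, ← Algebra.algebraMap_eq_smul_one] at h
    rw [h]
    conv_lhs => rw [← ψ.apply_symm_apply ν]
    simp only [polar, ← map_add, QuadraticMap.IsometryEquiv.map_app]
  obtain ⟨l, hl⟩ : ∃ l : A →ₗ[R] R ⧸ m, l 1 = 1 := by
    have h1 : (Submodule.Quotient.mk 1 : A ⧸ (m • ⊤ : Submodule R A)) ≠ 0 := by
      rw [Ne, Submodule.Quotient.mk_eq_zero]
      intro h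
      refine hmA ((Ideal.eq_top_iff_one _).mpr ?_)
      rw [Ideal.smul_top_eq_map] at h
      exact h
    obtain ⟨l, hl⟩ := Module.Projective.exists_dual_eq_one (R ⧸ m) h1
    exact ⟨(l.restrictScalars R) ∘ₗ Submodule.mkQ _, hl⟩
  have key (ν : A ⊗[R] W) : ∃ w₀, ∀ w, l (polar (qW.baseChange A) ν (1 ⊗ₜ w)) =
      Ideal.Quotient.mk m (polar qW w₀ w) := by
    induction ν using TensorProduct.induction_on with
    | zero => exact ⟨0, by simp⟩
    | add x y hx hy =>
      obtain ⟨x₀, hx⟩ := hx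
      obtain ⟨y₀, hy⟩ := hy
      exact ⟨x₀ + y₀, fun w ↦ by rw [polar_add_left, map_add, hx, hy, polar_add_left, map_add]⟩
    | tmul a x =>
      obtain ⟨r, hr⟩ := Ideal.Quotient.mk_surjective (l a)
      refine ⟨r • x, fun w ↦ ?_⟩
      rw [QuadraticForm.polar_baseChange_tmul, polar_smul_left, mul_one, mul_comm,
        ← Algebra.smul_def, map_smul, ← hr, smul_eq_mul, mul_comm, map_mul, mul_comm]
      exact mul_comm (Ideal.Quotient.mk m _) (Ideal.Quotient.mk m _)
  obtain ⟨w₀, hw₀⟩ := key (ψ.symm ν)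
  refine ⟨w₀, fun w ↦ Ideal.Quotient.eq.mp ?_⟩
  rw [← hw₀, ← hf, Algebra.algebraMap_eq_smul_one, map_smul, hl]
  exact (mul_one _).symm

theorem QuadraticForm.surjective_polarBilin_of_forall_isMaximal
    [Module.Projective R W] [Module.Finite R W] {qW : QuadraticForm R W}
    (h : ∀ m : Ideal R, m.IsMaximal → ∀ f : Module.Dual R W, ∃ w₀, ∀ w, f w - polar qW w₀ w ∈ m) :
    Function.Surjective (polarBilin qW) := by
  rw [← LinearMap.range_eq_top]
  by_contra hne
  let C := Module.Dual R W ⧸ LinearMap.range (polarBilin qW)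
  obtain ⟨m, hm, hCm⟩ := Ideal.exists_le_maximal (Module.annihilator R C) (by
    rw [Ne, Module.annihilator_eq_top_iff]
    rwa [Submodule.Quotient.subsingleton_iff])
  obtain ⟨r, hr, hr'⟩ := Submodule.exists_sub_one_mem_and_smul_eq_zero_of_fg_of_le_smul m
    (⊤ : Submodule R C) Module.Finite.fg_top (by
      rintro x -
      obtain ⟨f, rfl⟩ := Submodule.Quotient.mk_surjective _ x
      obtain ⟨w₀, hw₀⟩ := h m hm f
      obtain ⟨n, v, φ, hvφ⟩ := Module.exists_dual_basis R W
      have h1 : f - polarBilin qW w₀ = ∑ i, (f (v i) - polar qW w₀ (v i)) • φ i := by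
        ext w
        conv_lhs => rw [hvφ w]
        simp [mul_comm, mul_sub]
      have h2 : (Submodule.Quotient.mk f : C) =
          ∑ i, (f (v i) - polar qW w₀ (v i)) • Submodule.Quotient.mk (φ i) := by
        have h3 : (Submodule.Quotient.mk f : C) =
            Submodule.Quotient.mk (f - polarBilin qW w₀) :=
          (Submodule.Quotient.eq _).mpr (by rw [sub_sub_cancel]; exact ⟨w₀, rfl⟩)
        rw [h3, h1]
        exact map_sum (Submodule.mkQ _) _ _
      rw [h2]
      exact Submodule.sum_mem _ fun i _ ↦ Submodule.smul_mem_smul (hw₀ _) trivial)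
  have hrm : r ∈ m := hCm (Module.mem_annihilator.mpr fun x ↦ hr' x trivial)
  exact hm.ne_top ((Ideal.eq_top_iff_one _).mpr (by simpa using m.sub_mem hrm hr))

end BaseChange

end

section

open QuadraticMap nonZeroDivisors TensorProduct IsDedekindDomain

section LatticeEmbedding

variable {R K E V W : Type*} [CommRing R] [IsDedekindDomain R] [Field K] [Algebra R K]
  [IsFractionRing R K] [AddCommGroup E] [Module K E] [Module R E] [IsScalarTower R K E]
  [AddCommGroup V] [Module R V] [AddCommGroup W] [Module R W]

/-- An embedding of a quadratic module over `R` as a full lattice in a quadratic space over the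
fraction field of `R`. -/
structure IsLatticeEmbedding (qW : QuadraticForm R W) (q : QuadraticForm K E)
    (φ : W →ₗ[R] E) : Prop where
  injective : Function.Injective φ
  map_eq : ∀ w, q (φ w) = algebraMap R K (qW w)
  exists_smul_mem : ∀ z, ∃ r ≠ (0 : R), r • z ∈ LinearMap.range φ

namespace IsLatticeEmbedding

variable {qW : QuadraticForm R W} {Q : QuadraticForm R V} {q : QuadraticForm K E}
  {φ : W →ₗ[R] E} {χ : V →ₗ[R] E}

theorem polar_eq (h : IsLatticeEmbedding qW q φ) (x y : W) :
    polar q (φ x) (φ y) = algebraMap R K (polar qW x y) := by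
  simp only [polar, ← map_add, h.map_eq, map_sub]

theorem eq_zero_of_forall_polar (h : IsLatticeEmbedding qW q φ)
    (hreg : Function.Injective (polarBilin qW)) {x : E} (hx : ∀ w, polar q x (φ w) = 0) :
    x = 0 := by
  obtain ⟨r, hr, w, hw⟩ := h.exists_smul_mem x
  have h1 : polarBilin qW w = 0 := by
    ext y
    apply IsFractionRing.injective R K
    rw [polarBilin_apply_apply, ← h.polar_eq, hw, ← algebraMap_smul K r x, polar_smul_left, hx]
    simp
  rw [(map_eq_zero_iff _ hreg).mp h1, map_zero, ← algebraMap_smul K r x, eq_comm,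
    smul_eq_zero] at hw
  exact hw.resolve_left (by simpa using hr)

theorem isUnimodular_range (h : IsLatticeEmbedding qW q φ)
    (hreg : Function.Bijective (polarBilin qW)) : IsUnimodular R q (LinearMap.range φ) := by
  refine fun x ↦ ⟨?_, fun hx ↦ ?_⟩
  · rintro ⟨w, rfl⟩ _ ⟨w', rfl⟩
    rw [h.polar_eq]
    exact FractionalIdeal.algebraMap_mem_one _
  · choose F hF using fun w ↦ (FractionalIdeal.mem_one_iff _).mp (hx (φ w) ⟨w, rfl⟩)
    let f : Module.Dual R W :=
      { toFun := F
        map_add' := fun a b ↦ IsFractionRing.injective R K (by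
          simp only [map_add, hF, polar_add_right])
        map_smul' := fun r a ↦ IsFractionRing.injective R K (by
          rw [smul_eq_mul, map_mul, hF, hF, map_smul, ← algebraMap_smul K r (φ a),
            polar_smul_right]; rfl) }
    obtain ⟨w₀, hw₀⟩ := hreg.2 f
    refine ⟨w₀, (sub_eq_zero.mp (h.eq_zero_of_forall_polar hreg.1 fun w ↦ ?_)).symm⟩
    have h1 : polar qW w₀ w = F w := DFunLike.congr_fun hw₀ w
    rw [polar_sub_left, h.polar_eq, h1, hF, sub_self]

theorem nonempty_isometryEquiv (h : IsLatticeEmbedding qW q φ) (h' : IsLatticeEmbedding Q q χ)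
    (hL : LatticeIsometric q (LinearMap.range φ) (LinearMap.range χ)) :
    Nonempty (qW.IsometryEquiv Q) := by
  obtain ⟨g, hg⟩ := hL
  choose F hF using fun w ↦ (hg (φ w)).mp ⟨w, rfl⟩
  choose G hG using fun v ↦ (hg (g.symm (χ v))).mpr
    (by rw [QuadraticMap.IsometryEquiv.apply_symm_apply]; exact ⟨v, rfl⟩)
  have hgs (r : R) (x : E) : g (r • x) = r • g x := by
    rw [← algebraMap_smul K r x, ← algebraMap_smul K r (g x), map_smul]
  refine ⟨{
    toFun := F
    invFun := G
    map_add' := fun a b ↦ h'.injective ?_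
    map_smul' := fun r a ↦ h'.injective ?_
    left_inv := fun w ↦ h.injective ?_
    right_inv := fun v ↦ h'.injective ?_
    map_app' := fun w ↦ ?_ }⟩
  · simp only [map_add, hF]
  · simp only [map_smul, hF, hgs, RingHom.id_apply]
  · rw [hG, hF, QuadraticMap.IsometryEquiv.symm_apply_apply]
  · rw [hF, hG, QuadraticMap.IsometryEquiv.apply_symm_apply]
  · apply IsFractionRing.injective R K
    change algebraMap R K (Q (F w)) = _
    rw [← h'.map_eq, hF, g.map_app, h.map_eq]

end IsLatticeEmbedding

theorem isLatticeEmbedding_of_isometryEquiv [Invertible (2 : R)] [Module.Projective R W]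
    {qW : QuadraticForm R W} {q : QuadraticForm K E} (ψ : (qW.baseChange K).IsometryEquiv q) :
    IsLatticeEmbedding qW q
      ((ψ.toLinearEquiv.toLinearMap.restrictScalars R) ∘ₗ TensorProduct.mk R K W 1) where
  injective := ψ.toLinearEquiv.injective.comp (Module.Flat.tensorProduct_mk_injective R W K)
  map_eq w := by
    refine (ψ.map_app _).trans ?_
    simp [Algebra.algebraMap_eq_smul_one]
  exists_smul_mem z := by
    obtain ⟨⟨w, r⟩, h⟩ := IsLocalizedModule.surj R⁰ (TensorProduct.mk R K W 1) (ψ.symm z)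
    refine ⟨r, nonZeroDivisors.coe_ne_zero r, w, ?_⟩
    refine (congrArg ψ h.symm).trans ?_
    rw [Submonoid.smul_def, ← algebraMap_smul K (r : R) (ψ.symm z), map_smul,
      ψ.apply_symm_apply, algebraMap_smul]

theorem injective_polarBilin_of_surjective [Module.Projective R W] [Module.Finite R W]
    {qW : QuadraticForm R W} (h : Function.Surjective (polarBilin qW)) :
    Function.Injective (polarBilin qW) := by
  refine (injective_iff_map_eq_zero _).mpr fun x hx ↦ ?_
  obtain ⟨n, v, φ, hφ⟩ := Module.exists_dual_basis R W
  rw [hφ x]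
  refine Finset.sum_eq_zero fun i _ ↦ ?_
  obtain ⟨y, hy⟩ := h (φ i)
  rw [← hy, polarBilin_apply_apply, polar_comm]
  have := DFunLike.congr_fun hx y
  rw [polarBilin_apply_apply] at this
  simp [this]

theorem IsDedekindDomain.HeightOneSpectrum.map_adicCompletionIntegers_ne_top
    (p : HeightOneSpectrum R) :
    p.asIdeal.map (algebraMap R (p.adicCompletionIntegers K)) ≠ ⊤ := by
  intro h
  suffices p.asIdeal.map (algebraMap R (p.adicCompletionIntegers K)) ≤
      IsLocalRing.maximalIdeal (p.adicCompletionIntegers K) from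
    (IsLocalRing.maximalIdeal.isMaximal _).ne_top (top_le_iff.mp (h ▸ this))
  rw [Ideal.map_le_iff_le_comap]
  intro r hr
  rw [Ideal.mem_comap, IsLocalRing.mem_maximalIdeal, mem_nonunits_iff,
    HeightOneSpectrum.adicCompletionIntegers.isUnit_iff_valued_eq_one]
  exact fun h ↦ ((p.valuation_lt_one_iff_mem r).mpr hr).ne
    ((p.valuedAdicCompletion_eq_valuation r).symm.trans h)

theorem surjective_polarBilin_of_genus [Invertible (2 : R)] [Module.Projective R V]
    [Module.Finite R V] [Module.Projective R W] [Module.Finite R W] {Q : QuadraticForm R V}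
    (hQ : Function.Surjective (polarBilin Q)) {qW : QuadraticForm R W}
    (hK : Nonempty ((qW.baseChange K).IsometryEquiv (Q.baseChange K)))
    (hp : ∀ p : HeightOneSpectrum R, Nonempty ((qW.baseChange (p.adicCompletionIntegers
      K)).IsometryEquiv (Q.baseChange (p.adicCompletionIntegers K)))) :
    Function.Surjective (polarBilin qW) := by
  refine QuadraticForm.surjective_polarBilin_of_forall_isMaximal fun m hm f ↦ ?_
  by_cases h0 : m = ⊥
  · obtain ⟨ψ⟩ := hK
    exact QuadraticForm.exists_forall_sub_polar_mem hQ ψ hm (by simp [h0]) f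
  · obtain ⟨ψ⟩ := hp ⟨m, hm.isPrime, h0⟩
    exact QuadraticForm.exists_forall_sub_polar_mem hQ ψ hm
      (HeightOneSpectrum.map_adicCompletionIntegers_ne_top _) f

/-- A regular isotropic quadratic module of rank at least three over a Dedekind domain whose class
group consists of squares is alone in its genus. -/
theorem nonempty_isometryEquiv_of_forall_isSquare [Invertible (2 : R)] [Module.Projective R V]
    [Module.Finite R V] [Module.Projective R W] [Module.Finite R W] {Q : QuadraticForm R V}
    (hrank : 3 ≤ Module.finrank R V) (hQ : Function.Bijective (polarBilin Q))
    {x : V} (hx0 : x ≠ 0) (hx : Q x = 0) {qW : QuadraticForm R W}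
    (hsq : ∀ a : ClassGroup R, IsSquare a)
    (hK : Nonempty ((qW.baseChange K).IsometryEquiv (Q.baseChange K)))
    (hp : ∀ p : HeightOneSpectrum R, Nonempty ((qW.baseChange (p.adicCompletionIntegers
      K)).IsometryEquiv (Q.baseChange (p.adicCompletionIntegers K)))) :
    Nonempty (qW.IsometryEquiv Q) := by
  have hW := surjective_polarBilin_of_genus hQ.2 hK hp
  have hW' : Function.Bijective (polarBilin qW) := ⟨injective_polarBilin_of_surjective hW, hW⟩
  obtain ⟨ψ⟩ := hK
  have hφ := isLatticeEmbedding_of_isometryEquiv ψ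
  have hχ := isLatticeEmbedding_of_isometryEquiv
    (QuadraticMap.IsometryEquiv.refl (Q.baseChange K))
  obtain ⟨S, J, hJ, hM⟩ := exists_hyperbolicSplitting
    (by rwa [IsFractionRing.finrank_right_eq R K, IsLocalizedModule.finrank_eq R⁰
      (TensorProduct.mk R K V 1) le_rfl])
    (fun x hx ↦ hχ.eq_zero_of_forall_polar hQ.1 fun w ↦ hx _) (Submodule.FG.of_finite)
    (hχ.isUnimodular_range hQ) hχ.exists_smul_mem
    ((map_ne_zero_iff _ hχ.injective).mpr hx0) (by rw [hχ.map_eq, hx, map_zero])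
  obtain ⟨J', hJ', hN⟩ := S.exists_latticeIsometric (Submodule.FG.of_finite)
    (hφ.isUnimodular_range hW')
  refine hφ.nonempty_isometryEquiv hχ (hN.trans ?_)
  rw [hM]
  exact S.latticeIsometric_of_forall_isSquare hsq hJ' hJ

end LatticeEmbedding

end

section

open nonZeroDivisors IsDedekindDomain

section FractionalIdeal

variable {R K : Type*} [CommRing R] [IsDedekindDomain R] [Field K] [Algebra R K]
  [IsFractionRing R K]

theorem FractionalIdeal.exists_eq_mul_self_of_forall_even {J : FractionalIdeal R⁰ K} (hJ : J ≠ 0)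
    (h : ∀ p : HeightOneSpectrum R, Even (FractionalIdeal.count K p J)) :
    ∃ A : FractionalIdeal R⁰ K, J = A * A := by
  choose k hk using h
  have hfin : (Function.mulSupport fun p : HeightOneSpectrum R ↦
      (p.asIdeal : FractionalIdeal R⁰ K) ^ k p).Finite := by
    refine (Filter.eventually_cofinite.mp (FractionalIdeal.finite_factors (K := K) J)).subset ?_
    intro p hp hp0
    refine hp ?_
    have : k p = 0 := by have := hk p; omega
    simp [this]
  refine ⟨∏ᶠ p : HeightOneSpectrum R, (p.asIdeal : FractionalIdeal R⁰ K) ^ k p, ?_⟩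
  rw [← finprod_mul_distrib hfin hfin]
  conv_lhs => rw [← FractionalIdeal.finprod_heightOneSpectrum_factorization' K hJ]
  refine finprod_congr fun p ↦ ?_
  rw [hk p, zpow_add₀ (FractionalIdeal.coeIdeal_ne_zero.mpr p.ne_bot)]

namespace IsDedekindDomain.HeightOneSpectrum

variable (p : HeightOneSpectrum R)

theorem valuation_eq_one_of_notMem {r : R} (hr : r ∉ p.asIdeal) :
    p.valuation K (algebraMap R K r) = 1 :=
  le_antisymm (p.valuation_le_one r) (not_lt.mp fun h ↦ hr ((p.valuation_lt_one_iff_mem r).mp h))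

theorem exists_notMem_mul_eq_of_valuation_le_one {x : K} (hx : p.valuation K x ≤ 1) :
    ∃ d ∉ p.asIdeal, ∃ r, algebraMap R K d * x = algebraMap R K r := by
  obtain ⟨n, d, h | h⟩ := p.exists_primeCompl_mul_eq_or_mul_eq (K := K) x
  · exact ⟨d, d.2, n, by rw [mul_comm, h]⟩
  · refine ⟨n, fun hn ↦ ?_, d, by rw [mul_comm, h]⟩
    have h1 : p.valuation K x * p.valuation K (algebraMap R K n) = 1 := by
      rw [← map_mul, h, p.valuation_eq_one_of_notMem d.2]
    have h2 := (p.valuation_lt_one_iff_mem (K := K) n).mpr hn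
    exact ((mul_le_mul_left hx _).trans_lt (by rwa [one_mul])).ne h1

theorem count_eq_zero_of_not_le {I : Ideal R} (hI : ¬ I ≤ p.asIdeal) :
    FractionalIdeal.count K p (I : FractionalIdeal R⁰ K) = 0 := by
  classical
  have hI0 : I ≠ 0 := fun h ↦ hI (h ▸ bot_le)
  rw [FractionalIdeal.count_coe K p hI0]
  by_contra h
  exact hI (Ideal.dvd_iff_le.mp ((Associates.count_ne_zero_iff_dvd hI0 p.irreducible).mp
    (by exact_mod_cast h)))

theorem count_spanSingleton_algebraMap_eq_zero {r : R} (hr : r ∉ p.asIdeal) :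
    FractionalIdeal.count K p (FractionalIdeal.spanSingleton R⁰ (algebraMap R K r)) = 0 := by
  rw [← FractionalIdeal.coeIdeal_span_singleton]
  exact p.count_eq_zero_of_not_le fun h ↦ hr (h (Ideal.mem_span_singleton_self r))

theorem count_spanSingleton_eq_zero {x : K} (hx : p.valuation K x = 1) :
    FractionalIdeal.count K p (FractionalIdeal.spanSingleton R⁰ x) = 0 := by
  obtain ⟨d, hd, r, h⟩ := p.exists_notMem_mul_eq_of_valuation_le_one hx.le
  have hr : r ∉ p.asIdeal := fun hr ↦ by
    have h1 : p.valuation K (algebraMap R K r) < 1 := (p.valuation_lt_one_iff_mem r).mpr hr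
    rw [← h, map_mul, p.valuation_eq_one_of_notMem hd, hx, one_mul] at h1
    exact lt_irrefl _ h1
  have hx0 : x ≠ 0 := by rintro rfl; simp at hx
  have hd0 : algebraMap R K d ≠ 0 := by
    rw [Ne, FaithfulSMul.algebraMap_eq_zero_iff]
    rintro rfl
    exact hd (zero_mem _)
  have h1 := p.count_spanSingleton_algebraMap_eq_zero (K := K) hr
  rw [← h, ← FractionalIdeal.spanSingleton_mul_spanSingleton, FractionalIdeal.count_mul K p
    (FractionalIdeal.spanSingleton_ne_zero_iff.mpr hd0)
    (FractionalIdeal.spanSingleton_ne_zero_iff.mpr hx0),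
    p.count_spanSingleton_algebraMap_eq_zero hd, zero_add] at h1
  exact h1

/-- A local generator of an ideal at a prime. -/
theorem exists_generator {I : Ideal R} (hI : I ≠ ⊥) :
    ∃ t : K, t ≠ 0 ∧ (∃ s ∉ p.asIdeal, algebraMap R K s * t ∈ (I : FractionalIdeal R⁰ K) ∧
      algebraMap R K s * t⁻¹ ∈ (I : FractionalIdeal R⁰ K)⁻¹) ∧
      FractionalIdeal.count K p (FractionalIdeal.spanSingleton R⁰ t) =
        FractionalIdeal.count K p (I : FractionalIdeal R⁰ K) := by
  have hlt : I * p.asIdeal < I := by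
    refine lt_of_le_of_ne Ideal.mul_le_left fun h ↦ p.isPrime.ne_top ?_
    rw [← Ideal.one_eq_top]
    exact mul_left_cancel₀ hI (h.trans (mul_one I).symm)
  obtain ⟨t, htI, ht⟩ := SetLike.exists_of_lt hlt
  obtain ⟨B, hB⟩ := Ideal.dvd_iff_le.mpr ((Ideal.span_singleton_le_iff_mem I).mpr htI)
  have ht0 : t ≠ 0 := fun h ↦ ht (h ▸ zero_mem _)
  have hBp : ¬ B ≤ p.asIdeal := fun h ↦ ht (by
    have := Ideal.mem_span_singleton_self t
    rw [hB] at this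
    exact Ideal.mul_mono_right h this)
  obtain ⟨s, hsB, hs⟩ := Set.not_subset.mp hBp
  have hI0 : (I : FractionalIdeal R⁰ K) ≠ 0 := FractionalIdeal.coeIdeal_ne_zero.mpr hI
  have ht0' : algebraMap R K t ≠ 0 := by rwa [Ne, FaithfulSMul.algebraMap_eq_zero_iff]
  have hB0 : B ≠ ⊥ := fun h ↦ hBp (h ▸ bot_le)
  refine ⟨algebraMap R K t, ht0', ⟨s, hs, ?_, ?_⟩, ?_⟩
  · rw [← map_mul]
    exact FractionalIdeal.mem_coeIdeal_of_mem _ (I.mul_mem_left _ htI)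
  · rw [FractionalIdeal.mem_inv_iff hI0]
    intro y hy
    obtain ⟨a, ha, rfl⟩ := (FractionalIdeal.mem_coeIdeal _).mp hy
    have : s * a ∈ Ideal.span {t} := by
      rw [hB, mul_comm s]
      exact Ideal.mul_mem_mul ha hsB
    obtain ⟨c, hc⟩ := Ideal.mem_span_singleton'.mp this
    refine (FractionalIdeal.mem_one_iff _).mpr ⟨c, ?_⟩
    rw [mul_right_comm, ← map_mul, ← hc, map_mul, mul_inv_cancel_right₀ ht0']
  · rw [← FractionalIdeal.coeIdeal_span_singleton, hB, FractionalIdeal.coeIdeal_mul,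
      FractionalIdeal.count_mul K p hI0 (FractionalIdeal.coeIdeal_ne_zero.mpr hB0),
      p.count_eq_zero_of_not_le hBp, add_zero]

end IsDedekindDomain.HeightOneSpectrum

end FractionalIdeal

end

section

open QuadraticMap WithZero

section OrthogonalBasis

variable {K E : Type*} [Field K] [AddCommGroup E] [Module K E]
  {w : Valuation K (WithZero (Multiplicative ℤ))} {q : QuadraticForm K E} {L : AddSubgroup E}

theorem Valuation.polar_le_one (hintegral : ∀ x ∈ L, w (q x) ≤ 1) {x y : E}
    (hx : x ∈ L) (hy : y ∈ L) :
    w (polar q x y) ≤ 1 :=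
  w.map_sub_le (w.map_sub_le (hintegral _ (L.add_mem hx hy)) (hintegral x hx)) (hintegral y hy)

theorem smul_mem_of_dual (hintegral : ∀ x ∈ L, w (q x) ≤ 1)
    (hdual : ∀ y, (∀ m ∈ L, w (polar q y m) ≤ 1) → y ∈ L) {c : K} (hc : w c ≤ 1) {y : E}
    (hy : y ∈ L) : c • y ∈ L := by
  refine hdual _ fun m hm ↦ ?_
  rw [polar_smul_left, smul_eq_mul, map_mul]
  exact mul_le_one' hc (w.polar_le_one hintegral hy hm)

/-- Orthogonal projection onto the complement of an orthogonal family of vectors of unit norm. -/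
theorem exists_polar_eq_zero_of_orthogonal (hw2 : w 2 = 1) (hintegral : ∀ x ∈ L, w (q x) ≤ 1)
    (hdual : ∀ y, (∀ m ∈ L, w (polar q y m) ≤ 1) → y ∈ L) {n : ℕ} {b : Fin n → E}
    (hbL : ∀ i, b i ∈ L) (hb : ∀ i, w (q (b i)) = 1)
    (horth : ∀ i j, i ≠ j → polar q (b i) (b j) = 0) {m : E} (hm : m ∈ L) :
    ∃ m' ∈ L, (∀ i, polar q m' (b i) = 0) ∧
      ∀ y, (∀ i, polar q y (b i) = 0) → polar q y m = polar q y m' := by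
  let a (i : Fin n) : K := polar q m (b i) * (2 * q (b i))⁻¹
  have ha (i) : w (a i) ≤ 1 := by
    simp only [a, map_mul, map_inv₀, hw2, hb, mul_one, inv_one]
    exact w.polar_le_one hintegral hm (hbL i)
  have hne (i) : 2 * q (b i) ≠ 0 := by
    rw [← w.ne_zero_iff, map_mul, hw2, hb, mul_one]
    exact one_ne_zero
  refine ⟨m - ∑ i, a i • b i, L.sub_mem hm (L.sum_mem fun i _ ↦
    smul_mem_of_dual hintegral hdual (ha i) (hbL i)), fun j ↦ ?_, fun y hy ↦ ?_⟩
  · rw [polar_sub_left, ← polarBilin_apply_apply q (∑ i, a i • b i), map_sum, LinearMap.sum_apply,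
      Finset.sum_eq_single j]
    · rw [polarBilin_apply_apply, polar_smul_left, polar_self, smul_eq_mul, nsmul_eq_mul,
        Nat.cast_ofNat, inv_mul_cancel_right₀ (hne j), sub_self]
    · intro i _ hij
      rw [polarBilin_apply_apply, polar_smul_left, horth i j hij, smul_zero]
    · simp
  · rw [polar_sub_right, ← polarBilin_apply_apply q y (∑ i, a i • b i), map_sum,
      Finset.sum_eq_zero, sub_zero]
    intro i _
    rw [polarBilin_apply_apply, polar_smul_right, hy, smul_zero]

theorem exists_orthogonal_family [FiniteDimensional K E] (hw2 : w 2 = 1) {π : K}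
    (hπ : w π = exp (-1 : ℤ)) (hq : ∀ x, (∀ y, polar q x y = 0) → x = 0)
    (hintegral : ∀ x ∈ L, w (q x) ≤ 1) (hdual : ∀ y, (∀ m ∈ L, w (polar q y m) ≤ 1) → y ∈ L)
    (hscale : ∀ y, ∃ c : K, c ≠ 0 ∧ c • y ∈ L) {n : ℕ} (hn : n ≤ Module.finrank K E) :
    ∃ b : Fin n → E, (∀ i, b i ∈ L) ∧ (∀ i, w (q (b i)) = 1) ∧
      ∀ i j, i ≠ j → polar q (b i) (b j) = 0 := by
  induction n with
  | zero => exact ⟨Fin.elim0, fun i ↦ i.elim0, fun i ↦ i.elim0, fun i ↦ i.elim0⟩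
  | succ n ih =>
    obtain ⟨b, hbL, hb, horth⟩ := ih (by omega)
    suffices ∃ y ∈ L, (∀ i, polar q y (b i) = 0) ∧ w (q y) = 1 by
      obtain ⟨y, hyL, hyb, hy⟩ := this
      refine ⟨Fin.cons y b, Fin.cases hyL hbL, Fin.cases hy hb, ?_⟩
      refine Fin.cases (Fin.cases (fun h ↦ absurd rfl h) fun j _ ↦ hyb j) fun i ↦
        Fin.cases (fun _ ↦ ?_) fun j hij ↦ horth i j fun h ↦ hij (congrArg _ h)
      simpa [polar_comm] using hyb i
    by_contra! hlt
    have hlt' {y : E} (hy : y ∈ L) (hyb : ∀ i, polar q y (b i) = 0) : w (q y) ≤ exp (-1 : ℤ) := by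
      rw [← lt_mul_exp_iff_le exp_ne_zero, ← exp_add, neg_add_cancel, exp_zero]
      exact lt_of_le_of_ne (hintegral y hy) (hlt y hy hyb)
    have hπ0 : π ≠ 0 := by
      rw [← w.ne_zero_iff, hπ]
      exact exp_ne_zero
    have hdiv {y : E} (hy : y ∈ L) (hyb : ∀ i, polar q y (b i) = 0) : π⁻¹ • y ∈ L := by
      refine hdual _ fun m hm ↦ ?_
      obtain ⟨m', hm', hm'b, h⟩ :=
        exists_polar_eq_zero_of_orthogonal hw2 hintegral hdual hbL hb horth hm
      rw [polar_smul_left, h y hyb, smul_eq_mul, map_mul, map_inv₀, hπ]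
      have : w (polar q y m') ≤ exp (-1 : ℤ) := by
        refine w.map_sub_le (w.map_sub_le (hlt' (L.add_mem hy hm') fun i ↦ ?_) (hlt' hy hyb))
          (hlt' hm' hm'b)
        rw [polar_add_left, hyb, hm'b, add_zero]
      exact (mul_le_mul_right this _).trans_eq (inv_mul_cancel₀ exp_ne_zero)
    let F : E →ₗ[K] (Fin n → K) := LinearMap.pi fun i ↦ q.polarBilin (b i)
    obtain ⟨y₀, hy₀, hy₀0⟩ := Submodule.exists_mem_ne_zero_of_ne_bot
      (F.ker_ne_bot_of_finrank_lt (by simpa using hn))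
    have hy₀b (i) : polar q y₀ (b i) = 0 := by
      rw [polar_comm]; exact congrFun hy₀ i
    obtain ⟨c, hc, hcL⟩ := hscale y₀
    have hpow (k : ℕ) : (π⁻¹ ^ k * c) • y₀ ∈ L := by
      induction k with
      | zero => simpa using hcL
      | succ k ih =>
        rw [pow_succ', mul_assoc, mul_smul]
        refine hdiv ih fun i ↦ ?_
        rw [polar_smul_left, hy₀b, smul_zero]
    refine smul_ne_zero hc hy₀0 (hq _ fun z ↦ ?_)
    obtain ⟨d, hd, hdL⟩ := hscale z
    by_contra hne
    have hne' : w (polar q (c • y₀) (d • z)) ≠ 0 := by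
      rw [w.ne_zero_iff, polar_smul_right, smul_eq_mul]
      exact mul_ne_zero hd hne
    obtain ⟨k, hk⟩ := exists_exp_neg_natCast_lt hne'
    have h := w.polar_le_one hintegral (hpow k) hdL
    rw [mul_smul, polar_smul_left, smul_eq_mul, map_mul, map_pow, map_inv₀, hπ] at h
    refine hk.not_ge ?_
    have h2 := mul_le_mul_right h (exp (-(k : ℤ)))
    have h3 : exp (-(k : ℤ)) * (exp (-1 : ℤ))⁻¹ ^ k = 1 := by
      rw [← exp_neg, ← exp_nsmul, ← exp_add]
      simp
    rwa [← mul_assoc, h3, one_mul, mul_one] at h2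

theorem linearIndependent_of_orthogonal {n : ℕ} {b : Fin n → E} (h2 : (2 : K) ≠ 0)
    (hb : ∀ i, q (b i) ≠ 0) (horth : ∀ i j, i ≠ j → polar q (b i) (b j) = 0) :
    LinearIndependent K b := by
  rw [Fintype.linearIndependent_iff]
  intro g hg i
  have h : q.polarBilin (∑ j, g j • b j) (b i) = 0 := by rw [hg, map_zero]; rfl
  rw [map_sum, LinearMap.sum_apply, Finset.sum_eq_single i] at h
  · rw [polarBilin_apply_apply, polar_smul_left, polar_self] at h
    simpa [h2, hb i] using h
  · intro j _ hj
    rw [polarBilin_apply_apply, polar_smul_left, horth j i hj, smul_zero]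
  · simp

theorem exists_orthogonal_basis_of_dual [FiniteDimensional K E] (hw2 : w 2 = 1) {π : K}
    (hπ : w π = exp (-1 : ℤ)) (hq : ∀ x, (∀ y, polar q x y = 0) → x = 0)
    (hintegral : ∀ x ∈ L, w (q x) ≤ 1) (hdual : ∀ y, (∀ m ∈ L, w (polar q y m) ≤ 1) → y ∈ L)
    (hscale : ∀ y, ∃ c : K, c ≠ 0 ∧ c • y ∈ L) :
    ∃ b : Module.Basis (Fin (Module.finrank K E)) K E, (∀ i, b i ∈ L) ∧ (∀ i, w (q (b i)) = 1) ∧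
      ∀ i j, i ≠ j → polar q (b i) (b j) = 0 := by
  obtain ⟨b, hbL, hb, horth⟩ := exists_orthogonal_family hw2 hπ hq hintegral hdual hscale le_rfl
  have h2 : (2 : K) ≠ 0 := by
    rw [← w.ne_zero_iff, hw2]
    exact one_ne_zero
  have hb0 (i) : q (b i) ≠ 0 := by
    rw [← w.ne_zero_iff, hb]
    exact one_ne_zero
  refine ⟨basisOfLinearIndependentOfCardEqFinrank' b
    (linearIndependent_of_orthogonal h2 hb0 horth) (Fintype.card_fin _), ?_⟩
  simpa using ⟨hbL, hb, horth⟩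

/-- An isometry of a nondegenerate quadratic space is a product of reflections. -/
theorem exists_list_prod_orthReflection_eq_of_field [FiniteDimensional K E] (h2 : (2 : K) ≠ 0)
    (hq : ∀ x, (∀ y, polar q x y = 0) → x = 0) (g : Module.End K E) (hg : ∀ x, q (g x) = q x) :
    ∃ l : List E, (∀ x ∈ l, q x ≠ 0) ∧ g = (l.map (orthReflection q)).prod := by
  classical
  have : Invertible (2 : K) := invertibleOfNonzero h2
  obtain ⟨b, hb⟩ := LinearMap.BilinForm.exists_orthogonal_basis (B := q.polarBilin)
    ⟨fun x y ↦ polar_comm q x y⟩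
  have horth (i j) (h : i ≠ j) : polar q (b i) (b j) = 0 := hb h
  have hb0 (i) : q (b i) ≠ 0 := fun h ↦ by
    refine b.ne_zero i (hq _ fun y ↦ ?_)
    have : q.polarBilin (b i) = 0 := b.ext fun j ↦ by
      rw [polarBilin_apply_apply, LinearMap.zero_apply]
      by_cases hij : i = j
      · rw [← hij, polar_self, h, smul_zero]
      · exact horth i j hij
    rw [← polarBilin_apply_apply, this, LinearMap.zero_apply]
  let w : Valuation K (WithZero (Multiplicative ℤ)) := 1
  have hw {x : K} (hx : x ≠ 0) : w x = 1 := Valuation.one_apply_of_ne_zero hx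
  have hw' (x : K) : w x ≤ 1 := Valuation.one_apply_le_one x
  obtain ⟨l, hl, h⟩ := exists_list_prod_orthReflection_eq w (hw h2) q ⊤ (fun _ _ _ _ ↦ trivial)
    (fun x _ ↦ hw' _) b (fun _ ↦ trivial) (fun i ↦ hw (hb0 i)) horth g hg fun _ _ ↦ trivial
  refine ⟨l, fun x hx h0 ↦ ?_, h⟩
  have := hl x hx
  rw [h0, map_zero] at this
  exact zero_ne_one this

end OrthogonalBasis

end

section

open QuadraticMap nonZeroDivisors IsDedekindDomain

section SpinorNorm

variable {R K E : Type*} [CommRing R] [IsDedekindDomain R] [Field K] [Algebra R K]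
  [IsFractionRing R K] [AddCommGroup E] [Module K E] [Module R E] [IsScalarTower R K E]

/-- The localization at `p` of the dual of a lattice. -/
def localDual (p : HeightOneSpectrum R) (q : QuadraticForm K E) (M : Submodule R E) :
    AddSubgroup E where
  carrier := {y | ∀ m ∈ M, p.valuation K (polar q y m) ≤ 1}
  zero_mem' := fun m _ ↦ by simp
  add_mem' := fun {x y} hx hy m hm ↦ by
    rw [polar_add_left]
    exact (p.valuation K).map_add_le (hx m hm) (hy m hm)
  neg_mem' := fun {x} hx m hm ↦ by
    rw [polar_neg_left, Valuation.map_neg]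
    exact hx m hm

theorem IsDedekindDomain.HeightOneSpectrum.valuation_le_one_of_mem_one (p : HeightOneSpectrum R)
    {x : K} (hx : x ∈ (1 : FractionalIdeal R⁰ K)) : p.valuation K x ≤ 1 := by
  obtain ⟨r, rfl⟩ := (FractionalIdeal.mem_one_iff _).mp hx
  exact p.valuation_le_one r

theorem exists_notMem_smul_mem {p : HeightOneSpectrum R} {q : QuadraticForm K E}
    {M : Submodule R E} (hfg : M.FG) (hM : IsUnimodular R q M) {y : E} (hy : y ∈ localDual p q M) :
    ∃ s ∉ p.asIdeal, s • y ∈ M := by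
  obtain ⟨t, rfl⟩ := hfg
  choose! d hd r hr using fun m (hm : m ∈ t) ↦
    p.exists_notMem_mul_eq_of_valuation_le_one (hy m (Submodule.subset_span hm))
  refine ⟨∏ m ∈ t, d m, fun h ↦ ?_, (hM _).mpr fun m hm ↦ ?_⟩
  · obtain ⟨m, hm, hdm⟩ := p.isPrime.prod_mem_iff.mp h
    exact hd m hm hdm
  · induction hm using Submodule.span_induction with
    | mem m hm =>
      obtain ⟨a, ha⟩ := Finset.dvd_prod_of_mem d hm
      rw [ha, ← algebraMap_smul K (d m * a), polar_smul_left, smul_eq_mul, map_mul, mul_right_comm,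
        hr m hm, ← map_mul]
      exact FractionalIdeal.algebraMap_mem_one _
    | zero => simp
    | add x z _ _ hx hz =>
      rw [polar_add_right]
      exact FractionalIdeal.add_mem hx hz
    | smul a x _ hx =>
      rw [← algebraMap_smul K a x, polar_smul_right]
      exact FractionalIdeal.one_mul_mem (FractionalIdeal.algebraMap_mem_one _) hx

variable [Invertible (2 : R)]

theorem IsDedekindDomain.HeightOneSpectrum.valuation_two (p : HeightOneSpectrum R) :
    p.valuation K 2 = 1 := by
  rw [← map_ofNat (algebraMap R K) 2]
  exact p.valuation_eq_one_of_notMem fun h ↦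
    p.isPrime.ne_top (Ideal.eq_top_of_isUnit_mem _ h (isUnit_of_invertible 2))

/-- An isometry which preserves a unimodular lattice locally at `p` is a product of reflections
along vectors whose norm is a unit at `p`. -/
theorem exists_list_prod_orthReflection_eq_of_local [FiniteDimensional K E]
    {p : HeightOneSpectrum R} {q : QuadraticForm K E} (hq : ∀ x, (∀ y, polar q x y = 0) → x = 0)
    {M : Submodule R E} (hfg : M.FG) (hM : IsUnimodular R q M)
    (hspan : ∀ z, ∃ r ≠ (0 : R), r • z ∈ M) (g : q.IsometryEquiv q)
    (hg : ∀ m ∈ M, ∃ s ∉ p.asIdeal, s • g.symm m ∈ M) :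
    ∃ l : List E, (∀ x ∈ l, p.valuation K (q x) = 1) ∧
      g.toLinearEquiv.toLinearMap = (l.map (orthReflection q)).prod := by
  have hle : ∀ m ∈ M, m ∈ localDual p q M := fun m hm m' hm' ↦
    p.valuation_le_one_of_mem_one (hM.polar_mem hm hm')
  have hintegral : ∀ y ∈ localDual p q M, p.valuation K (q y) ≤ 1 := fun y hy ↦ by
    obtain ⟨s, hs, hsy⟩ := exists_notMem_smul_mem hfg hM hy
    have h := p.valuation_le_one_of_mem_one (hM.map_mem hsy)
    rwa [← algebraMap_smul K s, QuadraticMap.map_smul, smul_eq_mul, map_mul, map_mul,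
      p.valuation_eq_one_of_notMem hs, one_mul, one_mul] at h
  have hdual : ∀ y, (∀ m ∈ localDual p q M, p.valuation K (polar q y m) ≤ 1) →
      y ∈ localDual p q M := fun y hy m hm ↦ hy m (hle m hm)
  have hscale : ∀ y, ∃ c : K, c ≠ 0 ∧ c • y ∈ localDual p q M := fun y ↦ by
    obtain ⟨r, hr, hry⟩ := hspan y
    exact ⟨algebraMap R K r, by simpa using hr, hle _ (by rwa [algebraMap_smul])⟩
  obtain ⟨π, hπ⟩ := p.valuation_exists_uniformizer K
  obtain ⟨b, hbM, hb, horth⟩ :=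
    exists_orthogonal_basis_of_dual p.valuation_two hπ hq hintegral hdual hscale
  refine exists_list_prod_orthReflection_eq (p.valuation K) p.valuation_two q (localDual p q M)
    (fun c hc y hy ↦ smul_mem_of_dual hintegral hdual hc hy) hintegral b hbM hb horth _ g.map_app
    fun y hy m hm ↦ ?_
  obtain ⟨s, hs, hsm⟩ := hg m hm
  have h := hy _ hsm
  rw [← g.polar_apply, ← algebraMap_smul K s, map_smul, g.apply_symm_apply, polar_smul_right,
    smul_eq_mul, map_mul, p.valuation_eq_one_of_notMem hs, one_mul] at h
  exact h

namespace HyperbolicSplitting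

variable {q : QuadraticForm K E} (S : HyperbolicSplitting R q)

theorem map_e_sub_smul_f (t : K) : q (S.e - t • S.f) = -t := by
  rw [quadForm_sub_smul, S.map_e, S.map_f, S.polar_f_e]
  ring

theorem orthReflection_mul_eq_scale {t : K} (ht : t ≠ 0) :
    orthReflection q (S.e - (1 : K) • S.f) * orthReflection q (S.e - t • S.f) =
      (S.scale ht).toLinearEquiv.toLinearMap := by
  ext y
  have h : (S.scale ht).toLinearEquiv.toLinearMap y =
    (t * S.coordE y) • S.e + (t⁻¹ * S.coordF y) • S.f + S.proj y := S.scale_apply ht y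
  rw [h, Module.End.mul_apply, orthReflection_apply, orthReflection_apply, map_e_sub_smul_f,
    map_e_sub_smul_f]
  simp only [polar_sub_right, polar_sub_left, polar_smul_left, polar_smul_right, S.polar_e_e,
    S.polar_f_f, S.polar_e_f, S.polar_f_e, polar_comm q S.e y, polar_comm q S.f y,
    S.coordE_apply, S.coordF_apply, S.proj_apply, smul_eq_mul, inv_neg, inv_one]
  match_scalars <;> field_simp <;> ring

theorem smul_scale_mem_lattice {t : K} (ht : t ≠ 0) {I B : FractionalIdeal R⁰ K} {s : R}
    (hst : algebraMap R K s * t ∈ B) (hst' : algebraMap R K s * t⁻¹ ∈ B⁻¹) {m : E}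
    (hm : m ∈ S.lattice I) : s • S.scale ht m ∈ S.lattice (I * B) := by
  rw [← algebraMap_smul K s, S.scale_apply, S.mem_lattice, map_smul, map_smul, map_smul,
    S.coordE_add, S.coordF_add, S.proj_add, mul_inv, smul_eq_mul, smul_eq_mul, ← mul_assoc,
    ← mul_assoc]
  obtain ⟨h₁, h₂, h₃⟩ := S.mem_lattice.mp hm
  refine ⟨?_, ?_, by rw [algebraMap_smul]; exact S.core.smul_mem s h₃⟩
  · rw [mul_comm I]; exact FractionalIdeal.mul_mem_mul hst h₁
  · rw [mul_comm I⁻¹]; exact FractionalIdeal.mul_mem_mul hst' h₂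

/-- The quotient of two isometric lattices with the same core is a square in the class group. -/
theorem isSquare_mk0_of_latticeIsometric [FiniteDimensional K E]
    (hq : ∀ x, (∀ y, polar q x y = 0) → x = 0) {I : FractionalIdeal R⁰ K} (hI : I ≠ 0)
    (hfg : (S.lattice I).FG) (A : (Ideal R)⁰)
    (h : LatticeIsometric q (S.lattice I) (S.lattice (I * (A : Ideal R)))) :
    IsSquare (ClassGroup.mk0 A) := by
  obtain ⟨σ, hσ⟩ := h
  have h2 : (2 : K) ≠ 0 := two_ne_zero_of_invertible (R := R)
  have hA0 : (A : Ideal R) ≠ ⊥ := nonZeroDivisors.coe_ne_zero A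
  have hA : ((A : Ideal R) : FractionalIdeal R⁰ K) ≠ 0 := FractionalIdeal.coeIdeal_ne_zero.mpr hA0
  obtain ⟨l, hl, hσl⟩ := exists_list_prod_orthReflection_eq_of_field h2 hq
    σ.toLinearEquiv.toLinearMap σ.map_app
  set c : K := (l.map q).prod with hc
  have hc0 : c ≠ 0 := by
    refine List.prod_ne_zero fun h ↦ ?_
    obtain ⟨x, hx, h0⟩ := List.mem_map.mp h
    exact hl x hx h0
  have hspan {x : K} (hx : x ≠ 0) : FractionalIdeal.spanSingleton R⁰ x ≠ 0 :=
    FractionalIdeal.spanSingleton_ne_zero_iff.mpr hx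
  obtain ⟨B, hB⟩ := FractionalIdeal.exists_eq_mul_self_of_forall_even
    (J := FractionalIdeal.spanSingleton R⁰ c * ((A : Ideal R) : FractionalIdeal R⁰ K))
    (mul_ne_zero (hspan hc0) hA)
    fun p ↦ by
      obtain ⟨t, ht, ⟨s, hs, hst, hst'⟩, hcount⟩ := p.exists_generator (K := K) hA0
      obtain ⟨l', hl', hgl'⟩ := exists_list_prod_orthReflection_eq_of_local (p := p) hq hfg
        (S.isUnimodular_lattice hI) (S.exists_smul_mem_lattice hI) (σ.trans (S.scale ht).symm)
        fun m hm ↦ by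
          refine ⟨s, hs, (hσ _).mpr ?_⟩
          change σ (s • σ.symm (S.scale ht m)) ∈ _
          rw [← algebraMap_smul K s, map_smul, σ.apply_symm_apply, algebraMap_smul]
          exact S.smul_scale_mem_lattice ht hst hst' hm
      have hσ' : (S.scale ht).toLinearEquiv.toLinearMap * (l'.map (orthReflection q)).prod =
          (l.map (orthReflection q)).prod := by
        rw [← hgl', ← hσl]
        ext y
        exact (S.scale ht).apply_symm_apply (σ y)
      have hprod : ((l.reverse ++ (S.e - (1 : K) • S.f) :: (S.e - t • S.f) :: l').map
          (orthReflection q)).prod = 1 := by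
        rw [List.map_append, List.prod_append, List.map_cons, List.map_cons, List.prod_cons,
          List.prod_cons, ← mul_assoc (orthReflection q _), S.orthReflection_mul_eq_scale ht, hσ',
          prod_reverse_mul_prod_orthReflection]
      have hd : ∀ x ∈ l', q x ≠ 0 := fun x hx h0 ↦ by
        have := hl' x hx
        rw [h0, map_zero] at this
        exact zero_ne_one this
      obtain ⟨z, hz⟩ := isSquare_prod_of_prod_orthReflection_eq_one h2 hq _ (fun x hx ↦ by
        simp only [List.mem_append, List.mem_reverse, List.mem_cons] at hx
        obtain hx | rfl | rfl | hx := hx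
        · exact hl x hx
        · rw [S.map_e_sub_smul_f]; simp
        · rw [S.map_e_sub_smul_f]; simpa using ht
        · exact hd x hx) hprod
      set d : K := (l'.map q).prod
      have hd1 : p.valuation K d = 1 := by
        rw [map_list_prod, List.prod_eq_one]
        simpa using hl'
      have hd0 : d ≠ 0 := by
        rw [← (p.valuation K).ne_zero_iff, hd1]
        exact one_ne_zero
      have hz' : c * t * d = z * z := by
        rw [← hz, List.map_append, List.prod_append, List.map_reverse, List.prod_reverse,
          List.map_cons, List.map_cons, List.prod_cons, List.prod_cons, S.map_e_sub_smul_f,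
          S.map_e_sub_smul_f]
        ring
      have hz0 : z ≠ 0 := by
        rintro rfl
        simp [hc0, ht, hd0] at hz'
      have h := congrArg
        (fun x ↦ FractionalIdeal.count K p (FractionalIdeal.spanSingleton R⁰ x)) hz'
      simp only [← FractionalIdeal.spanSingleton_mul_spanSingleton] at h
      rw [FractionalIdeal.count_mul K p (mul_ne_zero (hspan hc0) (hspan ht)) (hspan hd0),
        FractionalIdeal.count_mul K p (hspan hc0) (hspan ht), hcount,
        p.count_spanSingleton_eq_zero hd1, add_zero,
        FractionalIdeal.count_mul K p (hspan hz0) (hspan hz0)] at h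
      rw [FractionalIdeal.count_mul K p (hspan hc0) hA, h]
      exact ⟨_, rfl⟩
  have hB0 : B ≠ 0 := by
    rintro rfl
    rw [mul_zero] at hB
    exact mul_ne_zero (hspan hc0) hA hB
  refine ⟨ClassGroup.mk (K := K) (Units.mk0 B hB0), ?_⟩
  rw [← ClassGroup.mk_mk0 K A, ← map_mul, ← div_eq_one, ← map_div, ClassGroup.mk_eq_one_iff,
    FractionalIdeal.isPrincipal_iff]
  refine ⟨c⁻¹, ?_⟩
  have : ((A : Ideal R) : FractionalIdeal R⁰ K) =
      FractionalIdeal.spanSingleton R⁰ c⁻¹ * (B * B) := by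
    rw [← hB, ← mul_assoc, FractionalIdeal.spanSingleton_mul_spanSingleton, inv_mul_cancel₀ hc0]
    simp
  rw [Units.val_div_eq_div_val, Units.val_mul, Units.val_mk0, div_eq_iff (mul_ne_zero hB0 hB0)]
  exact this

end HyperbolicSplitting

end SpinorNorm

end

section

open QuadraticMap nonZeroDivisors TensorProduct IsDedekindDomain

section Countable

open Polynomial in
theorem Polynomial.countable_of_countable (k : Type*) [Field k] [Countable k] : Countable k[X] :=
  Cardinal.mk_le_aleph0_iff.mp (Polynomial.cardinalMk_le_max.trans
    (max_le (Cardinal.mk_le_aleph0_iff.mpr inferInstance) le_rfl))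

theorem RatFunc.countable_of_countable (k : Type*) [Field k] [Countable k] :
    Countable (RatFunc k) := by
  have := Polynomial.countable_of_countable k
  refine Function.Surjective.countable (f := fun a : Polynomial k × Polynomial k ↦
    algebraMap _ (RatFunc k) a.1 / algebraMap _ (RatFunc k) a.2) fun x ↦ ⟨(x.num, x.denom), ?_⟩
  exact RatFunc.num_div_denom x

theorem Module.Finite.countable (A M : Type*) [Ring A] [Countable A] [AddCommGroup M] [Module A M]
    [Module.Finite A M] : Countable M := by
  obtain ⟨n, f, hf⟩ := Module.Finite.exists_fin' A M
  exact hf.countable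

theorem FunctionField.countable (k K : Type*) [Field k] [Finite k] [Field K]
    [Algebra (RatFunc k) K] [h : FunctionField k K] : Countable K := by
  have := RatFunc.countable_of_countable k
  have : Module.Finite (RatFunc k) K := h
  exact Module.Finite.countable (RatFunc k) K

end Countable

section Transport

variable {R K E : Type*} [CommRing R] [IsDedekindDomain R] [Field K] [Algebra R K]
  [IsFractionRing R K] [AddCommGroup E] [Module K E] [Module R E] [IsScalarTower R K E]

/-- An integral quadratic form on a lattice, transported along a parametrization of the lattice. -/
theorem exists_quadraticForm_of_forall_mem_one {W : Type*} [AddCommGroup W] [Module R W]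
    {q : QuadraticForm K E} (φ : W →ₗ[R] E)
    (hφ : ∀ w, q (φ w) ∈ (1 : FractionalIdeal R⁰ K)) :
    ∃ qW : QuadraticForm R W, ∀ w, q (φ w) = algebraMap R K (qW w) := by
  choose F hF using fun w ↦ (FractionalIdeal.mem_one_iff _).mp (hφ w)
  have inj := IsFractionRing.injective R K
  have hpol (x y : W) : algebraMap R K (F (x + y) - F x - F y) = polar q (φ x) (φ y) := by
    simp only [polar, map_sub, hF, map_add]
  have smul (r : R) (w : W) : φ (r • w) = algebraMap R K r • φ w := by
    rw [map_smul, algebraMap_smul]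
  refine ⟨{
    toFun := F
    toFun_smul := fun r w ↦ inj ?_
    exists_companion' := ⟨LinearMap.mk₂ R (fun x y ↦ F (x + y) - F x - F y)
      (fun x y z ↦ inj ?_) (fun r x y ↦ inj ?_) (fun x y z ↦ inj ?_) (fun r x y ↦ inj ?_),
      fun x y ↦ ?_⟩ }, fun w ↦ (hF w).symm⟩
  · rw [hF, smul, QuadraticMap.map_smul, smul_eq_mul, smul_eq_mul, map_mul, map_mul, hF]
  · rw [map_add, hpol, hpol, hpol, map_add, polar_add_left]
  · rw [smul_eq_mul, map_mul, hpol, hpol, smul, polar_smul_left, smul_eq_mul]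
  · rw [map_add, hpol, hpol, hpol, map_add, polar_add_right]
  · rw [smul_eq_mul, map_mul, hpol, hpol, smul, polar_smul_right, smul_eq_mul]
  · rw [LinearMap.mk₂_apply]
    ring

/-- A lattice in a quadratic space comes from a quadratic module in any universe in which it is
small. -/
theorem exists_isLatticeEmbedding_range_eq {q : QuadraticForm K E} {N : Submodule R E}
    [Small.{u} N] (hfg : N.FG) (hN : ∀ x ∈ N, q x ∈ (1 : FractionalIdeal R⁰ K))
    (hspan : ∀ z, ∃ r ≠ (0 : R), r • z ∈ N) :
    ∃ (W : Type u) (_ : AddCommGroup W) (_ : Module R W) (_ : Module.Projective R W)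
      (_ : Module.Finite R W) (qW : QuadraticForm R W) (φ : W →ₗ[R] E),
      IsLatticeEmbedding qW q φ ∧ LinearMap.range φ = N := by
  let ε : Shrink.{u} N ≃ₗ[R] N := Shrink.linearEquiv R N
  let φ : Shrink.{u} N →ₗ[R] E := N.subtype ∘ₗ ε.toLinearMap
  have hinj : Function.Injective φ := N.injective_subtype.comp ε.injective
  have hrange : LinearMap.range φ = N := by
    rw [LinearMap.range_comp, LinearEquiv.range, Submodule.map_top, Submodule.range_subtype]
  have : Module.Finite R N := Module.Finite.iff_fg.mpr hfg
  have hfin : Module.Finite R (Shrink.{u} N) := Module.Finite.equiv ε.symm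
  have : Module.IsTorsionFree R E := Module.IsTorsionFree.trans_faithfulSMul R K E
  have : Module.IsTorsionFree R N := inferInstance
  have : Module.FinitePresentation R N := Module.finitePresentation_of_finite R N
  have : Module.Flat R N := inferInstance
  have : Module.Projective R N := Module.Flat.projective_of_finitePresentation
  have hproj : Module.Projective R (Shrink.{u} N) := Module.Projective.of_equiv ε.symm
  obtain ⟨qW, hqW⟩ := exists_quadraticForm_of_forall_mem_one φ fun w ↦ hN _ (ε w).2
  exact ⟨_, _, _, hproj, hfin, qW, φ, ⟨hinj, hqW, by rwa [hrange]⟩, hrange⟩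

theorem inv_smul_inv_smul_tmul {A X : Type*} [CommRing A] [Algebra R A] [AddCommGroup X]
    [Module R X] {s : R} {u : Aˣ} (hu : (u : A) = algebraMap R A s) (x : X) :
    (↑u⁻¹ : A) • (↑u⁻¹ : A) • (1 : A) ⊗ₜ[R] ((s * s) • x) = 1 ⊗ₜ[R] x := by
  rw [tmul_smul, ← algebraMap_smul A (s * s), map_mul, ← hu, smul_smul, smul_smul]
  simp [mul_assoc]

namespace IsLatticeEmbedding

variable {V W : Type*} [AddCommGroup V] [Module R V] [AddCommGroup W] [Module R W]
  {qW : QuadraticForm R W} {Q : QuadraticForm R V} {q : QuadraticForm K E}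
  {φ : W →ₗ[R] E} {χ : V →ₗ[R] E}

theorem isLocalizedModule (h : IsLatticeEmbedding qW q φ) : IsLocalizedModule R⁰ φ where
  map_units r := by
    have hr : algebraMap R K r ≠ 0 := by simp
    rw [Module.End.isUnit_iff]
    constructor
    · intro x y hxy
      simp only [Module.algebraMap_end_apply, ← algebraMap_smul K (r : R)] at hxy
      exact smul_right_injective E hr hxy
    · intro x
      refine ⟨(algebraMap R K r)⁻¹ • x, ?_⟩
      rw [Module.algebraMap_end_apply, ← algebraMap_smul K (r : R), smul_inv_smul₀ hr]
  surj z := by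
    obtain ⟨r, hr, w, hw⟩ := h.exists_smul_mem z
    exact ⟨(w, ⟨r, mem_nonZeroDivisors_of_ne_zero hr⟩), hw.symm⟩
  exists_of_eq hxy := ⟨1, by rw [h.injective hxy]⟩

/-- An isometry of quadratic modules extends to the ambient quadratic space. -/
theorem latticeIsometric (h : IsLatticeEmbedding qW q φ) (h' : IsLatticeEmbedding Q q χ)
    (g : qW.IsometryEquiv Q) :
    LatticeIsometric q (LinearMap.range φ) (LinearMap.range χ) := by
  have := h.isLocalizedModule
  have := h'.isLocalizedModule
  let σ : E ≃ₗ[K] E := IsLocalizedModule.mapEquiv R⁰ φ χ K g.toLinearEquiv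
  have hσ (w : W) : σ (φ w) = χ (g w) :=
    IsLocalizedModule.map_apply R⁰ φ χ g.toLinearEquiv.toLinearMap w
  have hq (x : E) : q (σ x) = q x := by
    obtain ⟨r, hr, w, hw⟩ := h.exists_smul_mem x
    have hr' : algebraMap R K r ≠ 0 := by simpa using hr
    have h1 : q (σ (r • x)) = q (r • x) := by
      rw [← hw, hσ, h'.map_eq, h.map_eq, g.map_app]
    rw [← algebraMap_smul K r, map_smul, QuadraticMap.map_smul,
      QuadraticMap.map_smul, smul_eq_mul, smul_eq_mul] at h1
    exact mul_left_cancel₀ (mul_ne_zero hr' hr') h1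
  refine ⟨⟨σ, hq⟩, fun y ↦ ?_⟩
  change y ∈ _ ↔ σ y ∈ _
  constructor
  · rintro ⟨w, rfl⟩
    exact ⟨g w, (hσ w).symm⟩
  · rintro ⟨v, hv⟩
    refine ⟨g.symm v, σ.injective ?_⟩
    rw [hσ, g.apply_symm_apply, hv]

variable [Invertible (2 : R)]

/-- Lattices which differ by an isometry up to a denominator `s` become isometric over any algebra
in which `s` is invertible. -/
theorem nonempty_baseChange_isometryEquiv (A : Type*) [CommRing A] [Algebra R A]
    (h : IsLatticeEmbedding qW q φ) (h' : IsLatticeEmbedding Q q χ) (g : q.IsometryEquiv q)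
    {s : R} (hs : IsUnit (algebraMap R A s)) (hg : ∀ w, s • g (φ w) ∈ LinearMap.range χ)
    (hg' : ∀ v, s • g.symm (χ v) ∈ LinearMap.range φ) :
    Nonempty ((qW.baseChange A).IsometryEquiv (Q.baseChange A)) := by
  let G : E →ₗ[R] E := g.toLinearEquiv.toLinearMap.restrictScalars R
  let G' : E →ₗ[R] E := g.symm.toLinearEquiv.toLinearMap.restrictScalars R
  let α : W →ₗ[R] V := (LinearEquiv.ofInjective χ h'.injective).symm.toLinearMap ∘ₗ
    (s • G ∘ₗ φ).codRestrict (LinearMap.range χ) hg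
  let β : V →ₗ[R] W := (LinearEquiv.ofInjective φ h.injective).symm.toLinearMap ∘ₗ
    (s • G' ∘ₗ χ).codRestrict (LinearMap.range φ) hg'
  have hα (w : W) : χ (α w) = s • g (φ w) :=
    congrArg Subtype.val ((LinearEquiv.ofInjective χ h'.injective).apply_symm_apply ⟨_, hg w⟩)
  have hβ (v : V) : φ (β v) = s • g.symm (χ v) :=
    congrArg Subtype.val ((LinearEquiv.ofInjective φ h.injective).apply_symm_apply ⟨_, hg' v⟩)
  have hβα : β ∘ₗ α = (s * s) • LinearMap.id := LinearMap.ext fun w ↦ h.injective <| by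
    rw [LinearMap.comp_apply, hβ, hα, ← algebraMap_smul K s (g _), map_smul, g.symm_apply_apply,
      algebraMap_smul, smul_smul]
    simp
  have hαβ : α ∘ₗ β = (s * s) • LinearMap.id := LinearMap.ext fun v ↦ h'.injective <| by
    rw [LinearMap.comp_apply, hα, hβ, ← algebraMap_smul K s (g.symm _), map_smul,
      g.apply_symm_apply, algebraMap_smul, smul_smul]
    simp
  have hpol (x y : W) : polar Q (α x) (α y) = s * s * polar qW x y := by
    apply IsFractionRing.injective R K
    rw [← h'.polar_eq, hα, hα, ← algebraMap_smul K s, ← algebraMap_smul K s (g (φ y)),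
      polar_smul_left, polar_smul_right, g.polar_apply, h.polar_eq]
    simp [mul_assoc]
  obtain ⟨u, hu⟩ := hs
  have hu' : (↑u⁻¹ : A) * algebraMap R A s = 1 := by rw [← hu, Units.inv_mul]
  let Φ : A ⊗[R] W →ₗ[A] A ⊗[R] V := (↑u⁻¹ : A) • α.baseChange A
  let Ψ : A ⊗[R] V →ₗ[A] A ⊗[R] W := (↑u⁻¹ : A) • β.baseChange A
  have hΦΨ : Φ ∘ₗ Ψ = LinearMap.id := by
    ext v
    simpa [Φ, Ψ, ← LinearMap.comp_apply, hαβ] using inv_smul_inv_smul_tmul hu v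
  have hΨΦ : Ψ ∘ₗ Φ = LinearMap.id := by
    ext w
    simpa [Φ, Ψ, ← LinearMap.comp_apply, hβα] using inv_smul_inv_smul_tmul hu w
  have hform : (Q.baseChange A).comp Φ = qW.baseChange A := by
    refine QuadraticMap.polarBilin_injective ?_ ?_
    · rw [← map_ofNat (algebraMap R A) 2]
      exact (isUnit_of_invertible (2 : R)).map _
    · ext x y
      simp only [TensorProduct.AlgebraTensorModule.curry_apply,
        TensorProduct.curry_apply, LinearMap.coe_restrictScalars, polarBilin_apply_apply]
      have hΦ (z : W) : Φ (1 ⊗ₜ[R] z) = (↑u⁻¹ : A) • 1 ⊗ₜ[R] α z := by simp [Φ]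
      have hcomp (a b : A ⊗[R] W) :
          polar ((Q.baseChange A).comp Φ) a b = polar (Q.baseChange A) (Φ a) (Φ b) := by
        simp only [polar, QuadraticMap.comp_apply, map_add]
      rw [hcomp, QuadraticForm.polar_baseChange_tmul]
      rw [hΦ, hΦ, polar_smul_left, polar_smul_right, QuadraticForm.polar_baseChange_tmul, hpol]
      simp only [map_mul, smul_eq_mul]
      linear_combination (algebraMap R A (polar qW x y)) *
        (↑u⁻¹ * algebraMap R A s + 1) * hu'
  exact ⟨⟨LinearEquiv.ofLinearMap Φ Ψ hΦΨ hΨΦ, fun x ↦ DFunLike.congr_fun hform x⟩⟩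

end IsLatticeEmbedding

end Transport

end

section

open QuadraticMap nonZeroDivisors TensorProduct IsDedekindDomain

section HassePrinciple

variable {R K E : Type*} [CommRing R] [IsDedekindDomain R] [Field K] [Algebra R K]
  [IsFractionRing R K] [AddCommGroup E] [Module K E] [Module R E] [IsScalarTower R K E]

namespace HyperbolicSplitting

variable {q : QuadraticForm K E} (S : HyperbolicSplitting R q)

theorem fg_lattice {J : FractionalIdeal R⁰ K} (hJ : J ≠ 0) : (S.lattice J).FG := by
  have hI (I : FractionalIdeal R⁰ K) (hI : I ≠ 0) (z : E) :
      ((I : Submodule R K).map ((LinearMap.toSpanSingleton K E z).restrictScalars R)).FG :=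
    (FractionalIdeal.fg_of_isUnit I (Units.mk0 I hI).isUnit).map _
  refine Submodule.FG.of_le (((hI J hJ S.e).sup (hI J⁻¹ (inv_ne_zero hJ) S.f)).sup S.fg)
    fun y hy ↦ ?_
  obtain ⟨h₁, h₂, h₃⟩ := S.mem_lattice.mp hy
  rw [S.eq_add y]
  exact Submodule.add_mem_sup (Submodule.add_mem_sup ⟨_, h₁, rfl⟩ ⟨_, h₂, rfl⟩) h₃

theorem scale_symm {t : K} (ht : t ≠ 0) (y : E) :
    (S.scale ht).symm y = S.scale (inv_ne_zero ht) y := by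
  rw [S.scale_apply, inv_inv]
  rfl

end HyperbolicSplitting

/-- If the Hasse principle holds for an isotropic unimodular lattice of rank at least three, then
every ideal class is a square. -/
theorem isSquare_of_hassePrinciple [Countable K] [Invertible (2 : R)] {V : Type*}
    [AddCommGroup V] [Module R V] [Module.Projective R V] [Module.Finite R V]
    {Q : QuadraticForm R V} (hrank : 3 ≤ Module.finrank R V)
    (hQ : Function.Bijective (polarBilin Q)) {x : V} (hx0 : x ≠ 0) (hx : Q x = 0)
    (hasse : ∀ (W : Type u) [AddCommGroup W] [Module R W] [Module.Projective R W]
      [Module.Finite R W] (qW : QuadraticForm R W),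
      Nonempty ((qW.baseChange K).IsometryEquiv (Q.baseChange K)) →
      (∀ p : HeightOneSpectrum R, Nonempty ((qW.baseChange (p.adicCompletionIntegers
        K)).IsometryEquiv (Q.baseChange (p.adicCompletionIntegers K)))) →
      Nonempty (qW.IsometryEquiv Q)) (a : ClassGroup R) : IsSquare a := by
  obtain ⟨A, rfl⟩ := ClassGroup.mk0_surjective a
  have hA0 : (A : Ideal R) ≠ ⊥ := nonZeroDivisors.coe_ne_zero A
  have hA : ((A : Ideal R) : FractionalIdeal R⁰ K) ≠ 0 := FractionalIdeal.coeIdeal_ne_zero.mpr hA0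
  have hχ := isLatticeEmbedding_of_isometryEquiv
    (QuadraticMap.IsometryEquiv.refl (Q.baseChange K))
  have hq : ∀ x, (∀ y, polar (Q.baseChange K) x y = 0) → x = 0 :=
    fun x hx ↦ hχ.eq_zero_of_forall_polar hQ.1 fun w ↦ hx _
  obtain ⟨S, J, hJ, hM⟩ := exists_hyperbolicSplitting
    (by rwa [IsFractionRing.finrank_right_eq R K, IsLocalizedModule.finrank_eq R⁰
      (TensorProduct.mk R K V 1) le_rfl]) hq (Submodule.FG.of_finite)
    (hχ.isUnimodular_range hQ) hχ.exists_smul_mem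
    ((map_ne_zero_iff _ hχ.injective).mpr hx0) (by rw [hχ.map_eq, hx, map_zero])
  have hJA : J * ((A : Ideal R) : FractionalIdeal R⁰ K) ≠ 0 := mul_ne_zero hJ hA
  have hJA' : J * ((A : Ideal R) : FractionalIdeal R⁰ K) * ((A : Ideal R) : FractionalIdeal R⁰ K)⁻¹
      = J := mul_inv_cancel_right₀ hA J
  have : Countable (K ⊗[R] V) := Module.Finite.countable K _
  have : Small.{u} (S.lattice (J * ((A : Ideal R) : FractionalIdeal R⁰ K))) :=
    Countable.toSmall _
  obtain ⟨W, _, _, _, _, qW, φ, hφ, hrange⟩ := exists_isLatticeEmbedding_range_eq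
    (S.fg_lattice hJA) (fun x hx ↦ (S.isUnimodular_lattice hJA).map_mem hx)
    (S.exists_smul_mem_lattice hJA)
  have key (B : Type _) [CommRing B] [Algebra R B] {t : K} (ht : t ≠ 0) {s : R}
      (hs : IsUnit (algebraMap R B s))
      (hst : algebraMap R K s * t ∈ ((A : Ideal R) : FractionalIdeal R⁰ K))
      (hst' : algebraMap R K s * t⁻¹ ∈ ((A : Ideal R) : FractionalIdeal R⁰ K)⁻¹) :
      Nonempty ((qW.baseChange B).IsometryEquiv (Q.baseChange B)) := by
    refine hφ.nonempty_baseChange_isometryEquiv B hχ (S.scale ht).symm hs (fun w ↦ ?_)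
      fun v ↦ ?_
    · rw [S.scale_symm, hM, ← hJA']
      exact S.smul_scale_mem_lattice (inv_ne_zero ht) hst' (by rwa [inv_inv, inv_inv])
        (hrange ▸ LinearMap.mem_range_self φ w)
    · rw [hrange]
      exact S.smul_scale_mem_lattice ht hst hst' (hM ▸ LinearMap.mem_range_self _ v)
  obtain ⟨g⟩ := hasse W qW
    (by
      obtain ⟨s, hs, hs0⟩ := Submodule.exists_mem_ne_zero_of_ne_bot hA0
      refine key K one_ne_zero (s := s) (by simpa using hs0) ?_ ?_
      · rw [mul_one]
        exact FractionalIdeal.mem_coeIdeal_of_mem _ hs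
      · rw [inv_one, mul_one, FractionalIdeal.mem_inv_iff hA]
        intro y hy
        obtain ⟨r, -, rfl⟩ := (FractionalIdeal.mem_coeIdeal _).mp hy
        rw [← map_mul]
        exact FractionalIdeal.algebraMap_mem_one _)
    fun p ↦ by
      obtain ⟨t, ht, ⟨s, hs, hst, hst'⟩, -⟩ := p.exists_generator (K := K) hA0
      refine key (p.adicCompletionIntegers K) ht ?_ hst hst'
      rw [HeightOneSpectrum.adicCompletionIntegers.isUnit_iff_valued_eq_one]
      exact (p.valuedAdicCompletion_eq_valuation s).trans (p.valuation_eq_one_of_notMem hs)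
  refine S.isSquare_mk0_of_latticeIsometric hq hJ (S.fg_lattice hJ) A ?_
  rw [← hM, ← hrange]
  exact hχ.latticeIsometric hφ g.symm

end HassePrinciple

theorem forall_isSquare_iff_odd_card (G : Type*) [CommGroup G] [Finite G] :
    (∀ a : G, IsSquare a) ↔ Odd (Nat.card G) := by
  constructor
  · intro h
    by_contra hodd
    have hdvd : 2 ∣ Nat.card G := even_iff_two_dvd.mp (Nat.not_odd_iff_even.mp hodd)
    have : Fact (Nat.Prime 2) := ⟨Nat.prime_two⟩
    obtain ⟨x, hx⟩ := exists_prime_orderOf_dvd_card' 2 hdvd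
    have hsurj : Function.Surjective fun a : G ↦ a ^ 2 := fun a ↦ by
      obtain ⟨b, rfl⟩ := h a
      exact ⟨b, sq b⟩
    have hx1 : x = 1 := Finite.injective_iff_surjective.mpr hsurj (by
      simp [← hx, pow_orderOf_eq_one])
    simp [hx1] at hx
  · rintro ⟨k, hk⟩ a
    refine ⟨a ^ (k + 1), ?_⟩
    rw [← pow_add, show k + 1 + (k + 1) = Nat.card G + 1 by omega, pow_succ, pow_card_eq_one',
      one_mul]

end

/-- The local-global Hasse principle holds for a regular isotropic
quadratic `O_S`-space `(V, q)` of rank `≥ 3` — that is, every quadratic `O_S`-space which is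
isomorphic to `(V, q)` over `K` and over `Ô_p` for all `p ∉ S` is already `O_S`-isomorphic
to `(V, q)` (equivalently `|Cl_S(O_V)| = 1`) — if and only if the order of `Pic(O_S)` is
odd.

The Hasse domain `O_S` is realized as a Dedekind domain `R` with fraction field `K`,
identified via `algebraMap R K` with `{x ∈ K : v_p(x) ≥ 0 ∀ p ∉ S}`; its maximal primes
(which correspond to the points `p ∉ S`) form its height-one spectrum, and `Ô_p` is the
corresponding completed valuation ring `adicCompletionIntegers`. -/
theorem hasse_principle_iff_odd_class_number
    (Fq : Type*) [Field Fq] [Fintype Fq] (hq : Odd (Fintype.card Fq))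
    (K : Type*) [Field K] [Algebra Fq K] [Algebra (RatFunc Fq) K] (hK : FunctionField Fq K)
    (Ω : Type*) (v : Ω → AddValuation K (WithTop ℤ))
    (S : Finset Ω) (hS : S.Nonempty)
    -- R = O_S, the Hasse domain, as a Dedekind domain with fraction field K
    (R : Type*) [CommRing R] [IsDomain R] [IsDedekindDomain R]
    [Algebra R K] [IsFractionRing R K]
    (hR : ∀ x : K, x ∈ hasseDomain v S ↔ ∃ r : R, algebraMap R K r = x)
    -- 2 is a unit in O_S (q is odd)
    [Invertible (2 : R)]
    -- (V, q): a regular quadratic O_S-space of rank n ≥ 3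
    (V : Type*) [AddCommGroup V] [Module R V]
    [Module.Projective R V] [Module.Finite R V]
    (Q : QuadraticForm R V)
    (n : ℕ) (hn : 3 ≤ n) (hrank : Module.finrank R V = n)
    (hreg : Function.Bijective (QuadraticMap.polarBilin Q))
    -- which is isotropic
    (hiso : ∃ x : V, x ≠ 0 ∧ Q x = 0) :
    -- Conclusion: the Hasse principle holds for (V, q) iff |Pic(O_S)| is odd
    ((∀ (W : Type u) [AddCommGroup W] [Module R W]
        [Module.Projective R W] [Module.Finite R W]
        (qW : QuadraticForm R W),
        -- W is in the genus of (V, q): isomorphic to it over K ...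
        Nonempty ((qW.baseChange K).IsometryEquiv (Q.baseChange K)) →
        -- ... and over Ô_p for every maximal prime p ∉ S of O_S ...
        (∀ p : HeightOneSpectrum R,
          Nonempty ((qW.baseChange (p.adicCompletionIntegers K)).IsometryEquiv
            (Q.baseChange (p.adicCompletionIntegers K)))) →
        -- ... implies W is O_S-isomorphic to (V, q)
        Nonempty (qW.IsometryEquiv Q))
      ↔ Odd (Nat.card (ClassGroup R))) := by
  have := hK
  have : Finite (ClassGroup R) := ClassGroup.finite_of_functionField (k := Fq) (K := K)
  have : Countable K := FunctionField.countable Fq K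
  rw [← forall_isSquare_iff_odd_card]
  obtain ⟨x, hx0, hx⟩ := hiso
  exact ⟨fun h ↦ isSquare_of_hassePrinciple (hrank ▸ hn) hreg hx0 hx h, fun h W _ _ _ _ _ hKW hp ↦
    nonempty_isometryEquiv_of_forall_isSquare (hrank ▸ hn) hreg hx0 hx h hKW hp⟩
end
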